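/- arXiv:2410.22920 — 2 statements merged into one kernel-verified Lean document; each statement's English description precedes it below -/
import Mathlib

section
/- Local approximation of the IPM velocity for plane-wave densities: for every K ∈ ℕ ∪ {0}, every ε ∈ (0,1), every J ∈ ℕ and each component index j ∈ {1,2}, there exists a constant C > 0, depending only on K, ε, J and g, such that for all N ≥ 1, all a, b, Θ₀ ∈ ℝ with a² + b² = 1, and every f ∈ C^{K+J+2}(ℝ²) with supp f ⊂ B₁(0), setting ρ(x) = f(x)·sin(N(b x₁ + a x₂) + Θ₀), one has ‖u_j(ρ) − u^K_j(ρ)‖_{C^J} ≤ C ( Σ_{i=0}^{K} N^{iε + J + 1 − K} ‖f‖_{C^{K−i+J+1}} + N^{J + 1 − (K+2)ε} ‖f‖_{C^{K+J+2}} ). -/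
open MeasureTheory Real Filter

/-- First spatial partial derivative `∂/∂x₁`. -/
noncomputable def pd1 (f : ℝ × ℝ → ℝ) : ℝ × ℝ → ℝ := fun x => fderiv ℝ f x (1, 0)

/-- Second spatial partial derivative `∂/∂x₂`. -/
noncomputable def pd2 (f : ℝ × ℝ → ℝ) : ℝ × ℝ → ℝ := fun x => fderiv ℝ f x (0, 1)

/-- Mixed partial derivative `∂₁^i ∂₂^j f`. -/
noncomputable def pdMix (i j : ℕ) (f : ℝ × ℝ → ℝ) : ℝ × ℝ → ℝ := pd1^[i] (pd2^[j] f)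

/-- The `C^k` norm: supremum of the absolute values of all partial derivatives
of order at most `k`. -/
noncomputable def CkNorm (k : ℕ) (f : ℝ × ℝ → ℝ) : ℝ :=
  sSup {y : ℝ | ∃ i j : ℕ, ∃ x : ℝ × ℝ, i + j ≤ k ∧ y = |pdMix i j f x|}

/-- The Euclidean norm `|h|` of `h ∈ ℝ²`. -/
noncomputable def rad (h : ℝ × ℝ) : ℝ := Real.sqrt (h.1 ^ 2 + h.2 ^ 2)

/-- A smooth radial cutoff: `C^∞`, nonincreasing on `[0,∞)`, equal to `1` on `(-∞,1/2]`
and to `0` on `[1,∞)`. -/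
def IsCutoff (g : ℝ → ℝ) : Prop :=
  ContDiff ℝ (⊤ : ℕ∞) g ∧ AntitoneOn g (Set.Ici 0) ∧
    (∀ r : ℝ, r ≤ 1 / 2 → g r = 1) ∧ (∀ r : ℝ, 1 ≤ r → g r = 0)

/-- The kernel moment integral `T^{i,j,s}_N` (with `cos(a h₂ + b h₁)`). -/
noncomputable def Tijs (g : ℝ → ℝ) (ε a b : ℝ) (i j : ℕ) (N : ℝ) : ℝ :=
  ∫ h : ℝ × ℝ, (h.1 / (h.1 ^ 2 + h.2 ^ 2))
    * (h.1 ^ (i - j) * h.2 ^ j / ((Nat.factorial (i - j) : ℝ) * (Nat.factorial j : ℝ)))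
    * Real.cos (a * h.2 + b * h.1) * g (N ^ (ε - 1) * rad h)

/-- The kernel moment integral `T^{i,j,c}_N` (with `sin(a h₂ + b h₁)`). -/
noncomputable def Tijc (g : ℝ → ℝ) (ε a b : ℝ) (i j : ℕ) (N : ℝ) : ℝ :=
  ∫ h : ℝ × ℝ, (h.1 / (h.1 ^ 2 + h.2 ^ 2))
    * (h.1 ^ (i - j) * h.2 ^ j / ((Nat.factorial (i - j) : ℝ) * (Nat.factorial j : ℝ)))
    * Real.sin (a * h.2 + b * h.1) * g (N ^ (ε - 1) * rad h)

/-- The operator `V(w)(x) = ∫ (h₁/|h|²) w(x+h) dh`. -/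
noncomputable def Vop (w : ℝ × ℝ → ℝ) : ℝ × ℝ → ℝ :=
  fun x => ∫ h : ℝ × ℝ, (h.1 / (h.1 ^ 2 + h.2 ^ 2)) * w (x + h)

/-- The local approximation `V^K`, for a density with amplitude `f` and phase
`N(b x₁ + a x₂) + Θ₀`, built from the limiting constants `cs i j`, `cc i j`. -/
noncomputable def VKapprox (cs cc : ℕ → ℕ → ℝ) (K : ℕ) (N a b Θ₀ : ℝ)
    (f : ℝ × ℝ → ℝ) : ℝ × ℝ → ℝ :=
  fun x => ∑ i ∈ Finset.range (K + 1), ∑ j ∈ Finset.range (i + 1),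
    (pdMix (i - j) j f x / N ^ (i + 1)) *
      (cs i j * Real.sin (N * (b * x.1 + a * x.2) + Θ₀)
        + cc i j * Real.cos (N * (b * x.1 + a * x.2) + Θ₀))

open scoped ContDiff

namespace IPMVelocity

/-- Directional derivative of `f` along the constant vector `v`. -/
noncomputable def dd (v : ℝ × ℝ) (f : ℝ × ℝ → ℝ) : ℝ × ℝ → ℝ := fun x => fderiv ℝ f x v

lemma pd1_eq_dd : pd1 = dd (1, 0) := rfl

lemma pd2_eq_dd : pd2 = dd (0, 1) := rfl

lemma contDiff_dd {n : ℕ} {f : ℝ × ℝ → ℝ} (v : ℝ × ℝ) (hf : ContDiff ℝ (n + 1 : ℕ) f) :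
    ContDiff ℝ n (dd v f) :=
  (hf.fderiv_right (m := n) (by norm_cast)).clm_apply contDiff_const

lemma differentiable_of_contDiff_succ {n : ℕ} {f : ℝ × ℝ → ℝ}
    (hf : ContDiff ℝ (n + 1 : ℕ) f) : Differentiable ℝ f :=
  hf.differentiable (by norm_cast)

lemma dd_add {f g : ℝ × ℝ → ℝ} (v : ℝ × ℝ) (hf : Differentiable ℝ f) (hg : Differentiable ℝ g) :
    dd v (fun x => f x + g x) = fun x => dd v f x + dd v g x := by
  funext x
  have := ((hf x).hasFDerivAt.add (hg x).hasFDerivAt).fderiv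
  simp only [dd]
  rw [show (fun x => f x + g x) = f + g from rfl, this]
  rfl

lemma dd_const_mul (v : ℝ × ℝ) (c : ℝ) (f : ℝ × ℝ → ℝ) :
    dd v (fun x => c * f x) = fun x => c * dd v f x := by
  funext x
  simp only [dd]
  rw [show (fun x => c * f x) = c • f from rfl, fderiv_const_smul_field]
  rfl

lemma dd_zero_off {S : Set (ℝ × ℝ)} (hS : IsClosed S) {F : ℝ × ℝ → ℝ} (v : ℝ × ℝ)
    (hF : ∀ h ∉ S, F h = 0) : ∀ h ∉ S, dd v F h = 0 := by
  intro h hh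
  have : F =ᶠ[nhds h] fun _ => 0 := by
    filter_upwards [hS.isOpen_compl.mem_nhds hh] with y hy using hF y hy
  simp [dd, this.fderiv_eq]

lemma dd_comm {f : ℝ × ℝ → ℝ} (v w : ℝ × ℝ) (hf : ContDiff ℝ 2 f) :
    dd v (dd w f) = dd w (dd v f) := by
  funext x
  have hd : DifferentiableAt ℝ (fderiv ℝ f) x :=
    ((hf.fderiv_right (m := 1) (by norm_num)).differentiable (by norm_num)) x
  have key : ∀ v w : ℝ × ℝ, dd v (dd w f) x = fderiv ℝ (fderiv ℝ f) x v w := by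
    intro v w
    have h := (hd.hasFDerivAt.clm_apply (hasFDerivAt_const w x)).fderiv
    have h2 : fderiv ℝ (dd w f) x = _ := h
    change fderiv ℝ (dd w f) x v = _
    rw [h2]
    simp
  rw [key, key]
  exact (hf.contDiffAt.isSymmSndFDerivAt (by simp)) v w

lemma contDiff_dd_iterate {n m : ℕ} {f : ℝ × ℝ → ℝ} (v : ℝ × ℝ)
    (hf : ContDiff ℝ (n + m : ℕ) f) : ContDiff ℝ n ((dd v)^[m] f) := by
  induction m generalizing f with
  | zero => exact hf
  | succ m ih =>
    rw [Function.iterate_succ_apply]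
    exact ih (contDiff_dd v hf)

lemma dd_iterate_comm {n : ℕ} {f : ℝ × ℝ → ℝ} (v w : ℝ × ℝ) (hf : ContDiff ℝ (n + 1 : ℕ) f) :
    dd w ((dd v)^[n] f) = (dd v)^[n] (dd w f) := by
  induction n generalizing f with
  | zero => rfl
  | succ n ih =>
    rw [Function.iterate_succ_apply, Function.iterate_succ_apply, ih (contDiff_dd v hf),
      dd_comm w v (hf.of_le (by norm_cast; omega))]

lemma pdMix_pd2 (i j : ℕ) (f : ℝ × ℝ → ℝ) : pdMix i j (pd2 f) = pdMix i (j + 1) f := rfl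

lemma pdMix_pd1 {i j : ℕ} {f : ℝ × ℝ → ℝ} (hf : ContDiff ℝ (j + 1 : ℕ) f) :
    pdMix i j (pd1 f) = pdMix (i + 1) j f := by
  simp only [pdMix, Function.iterate_succ_apply]
  rw [pd1_eq_dd, pd2_eq_dd, dd_iterate_comm _ _ hf]

lemma pd1_pdMix (i j : ℕ) (f : ℝ × ℝ → ℝ) : pd1 (pdMix i j f) = pdMix (i + 1) j f := by
  simp only [pdMix, Function.iterate_succ_apply']

lemma pd2_pdMix {i j : ℕ} {f : ℝ × ℝ → ℝ} (hf : ContDiff ℝ (i + j + 1 : ℕ) f) :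
    pd2 (pdMix i j f) = pdMix i (j + 1) f := by
  simp only [pdMix, Function.iterate_succ_apply']
  rw [pd1_eq_dd, pd2_eq_dd, dd_iterate_comm]
  exact contDiff_dd_iterate _ (hf.of_le (by norm_cast; omega))

lemma contDiff_pdMix {n i j : ℕ} {f : ℝ × ℝ → ℝ} (hf : ContDiff ℝ (n + i + j : ℕ) f) :
    ContDiff ℝ n (pdMix i j f) :=
  contDiff_dd_iterate _ (contDiff_dd_iterate _ hf)

lemma pdMix_const_mul (i j : ℕ) (c : ℝ) (f : ℝ × ℝ → ℝ) :
    pdMix i j (fun x => c * f x) = fun x => c * pdMix i j f x := by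
  have key : ∀ (v : ℝ × ℝ) (n : ℕ) (f : ℝ × ℝ → ℝ),
      (dd v)^[n] (fun x => c * f x) = fun x => c * (dd v)^[n] f x := by
    intro v n
    induction n with
    | zero => intro f; rfl
    | succ n ih =>
      intro f
      rw [Function.iterate_succ_apply, dd_const_mul, ih]
      rfl
  simp only [pdMix, pd1_eq_dd, pd2_eq_dd, key]

/-- `C^n` functions vanishing outside the closed unit disc. -/
structure Adm (n : ℕ) (f : ℝ × ℝ → ℝ) : Prop where
  smooth : ContDiff ℝ n f
  supp : ∀ x : ℝ × ℝ, 1 < x.1 ^ 2 + x.2 ^ 2 → f x = 0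

lemma isClosed_disc : IsClosed {x : ℝ × ℝ | x.1 ^ 2 + x.2 ^ 2 ≤ 1} :=
  isClosed_le (by fun_prop) (by fun_prop)

lemma Adm.dd {n : ℕ} {f : ℝ × ℝ → ℝ} (v : ℝ × ℝ) (hf : Adm (n + 1) f) : Adm n (dd v f) :=
  ⟨contDiff_dd v hf.smooth, fun x hx =>
    dd_zero_off isClosed_disc v (fun y hy => hf.supp y (not_le.mp hy)) x (not_le.mpr hx)⟩

lemma Adm.mono {m n : ℕ} {f : ℝ × ℝ → ℝ} (hf : Adm n f) (h : m ≤ n) : Adm m f :=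
  ⟨hf.smooth.of_le (by exact_mod_cast h), hf.supp⟩

lemma abs_le_of_sq_add_sq_le {x : ℝ × ℝ} {L : ℝ} (hL : 0 ≤ L) (hx : x.1 ^ 2 + x.2 ^ 2 ≤ L ^ 2) :
    |x.1| ≤ L ∧ |x.2| ≤ L :=
  ⟨abs_le_of_sq_le_sq (by nlinarith [sq_nonneg x.2]) hL,
    abs_le_of_sq_le_sq (by nlinarith [sq_nonneg x.1]) hL⟩

lemma hasCompactSupport_of_disc {f : ℝ × ℝ → ℝ}
    (hf : ∀ x : ℝ × ℝ, 1 < x.1 ^ 2 + x.2 ^ 2 → f x = 0) : HasCompactSupport f := by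
  apply HasCompactSupport.of_support_subset_isCompact (isCompact_closedBall (0 : ℝ × ℝ) 1)
  intro x hx
  have h1 : x.1 ^ 2 + x.2 ^ 2 ≤ 1 := by
    by_contra h
    exact hx (hf x (not_le.mp h))
  have h2 := abs_le_of_sq_add_sq_le (L := 1) zero_le_one (by simpa using h1)
  rw [mem_closedBall_zero_iff, Prod.norm_def]
  exact max_le h2.1 h2.2

lemma Adm.hasCompactSupport {n : ℕ} {f : ℝ × ℝ → ℝ} (hf : Adm n f) : HasCompactSupport f :=
  hasCompactSupport_of_disc hf.supp

lemma Adm.dd_iterate {n m : ℕ} {f : ℝ × ℝ → ℝ} (v : ℝ × ℝ) (hf : Adm (n + m) f) :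
    Adm n ((IPMVelocity.dd v)^[m] f) := by
  induction m generalizing f with
  | zero => exact hf
  | succ m ih =>
    rw [Function.iterate_succ_apply]
    exact ih (hf.dd v)

lemma Adm.pdMix {n i j : ℕ} {f : ℝ × ℝ → ℝ} (hf : Adm (n + i + j) f) :
    Adm n (pdMix i j f) :=
  (Adm.dd_iterate (1, 0) (Adm.dd_iterate (0, 1) hf) :)

lemma bddAbove_CkNorm {k : ℕ} {f : ℝ × ℝ → ℝ} (hf : Adm k f) :
    BddAbove {y : ℝ | ∃ i j : ℕ, ∃ x : ℝ × ℝ, i + j ≤ k ∧ y = |_root_.pdMix i j f x|} := by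
  have h1 : ∀ i j : ℕ, ∃ B : ℝ, i + j ≤ k → ∀ x, |_root_.pdMix i j f x| ≤ B := by
    intro i j
    by_cases hij : i + j ≤ k
    · have := Adm.pdMix (n := 0) (i := i) (j := j) (hf.mono (by omega))
      obtain ⟨B, hB⟩ := this.hasCompactSupport.exists_bound_of_continuous this.smooth.continuous
      exact ⟨B, fun _ x => hB x⟩
    · exact ⟨0, fun h => absurd h hij⟩
  choose B hB using h1
  refine ⟨∑ i ∈ Finset.range (k + 1), ∑ j ∈ Finset.range (k + 1), |B i j|, ?_⟩
  rintro y ⟨i, j, x, hij, rfl⟩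
  calc |_root_.pdMix i j f x| ≤ |B i j| := (hB i j hij x).trans (le_abs_self _)
    _ ≤ ∑ j ∈ Finset.range (k + 1), |B i j| :=
      Finset.single_le_sum (f := fun j => |B i j|) (fun _ _ => abs_nonneg _)
        (Finset.mem_range.mpr (by omega))
    _ ≤ _ := Finset.single_le_sum (f := fun i => ∑ j ∈ Finset.range (k + 1), |B i j|)
        (fun _ _ => Finset.sum_nonneg fun _ _ => abs_nonneg _) (Finset.mem_range.mpr (by omega))

lemma abs_pdMix_le_CkNorm {k i j : ℕ} {f : ℝ × ℝ → ℝ} (hf : Adm k f) (hij : i + j ≤ k)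
    (x : ℝ × ℝ) : |pdMix i j f x| ≤ CkNorm k f :=
  le_csSup (bddAbove_CkNorm hf) ⟨i, j, x, hij, rfl⟩

lemma abs_le_CkNorm {k : ℕ} {f : ℝ × ℝ → ℝ} (hf : Adm k f) (x : ℝ × ℝ) : |f x| ≤ CkNorm k f :=
  abs_pdMix_le_CkNorm (i := 0) (j := 0) hf (by omega) x

lemma CkNorm_nonneg (k : ℕ) (f : ℝ × ℝ → ℝ) : 0 ≤ CkNorm k f := by
  apply Real.sSup_nonneg
  rintro y ⟨i, j, x, -, rfl⟩
  exact abs_nonneg _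

lemma CkNorm_le {k : ℕ} {f : ℝ × ℝ → ℝ} {B : ℝ}
    (h : ∀ i j x, i + j ≤ k → |pdMix i j f x| ≤ B) : CkNorm k f ≤ B := by
  apply csSup_le
  · exact ⟨_, 0, 0, 0, by omega, rfl⟩
  · rintro y ⟨i, j, x, hij, rfl⟩
    exact h i j x hij

lemma CkNorm_mono {k l : ℕ} {f : ℝ × ℝ → ℝ} (hf : Adm l f) (hkl : k ≤ l) :
    CkNorm k f ≤ CkNorm l f :=
  CkNorm_le fun _ _ x hij => abs_pdMix_le_CkNorm hf (hij.trans hkl) x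

lemma CkNorm_pd1_le {k : ℕ} {f : ℝ × ℝ → ℝ} (hf : Adm (k + 1) f) :
    CkNorm k (pd1 f) ≤ CkNorm (k + 1) f := by
  refine CkNorm_le fun i j x hij => ?_
  rw [pdMix_pd1 (hf.mono (by omega)).smooth]
  exact abs_pdMix_le_CkNorm hf (by omega) x

lemma CkNorm_pd2_le {k : ℕ} {f : ℝ × ℝ → ℝ} (hf : Adm (k + 1) f) :
    CkNorm k (pd2 f) ≤ CkNorm (k + 1) f := by
  refine CkNorm_le fun i j x hij => ?_
  rw [pdMix_pd2]
  exact abs_pdMix_le_CkNorm hf (by omega) x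

/-- All partial derivatives of `F` of order `l ≤ m` are bounded by `M l` on `B`, whatever the
order in which the derivatives are taken. -/
def DerivBound (B : Set (ℝ × ℝ)) : ℕ → (ℕ → ℝ) → (ℝ × ℝ → ℝ) → Prop
  | 0, M, F => ∀ h ∈ B, |F h| ≤ M 0
  | m + 1, M, F => (∀ h ∈ B, |F h| ≤ M 0) ∧ DerivBound B m (fun l => M (l + 1)) (pd1 F) ∧
      DerivBound B m (fun l => M (l + 1)) (pd2 F)

section DerivBound

variable {B : Set (ℝ × ℝ)} {m : ℕ} {M M' : ℕ → ℝ} {F G : ℝ × ℝ → ℝ}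

lemma DerivBound.le (h : DerivBound B m M F) : ∀ x ∈ B, |F x| ≤ M 0 := by
  cases m with
  | zero => exact h
  | succ m => exact h.1

lemma DerivBound.mono (h : DerivBound B m M F) (hM : ∀ l ≤ m, M l ≤ M' l) :
    DerivBound B m M' F := by
  induction m generalizing M M' F with
  | zero => exact fun x hx => (h x hx).trans (hM 0 le_rfl)
  | succ m ih =>
    exact ⟨fun x hx => (h.1 x hx).trans (hM 0 (by omega)),
      ih h.2.1 fun l hl => hM (l + 1) (by omega), ih h.2.2 fun l hl => hM (l + 1) (by omega)⟩

lemma DerivBound.of_succ (h : DerivBound B (m + 1) M F) : DerivBound B m M F := by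
  induction m generalizing M F with
  | zero => exact h.1
  | succ m ih => exact ⟨h.1, ih h.2.1, ih h.2.2⟩

lemma DerivBound.subset {B' : Set (ℝ × ℝ)} (h : DerivBound B m M F) (hB : B' ⊆ B) :
    DerivBound B' m M F := by
  induction m generalizing M F with
  | zero => exact fun x hx => h x (hB hx)
  | succ m ih => exact ⟨fun x hx => h.1 x (hB hx), ih h.2.1, ih h.2.2⟩

lemma DerivBound.add (hF : DerivBound B m M F) (hG : DerivBound B m M' G)
    (hF' : ContDiff ℝ m F) (hG' : ContDiff ℝ m G) :
    DerivBound B m (fun l => M l + M' l) (fun x => F x + G x) := by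
  induction m generalizing M M' F G with
  | zero => exact fun x hx => (abs_add_le _ _).trans (add_le_add (hF x hx) (hG x hx))
  | succ m ih =>
    refine ⟨fun x hx => (abs_add_le _ _).trans (add_le_add (hF.1 x hx) (hG.1 x hx)), ?_, ?_⟩
    · rw [pd1_eq_dd, dd_add _ (differentiable_of_contDiff_succ hF')
        (differentiable_of_contDiff_succ hG')]
      exact ih hF.2.1 hG.2.1 (contDiff_dd _ hF') (contDiff_dd _ hG')
    · rw [pd2_eq_dd, dd_add _ (differentiable_of_contDiff_succ hF')
        (differentiable_of_contDiff_succ hG')]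
      exact ih hF.2.2 hG.2.2 (contDiff_dd _ hF') (contDiff_dd _ hG')

lemma DerivBound.const_mul (hF : DerivBound B m M F) (c : ℝ) :
    DerivBound B m (fun l => |c| * M l) (fun x => c * F x) := by
  induction m generalizing M F with
  | zero =>
    intro x hx
    rw [abs_mul]
    exact mul_le_mul_of_nonneg_left (hF x hx) (abs_nonneg _)
  | succ m ih =>
    refine ⟨?_, ?_, ?_⟩
    · intro x hx
      rw [abs_mul]
      exact mul_le_mul_of_nonneg_left (hF.1 x hx) (abs_nonneg _)
    · rw [pd1_eq_dd, dd_const_mul]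
      exact ih hF.2.1
    · rw [pd2_eq_dd, dd_const_mul]
      exact ih hF.2.2

lemma DerivBound.abs_pdMix_le {c : ℝ} (hF : DerivBound B m (fun _ => c) F) {i j : ℕ}
    (hij : i + j ≤ m) : ∀ x ∈ B, |pdMix i j F x| ≤ c := by
  have h2 : ∀ (j m : ℕ) (F : ℝ × ℝ → ℝ), DerivBound B (m + j) (fun _ => c) F →
      DerivBound B m (fun _ => c) (pd2^[j] F) := by
    intro j
    induction j with
    | zero => exact fun _ _ h => h
    | succ j ih => exact fun m F h => ih m _ h.2.2
  have h1 : ∀ (j m : ℕ) (F : ℝ × ℝ → ℝ), DerivBound B (m + j) (fun _ => c) F →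
      DerivBound B m (fun _ => c) (pd1^[j] F) := by
    intro j
    induction j with
    | zero => exact fun _ _ h => h
    | succ j ih => exact fun m F h => ih m _ h.2.1
  obtain ⟨n, rfl⟩ := Nat.exists_eq_add_of_le hij
  have : DerivBound B (n + i + j) (fun _ => c) F := by convert! hF using 1; omega
  exact (h1 i n _ (h2 j _ _ this)).le

lemma dd_comp_affine {f : ℝ × ℝ → ℝ} (v x : ℝ × ℝ) (c t : ℝ) (hf : Differentiable ℝ f) :
    dd v (fun h => c * f (x + t • h)) = fun h => (c * t) * dd v f (x + t • h) := by
  rw [dd_const_mul]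
  funext h
  have h1 : HasFDerivAt (fun h : ℝ × ℝ => x + t • h) (t • ContinuousLinearMap.id ℝ (ℝ × ℝ)) h :=
    ((hasFDerivAt_id h).const_smul t).const_add x
  have h2 := ((hf (x + t • h)).hasFDerivAt.comp h h1).fderiv
  have h3 : fderiv ℝ (fun h : ℝ × ℝ => f (x + t • h)) h = _ := h2
  simp only [dd, h3]
  simp
  ring

lemma Adm.derivBound_comp_affine {f : ℝ × ℝ → ℝ} (hf : Adm m f) (x : ℝ × ℝ) {t : ℝ}
    (ht : 0 ≤ t) (c : ℝ) :
    DerivBound Set.univ m (fun l => |c| * (t ^ l * CkNorm l f)) (fun h => c * f (x + t • h)) := by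
  induction m generalizing f c with
  | zero =>
    intro h _
    simp only [abs_mul, pow_zero, one_mul]
    exact mul_le_mul_of_nonneg_left (abs_le_CkNorm hf _) (abs_nonneg _)
  | succ m ih =>
    have hd : Differentiable ℝ f := differentiable_of_contDiff_succ hf.smooth
    have aux : ∀ v : ℝ × ℝ, (∀ l ≤ m, CkNorm l (IPMVelocity.dd v f) ≤ CkNorm (l + 1) f) →
        DerivBound Set.univ m (fun l => |c| * (t ^ (l + 1) * CkNorm (l + 1) f))
          (IPMVelocity.dd v (fun h => c * f (x + t • h))) := by
      intro v hv
      rw [dd_comp_affine v x c t hd]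
      refine (ih (hf.dd v) (c * t)).mono fun l hl => ?_
      rw [abs_mul, abs_of_nonneg ht, pow_succ', mul_assoc, mul_assoc]
      have := hv l hl
      gcongr
    refine ⟨?_, aux _ fun l hl => CkNorm_pd1_le (hf.mono (by omega)),
      aux _ fun l hl => CkNorm_pd2_le (hf.mono (by omega))⟩
    intro h _
    simp only [abs_mul, pow_zero, one_mul]
    exact mul_le_mul_of_nonneg_left (abs_le_CkNorm (hf.mono (Nat.zero_le _)) _) (abs_nonneg _)

lemma derivBound_const_one (B : Set (ℝ × ℝ)) (m : ℕ) :
    DerivBound B m (fun l => if l = 0 then 1 else 0) (fun _ => 1) := by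
  have hz : ∀ m : ℕ, DerivBound B m (fun _ => 0) (fun _ => 0) := by
    intro m
    induction m with
    | zero => intro x _; simp
    | succ m ih =>
      refine ⟨fun x _ => by simp, ?_, ?_⟩
      · convert! ih using 1; funext x; simp [pd1]
      · convert! ih using 1; funext x; simp [pd2]
  cases m with
  | zero => intro x _; simp
  | succ m =>
    refine ⟨fun x _ => by simp, ?_, ?_⟩
    · convert! hz m using 1; funext x; simp [pd1]
    · convert! hz m using 1; funext x; simp [pd2]

end DerivBound

/-- The kernel `h₁ / |h|²`. -/
noncomputable def kern (h : ℝ × ℝ) : ℝ := h.1 / (h.1 ^ 2 + h.2 ^ 2)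

lemma measurable_kern : Measurable kern := by unfold kern; fun_prop

lemma kern_neg (h : ℝ × ℝ) : kern (-h) = -kern h := by
  simp [kern, neg_div]

lemma abs_kern_le (h : ℝ × ℝ) : |kern h| ≤ ‖h‖⁻¹ := by
  rcases eq_or_ne h 0 with rfl | hh
  · simp [kern]
  have hn : 0 < ‖h‖ := norm_pos_iff.mpr hh
  have hpos : 0 < h.1 ^ 2 + h.2 ^ 2 := by
    by_contra hc
    have h1 : h.1 = 0 := by nlinarith [sq_nonneg h.1, sq_nonneg h.2]
    have h2 : h.2 = 0 := by nlinarith [sq_nonneg h.1, sq_nonneg h.2]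
    exact hh (Prod.ext h1 h2)
  rw [kern, abs_div, abs_of_pos hpos, div_le_iff₀ hpos, inv_mul_eq_div, le_div_iff₀ hn,
    Prod.norm_def, ← sq_abs h.1, ← sq_abs h.2]
  simp only [Real.norm_eq_abs]
  rcases max_cases |h.1| |h.2| with ⟨h1, -⟩ | ⟨h1, -⟩ <;> rw [h1] <;>
    nlinarith [sq_nonneg (|h.1| - |h.2|), sq_nonneg (|h.1|), sq_nonneg (|h.2|)]

lemma integrableOn_kern_ball (L : ℝ) : IntegrableOn kern (Metric.ball 0 L) := by
  have h1 : Integrable (fun h : ℝ × ℝ => (Set.Iio L).indicator (fun y => y⁻¹) ‖h‖) := by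
    rw [integrable_fun_norm_addHaar (volume : Measure (ℝ × ℝ))
      (f := (Set.Iio L).indicator (fun y => y⁻¹))]
    have h2 : IntegrableOn (fun _ : ℝ => (1 : ℝ)) (Set.Ioo 0 L) := by
      simp
    have h3 : Integrable ((Set.Ioo 0 L).indicator (fun _ : ℝ => (1 : ℝ))) :=
      (integrable_indicator_iff measurableSet_Ioo).mpr h2
    refine h3.integrableOn.congr_fun ?_ measurableSet_Ioi
    intro y hy
    have hy' : (0 : ℝ) < y := hy
    by_cases hL : y < L <;> simp [hL, hy', hy'.ne', Set.indicator]
  have h4 := h1.integrableOn (s := Metric.ball (0 : ℝ × ℝ) L)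
  refine h4.mono' measurable_kern.aestronglyMeasurable ?_
  refine (ae_restrict_iff' Metric.isOpen_ball.measurableSet).mpr (ae_of_all _ fun h hh => ?_)
  have : ‖h‖ < L := by simpa using hh
  simpa [Set.indicator, this] using abs_kern_le h

lemma locallyIntegrable_kern : LocallyIntegrable kern := by
  rw [locallyIntegrable_iff]
  intro k hk
  obtain ⟨L, hL⟩ := hk.isBounded.subset_ball (0 : ℝ × ℝ)
  exact (integrableOn_kern_ball L).mono_set hL

lemma integrable_kern_mul {w : ℝ × ℝ → ℝ} (hw : Continuous w) (hc : HasCompactSupport w) :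
    Integrable (fun h => kern h * w h) :=
  locallyIntegrable_kern.integrable_smul_right_of_hasCompactSupport hw hc

lemma Vop_eq_convolution (w : ℝ × ℝ → ℝ) :
    Vop w = fun x => -(convolution kern w (ContinuousLinearMap.mul ℝ ℝ) volume x) := by
  funext x
  rw [convolution_def, ← integral_neg_eq_self, ← integral_neg]
  simp [Vop, kern_neg]
  rfl

lemma contDiff_Vop {n : ℕ} {w : ℝ × ℝ → ℝ} (hw : ContDiff ℝ n w) (hc : HasCompactSupport w) :
    ContDiff ℝ n (Vop w) := by
  rw [Vop_eq_convolution]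
  exact (hc.contDiff_convolution_right (n := n) (ContinuousLinearMap.mul ℝ ℝ)
    locallyIntegrable_kern hw).neg

lemma dd_Vop {w : ℝ × ℝ → ℝ} (v : ℝ × ℝ) (hw : ContDiff ℝ 1 w) (hc : HasCompactSupport w) :
    dd v (Vop w) = Vop (dd v w) := by
  funext x
  have h := (hc.hasFDerivAt_convolution_right (ContinuousLinearMap.mul ℝ ℝ)
    locallyIntegrable_kern hw x).neg.fderiv
  have h2 : fderiv ℝ (Vop w) x = -convolution kern (fderiv ℝ w)
      (ContinuousLinearMap.precompR (ℝ × ℝ) (ContinuousLinearMap.mul ℝ ℝ)) volume x := by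
    rw [Vop_eq_convolution]; exact h
  rw [dd, h2, Vop_eq_convolution, neg_apply, convolution_precompR_apply _ locallyIntegrable_kern
    (hc.fderiv ℝ) (hw.continuous_fderiv one_ne_zero)]
  rfl

/-- The square of half-side `2 / r`. -/
def Box (r : ℝ) : Set (ℝ × ℝ) := {h | |r * h.1| ≤ 2 ∧ |r * h.2| ≤ 2}

lemma isClosed_Box (r : ℝ) : IsClosed (Box r) :=
  by
  have h1 : IsClosed {h : ℝ × ℝ | |r * h.1| ≤ 2} := isClosed_le (by fun_prop) (by fun_prop)
  have h2 : IsClosed {h : ℝ × ℝ | |r * h.2| ≤ 2} := isClosed_le (by fun_prop) (by fun_prop)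
  exact h1.inter h2

lemma Box_eq {r : ℝ} (hr : 0 < r) :
    Box r = Set.Icc (-(2 / r)) (2 / r) ×ˢ Set.Icc (-(2 / r)) (2 / r) := by
  ext h
  simp only [Box, Set.mem_ofPred_eq, Set.mem_prod, Set.mem_Icc, ← abs_le, abs_mul, abs_of_pos hr]
  rw [le_div_iff₀' hr, le_div_iff₀' hr]

lemma isCompact_Box {r : ℝ} (hr : 0 < r) : IsCompact (Box r) := by
  rw [Box_eq hr]
  exact isCompact_Icc.prod isCompact_Icc

lemma volume_Box {r : ℝ} (hr : 0 < r) : volume.real (Box r) = 16 * (r ^ 2)⁻¹ := by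
  rw [Box_eq hr, Measure.volume_eq_prod, measureReal_prod_prod, Real.volume_real_Icc,
    max_eq_left (by have : 0 < 2 / r := by positivity
                    linarith)]
  field_simp
  norm_num

lemma abs_sin_phase_le (φ x : ℝ) : ‖Real.sin (φ + x)‖ ≤ 1 := Real.abs_sin_le_one _

lemma comp_smul_eq_zero {η : ℝ × ℝ → ℝ} {r : ℝ} (hη : ∀ h ∉ Box 1, η h = 0) :
    ∀ h ∉ Box r, η (r • h) = 0 := by
  intro h hh
  apply hη
  simpa [Box] using hh

lemma hasCompactSupport_comp_smul {η : ℝ × ℝ → ℝ} {r : ℝ} (hr : 0 < r)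
    (hη : ∀ h ∉ Box 1, η h = 0) : HasCompactSupport (fun h => η (r • h)) :=
  HasCompactSupport.intro (isCompact_Box hr) (comp_smul_eq_zero hη)

lemma integrable_osc {η F : ℝ × ℝ → ℝ} {r : ℝ} (hr : 0 < r) (hη : ∀ h ∉ Box 1, η h = 0)
    (hηc : Continuous η) (hF : Continuous F) (a b φ : ℝ) :
    Integrable (fun h : ℝ × ℝ => η (r • h) * F h * Real.sin (φ + (b * h.1 + a * h.2))) := by
  apply Continuous.integrable_of_hasCompactSupport (by fun_prop)
  have : HasCompactSupport (fun h : ℝ × ℝ => η (r • h) *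
      (F h * Real.sin (φ + (b * h.1 + a * h.2)))) := (hasCompactSupport_comp_smul hr hη).mul_right
  simpa only [mul_assoc] using this

lemma integral_osc_by_parts {η F : ℝ × ℝ → ℝ} {r : ℝ} (hr : 0 < r) (hη : ∀ h ∉ Box 1, η h = 0)
    (hηc : ContDiff ℝ 1 η) (hF : ContDiff ℝ 1 F) {a b : ℝ} (hab : a ^ 2 + b ^ 2 = 1) (φ : ℝ) :
    ∫ h : ℝ × ℝ, η (r • h) * F h * Real.sin (φ + (b * h.1 + a * h.2)) =
      b * r * (∫ h : ℝ × ℝ, pd1 η (r • h) * F h * Real.sin (φ + π / 2 + (b * h.1 + a * h.2))) +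
      b * (∫ h : ℝ × ℝ, η (r • h) * pd1 F h * Real.sin (φ + π / 2 + (b * h.1 + a * h.2))) +
      a * r * (∫ h : ℝ × ℝ, pd2 η (r • h) * F h * Real.sin (φ + π / 2 + (b * h.1 + a * h.2))) +
      a * (∫ h : ℝ × ℝ, η (r • h) * pd2 F h * Real.sin (φ + π / 2 + (b * h.1 + a * h.2))) := by
  have hz : ∀ v, ∀ h ∉ Box 1, dd v η h = 0 := fun v => dd_zero_off (isClosed_Box 1) v hη
  have cη : ∀ v, Continuous (dd v η) := fun v =>
    (contDiff_dd (n := 0) v (by simpa using hηc)).continuous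
  have cF : ∀ v, Continuous (dd v F) := fun v =>
    (contDiff_dd (n := 0) v (by simpa using hF)).continuous
  have dη : Differentiable ℝ η := hηc.differentiable one_ne_zero
  have dF : Differentiable ℝ F := hF.differentiable one_ne_zero
  have i1 := (integrable_osc hr (hz (1, 0)) (cη _) hF.continuous a b (φ + π / 2)).const_mul (b * r)
  have i2 := (integrable_osc hr hη hηc.continuous (cF (1, 0)) a b (φ + π / 2)).const_mul b
  have i3 := (integrable_osc hr (hz (0, 1)) (cη _) hF.continuous a b (φ + π / 2)).const_mul (a * r)
  have i4 := (integrable_osc hr hη hηc.continuous (cF (0, 1)) a b (φ + π / 2)).const_mul a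
  rw [pd1_eq_dd, pd2_eq_dd]
  simp only [← integral_const_mul]
  rw [← integral_add i1 i2, ← integral_add (by exact i1.add i2) i3,
    ← integral_add (by exact (i1.add i2).add i3) i4]
  have fη : ∀ h v, fderiv ℝ (fun h => η (r • h)) h v = r * fderiv ℝ η (r • h) v := by
    intro h v
    have h2 := congrFun (dd_comp_affine v 0 1 r dη) h
    simpa [dd] using h2
  have dηr : Differentiable ℝ (fun h => η (r • h)) := by fun_prop
  have fG : ∀ h, fderiv ℝ (fun h => η (r • h) * F h) h (b, a) =
      b * r * (dd (1, 0) η (r • h) * F h) + b * (η (r • h) * dd (1, 0) F h) +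
      a * r * (dd (0, 1) η (r • h) * F h) + a * (η (r • h) * dd (0, 1) F h) := by
    intro h
    have e : ((b, a) : ℝ × ℝ) = b • (1, 0) + a • (0, 1) := by simp
    rw [fderiv_fun_mul (dηr h) (dF h)]
    simp only [_root_.add_apply, _root_.smul_apply, fη, dd]
    rw [e]
    simp only [map_add, map_smul, smul_eq_mul]
    ring
  have fS : ∀ h : ℝ × ℝ, fderiv ℝ (fun h : ℝ × ℝ => -Real.cos (φ + (b * h.1 + a * h.2))) h (b, a) =
      Real.sin (φ + (b * h.1 + a * h.2)) := by
    intro h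
    have h1 : HasFDerivAt (fun h : ℝ × ℝ => φ + (b * h.1 + a * h.2))
        (b • ContinuousLinearMap.fst ℝ ℝ ℝ + a • ContinuousLinearMap.snd ℝ ℝ ℝ) h :=
      ((hasFDerivAt_fst.const_mul b).add (hasFDerivAt_snd.const_mul a)).const_add φ
    have h2 := h1.cos.fun_neg.fderiv
    rw [h2]
    simp
    linear_combination (Real.sin (φ + (b * h.1 + a * h.2))) * hab
  have hcG : HasCompactSupport (fun h => η (r • h) * F h) :=
    (hasCompactSupport_comp_smul hr hη).mul_right
  have cG : Continuous (fun h => η (r • h) * F h) := by fun_prop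
  have hsum : ∀ h : ℝ × ℝ, fderiv ℝ (fun h => η (r • h) * F h) h (b, a) *
      -Real.cos (φ + (b * h.1 + a * h.2)) = -(b * r * (dd (1, 0) η (r • h) * F h *
        Real.sin (φ + π / 2 + (b * h.1 + a * h.2))) +
        b * (η (r • h) * dd (1, 0) F h * Real.sin (φ + π / 2 + (b * h.1 + a * h.2))) +
        a * r * (dd (0, 1) η (r • h) * F h * Real.sin (φ + π / 2 + (b * h.1 + a * h.2))) +
        a * (η (r • h) * dd (0, 1) F h * Real.sin (φ + π / 2 + (b * h.1 + a * h.2)))) := by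
    intro h
    rw [fG, show φ + π / 2 + (b * h.1 + a * h.2) = (φ + (b * h.1 + a * h.2)) + π / 2 by ring,
      Real.sin_add_pi_div_two]
    ring
  have parts := integral_mul_fderiv_eq_neg_fderiv_mul_of_integrable (μ := (volume : Measure (ℝ × ℝ)))
    (f := fun h => η (r • h) * F h) (g := fun h : ℝ × ℝ => -Real.cos (φ + (b * h.1 + a * h.2)))
    (v := (b, a)) ?_ ?_ ?_ (fun x _ => (dηr x).mul (dF x)) (fun x _ => by fun_prop)
  · simp only [fS, hsum, integral_neg, neg_neg] at parts
    exact parts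
  · simp only [hsum]
    exact (((i1.add i2).add i3).add i4).neg
  · simp only [fS]
    exact integrable_osc hr hη hηc.continuous hF.continuous a b φ
  · exact Continuous.integrable_of_hasCompactSupport (by fun_prop) hcG.mul_right

lemma oscillatory_bound (m : ℕ) (η : ℝ × ℝ → ℝ) (hηc : ContDiff ℝ ∞ η)
    (hη : ∀ h ∉ Box 1, η h = 0) :
    ∃ C, 0 ≤ C ∧ ∀ r > 0, ∀ a b φ : ℝ, a ^ 2 + b ^ 2 = 1 → ∀ S : Set (ℝ × ℝ), IsClosed S →
      ∀ F : ℝ × ℝ → ℝ, ContDiff ℝ m F → (∀ h ∉ S, F h = 0) → ∀ M : ℕ → ℝ, (∀ l, 0 ≤ M l) →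
      DerivBound (Box r) m M F →
      |∫ h : ℝ × ℝ, η (r • h) * F h * Real.sin (φ + (b * h.1 + a * h.2))| ≤
        C * volume.real (S ∩ Box r) * ∑ l ∈ Finset.range (m + 1), r ^ (m - l) * M l := by
  induction m generalizing η with
  | zero =>
    have hc : HasCompactSupport η := HasCompactSupport.intro (isCompact_Box one_pos) hη
    obtain ⟨C, hC⟩ := hc.exists_bound_of_continuous hηc.continuous
    have hC0 : 0 ≤ C := (norm_nonneg _).trans (hC 0)
    refine ⟨C, hC0, fun r hr a b φ _ S hS F hF hFS M hM hD => ?_⟩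
    have hsupp : ∀ h ∉ S ∩ Box r,
        η (r • h) * F h * Real.sin (φ + (b * h.1 + a * h.2)) = 0 := by
      intro h hh
      by_cases h1 : h ∈ S
      · rw [comp_smul_eq_zero hη h fun h2 => hh ⟨h1, h2⟩]; ring
      · rw [hFS h h1]; ring
    rw [← setIntegral_eq_integral_of_forall_compl_eq_zero hsupp]
    have hfin : volume (S ∩ Box r) < ⊤ :=
      (measure_mono Set.inter_subset_right).trans_lt (isCompact_Box hr).measure_lt_top
    rw [← Real.norm_eq_abs]
    refine (norm_setIntegral_le_of_norm_le_const (C := C * M 0) hfin ?_).trans (le_of_eq ?_)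
    · intro h hh
      rw [norm_mul, norm_mul]
      calc _ ≤ (C * M 0) * 1 := by
            have := hC (r • h)
            have := hD h hh.2
            have := abs_sin_phase_le φ (b * h.1 + a * h.2)
            have := hM 0
            rw [Real.norm_eq_abs (F h)]
            gcongr
        _ = C * M 0 := mul_one _
    · simp
      ring
  | succ m ih =>
    obtain ⟨C0, hC0, h0⟩ := ih η hηc hη
    have hd : ∀ v, ContDiff ℝ ∞ (dd v η) := fun v =>
      (hηc.fderiv_right (m := ∞) (by simp)).clm_apply contDiff_const
    obtain ⟨C1, hC1, h1⟩ := ih (pd1 η) (hd _) (dd_zero_off (isClosed_Box 1) (1, 0) hη)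
    obtain ⟨C2, hC2, h2⟩ := ih (pd2 η) (hd _) (dd_zero_off (isClosed_Box 1) (0, 1) hη)
    refine ⟨C1 + C2 + 2 * C0, by positivity, fun r hr a b φ hab S hS F hF hFS M hM hD => ?_⟩
    have hF1 : ContDiff ℝ m F := hF.of_le (by norm_cast; omega)
    rw [integral_osc_by_parts hr hη (hηc.of_le (by exact_mod_cast le_top))
      (hF.of_le (by norm_cast; omega)) hab φ]
    have e1 := h1 r hr a b (φ + π / 2) hab S hS F hF1 hFS M hM hD.of_succ
    have e2 := h0 r hr a b (φ + π / 2) hab S hS (pd1 F) (contDiff_dd _ hF)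
      (dd_zero_off hS _ hFS) (fun l => M (l + 1)) (fun l => hM _) hD.2.1
    have e3 := h2 r hr a b (φ + π / 2) hab S hS F hF1 hFS M hM hD.of_succ
    have e4 := h0 r hr a b (φ + π / 2) hab S hS (pd2 F) (contDiff_dd _ hF)
      (dd_zero_off hS _ hFS) (fun l => M (l + 1)) (fun l => hM _) hD.2.2
    set V := volume.real (S ∩ Box r)
    have hV : 0 ≤ V := measureReal_nonneg
    set T := ∑ l ∈ Finset.range (m + 1 + 1), r ^ (m + 1 - l) * M l with hT
    have t1 : r * ∑ l ∈ Finset.range (m + 1), r ^ (m - l) * M l ≤ T := by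
      rw [hT, Finset.sum_range_succ _ (m + 1), Finset.mul_sum]
      have : ∑ l ∈ Finset.range (m + 1), r * (r ^ (m - l) * M l) =
          ∑ l ∈ Finset.range (m + 1), r ^ (m + 1 - l) * M l := by
        refine Finset.sum_congr rfl fun l hl => ?_
        rw [Nat.sub_add_comm (Nat.lt_succ_iff.mp (Finset.mem_range.mp hl)), pow_succ']
        ring
      rw [this]
      have := hM (m + 1)
      exact le_add_of_nonneg_right (by positivity)
    have t2 : ∑ l ∈ Finset.range (m + 1), r ^ (m - l) * M (l + 1) ≤ T := by
      rw [hT, Finset.sum_range_succ' _ (m + 1)]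
      have := hM 0
      simp only [Nat.add_sub_add_right]
      exact le_add_of_nonneg_right (by positivity)
    have ha : |a| ≤ 1 := abs_le_one_iff_mul_self_le_one.mpr (by nlinarith [sq_nonneg b])
    have hb : |b| ≤ 1 := abs_le_one_iff_mul_self_le_one.mpr (by nlinarith [sq_nonneg a])
    have key : ∀ {c X Y : ℝ}, |c| ≤ 1 → |X| ≤ Y → |c * X| ≤ Y := by
      intro c X Y hc hX
      rw [abs_mul]
      exact (mul_le_of_le_one_left (abs_nonneg _) hc).trans hX
    have f1 := key hb ((abs_mul r _).trans_le (mul_le_mul_of_nonneg_left e1 (abs_nonneg r)))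
    have f3 := key ha ((abs_mul r _).trans_le (mul_le_mul_of_nonneg_left e3 (abs_nonneg r)))
    have f2 := key hb e2
    have f4 := key ha e4
    rw [abs_of_pos hr] at f1 f3
    rw [mul_assoc b r, mul_assoc a r]
    have g1 := mul_le_mul_of_nonneg_left t1 (mul_nonneg hC1 hV)
    have g3 := mul_le_mul_of_nonneg_left t1 (mul_nonneg hC2 hV)
    have g2 := mul_le_mul_of_nonneg_left t2 (mul_nonneg hC0 hV)
    refine (abs_add_le _ _).trans ((add_le_add_left ((abs_add_le _ _).trans
      (add_le_add_left (abs_add_le _ _) _)) _).trans ?_)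
    linarith

lemma rad_nonneg (h : ℝ × ℝ) : 0 ≤ rad h := Real.sqrt_nonneg _

lemma abs_fst_le_rad (h : ℝ × ℝ) : |h.1| ≤ rad h :=
  Real.abs_le_sqrt (by nlinarith [sq_nonneg h.2])

lemma abs_snd_le_rad (h : ℝ × ℝ) : |h.2| ≤ rad h :=
  Real.abs_le_sqrt (by nlinarith [sq_nonneg h.1])

lemma rad_smul {s : ℝ} (hs : 0 ≤ s) (h : ℝ × ℝ) : rad (s • h) = s * rad h := by
  simp only [rad, Prod.smul_fst, Prod.smul_snd, smul_eq_mul]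
  rw [show (s * h.1) ^ 2 + (s * h.2) ^ 2 = s ^ 2 * (h.1 ^ 2 + h.2 ^ 2) by ring,
    Real.sqrt_mul (sq_nonneg s), Real.sqrt_sq hs]

lemma continuous_rad : Continuous rad := by unfold rad; fun_prop

lemma kern_smul (s : ℝ) (h : ℝ × ℝ) : kern (s • h) = s⁻¹ * kern h := by
  rcases eq_or_ne s 0 with rfl | hs
  · simp [kern]
  simp only [kern, Prod.smul_fst, Prod.smul_snd, smul_eq_mul]
  rw [show (s * h.1) ^ 2 + (s * h.2) ^ 2 = s ^ 2 * (h.1 ^ 2 + h.2 ^ 2) by ring]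
  field_simp

section Cutoff

variable {g : ℝ → ℝ}

lemma _root_.IsCutoff.continuous (hg : IsCutoff g) : Continuous g := hg.1.continuous

lemma _root_.IsCutoff.abs_le_one (hg : IsCutoff g) {r : ℝ} (hr : 0 ≤ r) : |g r| ≤ 1 := by
  rw [abs_le]
  have h1 : g r ≤ 1 := by
    have := hg.2.1 (Set.mem_Ici.mpr le_rfl) (Set.mem_Ici.mpr hr) hr
    rwa [hg.2.2.1 0 (by norm_num)] at this
  have h0 : 0 ≤ g r := by
    have := hg.2.1 (Set.mem_Ici.mpr hr) (Set.mem_Ici.mpr (by positivity : 0 ≤ r + 1))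
      (by linarith : r ≤ r + 1)
    rwa [hg.2.2.2 (r + 1) (by linarith)] at this
  constructor <;> linarith

lemma two_lt_mul_rad_of_notMem_Box {r : ℝ} (hr : 0 ≤ r) {h : ℝ × ℝ} (hh : h ∉ Box r) :
    2 < r * rad h := by
  by_contra! hc
  refine hh ⟨?_, ?_⟩
  · rw [abs_mul, abs_of_nonneg hr]
    exact (mul_le_mul_of_nonneg_left (abs_fst_le_rad h) hr).trans hc
  · rw [abs_mul, abs_of_nonneg hr]
    exact (mul_le_mul_of_nonneg_left (abs_snd_le_rad h) hr).trans hc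

lemma hasCompactSupport_cutoff (hg : IsCutoff g) {r : ℝ} (hr : 0 < r) :
    HasCompactSupport (fun h : ℝ × ℝ => g (r * rad h)) :=
  HasCompactSupport.intro (isCompact_Box hr) fun h hh =>
    hg.2.2.2 _ (by linarith [two_lt_mul_rad_of_notMem_Box hr.le hh])

/-- A dyadic piece of the kernel moment of multi-index `(p, q)`. -/
noncomputable def dyad (g : ℝ → ℝ) (p q : ℕ) (h : ℝ × ℝ) : ℝ :=
  kern h * (h.1 ^ p * h.2 ^ q) * (g (rad h / 2) - g (rad h))

lemma dyad_eq_zero (hg : IsCutoff g) (p q : ℕ) : ∀ h ∉ Box 1, dyad g p q h = 0 := by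
  intro h hh
  have := two_lt_mul_rad_of_notMem_Box zero_le_one hh
  rw [dyad, hg.2.2.2 (rad h) (by linarith), hg.2.2.2 (rad h / 2) (by linarith)]
  simp

lemma contDiff_dyad (hg : IsCutoff g) (p q : ℕ) : ContDiff ℝ ∞ (dyad g p q) := by
  rw [contDiff_iff_contDiffAt]
  intro h
  rcases lt_or_ge (rad h) (1 / 2) with hh | hh
  · have : dyad g p q =ᶠ[nhds h] fun _ => 0 := by
      filter_upwards [continuous_rad.continuousAt.eventually_lt continuousAt_const hh] with y hy
      rw [dyad, hg.2.2.1 (rad y) hy.le, hg.2.2.1 (rad y / 2) (by linarith [rad_nonneg y])]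
      simp
    exact contDiffAt_const.congr_of_eventuallyEq this
  · have hpos : h.1 ^ 2 + h.2 ^ 2 ≠ 0 := by
      intro h0
      rw [rad, h0, Real.sqrt_zero] at hh
      norm_num at hh
    have hrad : ContDiffAt ℝ ∞ rad h := by
      unfold rad
      exact ContDiffAt.sqrt (by fun_prop) hpos
    have hk : ContDiffAt ℝ ∞ kern h := by
      unfold kern
      exact ContDiffAt.div (by fun_prop) (by fun_prop) hpos
    have h1 : ContDiffAt ℝ ∞ (fun y => g (rad y)) h := hg.1.contDiffAt.comp h hrad
    have h2 : ContDiffAt ℝ ∞ (fun y => g (rad y / 2)) h :=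
      hg.1.contDiffAt.comp h (hrad.div_const 2)
    unfold dyad
    exact (hk.mul (by fun_prop)).mul (h2.sub h1)

lemma kern_mul_cutoff_sub {r : ℝ} (hr : 0 < r) (p q : ℕ) (h : ℝ × ℝ) :
    kern h * (h.1 ^ p * h.2 ^ q) * (g (r / 2 * rad h) - g (r * rad h)) =
      r * r⁻¹ ^ (p + q) * dyad g p q (r • h) := by
  rw [dyad, kern_smul, rad_smul hr.le, Prod.smul_fst, Prod.smul_snd, smul_eq_mul, smul_eq_mul,
    mul_pow, mul_pow, show r * rad h / 2 = r / 2 * rad h by ring, pow_add, inv_pow, inv_pow]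
  field_simp

/-- The truncated oscillatory moment of the kernel at scale `r⁻¹`. -/
noncomputable def oscMoment (g : ℝ → ℝ) (a b φ : ℝ) (p q : ℕ) (r : ℝ) : ℝ :=
  ∫ h : ℝ × ℝ, kern h * (h.1 ^ p * h.2 ^ q) * g (r * rad h) * Real.sin (φ + (b * h.1 + a * h.2))

lemma integrable_kern_cutoff (hg : IsCutoff g) {r : ℝ} (hr : 0 < r) {G : ℝ × ℝ → ℝ}
    (hG : Continuous G) : Integrable (fun h : ℝ × ℝ => kern h * G h * g (r * rad h)) := by
  have hgc : Continuous fun h : ℝ × ℝ => g (r * rad h) :=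
    hg.continuous.comp (continuous_rad.const_mul r)
  have := integrable_kern_mul (hG.mul hgc) (hasCompactSupport_cutoff hg hr).mul_left
  refine this.congr (ae_of_all _ fun h => ?_)
  simp only [Pi.mul_apply]
  ring

lemma integrable_oscMoment (hg : IsCutoff g) {r : ℝ} (hr : 0 < r) (a b φ : ℝ) (p q : ℕ) :
    Integrable (fun h : ℝ × ℝ => kern h * (h.1 ^ p * h.2 ^ q) * g (r * rad h) *
      Real.sin (φ + (b * h.1 + a * h.2))) := by
  refine (integrable_kern_cutoff hg hr (G := fun h => (h.1 ^ p * h.2 ^ q) *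
    Real.sin (φ + (b * h.1 + a * h.2))) (by fun_prop)).congr (ae_of_all _ fun h => ?_)
  simp only
  ring

lemma Tijs_eq (g : ℝ → ℝ) (ε a b : ℝ) (i j : ℕ) (N : ℝ) :
    Tijs g ε a b i j N =
      oscMoment g a b (π / 2) (i - j) j (N ^ (ε - 1)) / ((i - j).factorial * j.factorial) := by
  rw [Tijs, oscMoment, ← integral_div]
  congr 1
  funext h
  rw [kern, show π / 2 + (b * h.1 + a * h.2) = (a * h.2 + b * h.1) + π / 2 by ring,
    Real.sin_add_pi_div_two]
  ring

lemma Tijc_eq (g : ℝ → ℝ) (ε a b : ℝ) (i j : ℕ) (N : ℝ) :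
    Tijc g ε a b i j N =
      oscMoment g a b 0 (i - j) j (N ^ (ε - 1)) / ((i - j).factorial * j.factorial) := by
  rw [Tijc, oscMoment, ← integral_div]
  congr 1
  funext h
  rw [kern, show 0 + (b * h.1 + a * h.2) = (a * h.2 + b * h.1) by ring]
  ring

lemma oscMoment_half_sub (hg : IsCutoff g) {r : ℝ} (hr : 0 < r) (a b φ : ℝ) (p q : ℕ) :
    oscMoment g a b φ p q (r / 2) - oscMoment g a b φ p q r =
      r * r⁻¹ ^ (p + q) *
        ∫ h : ℝ × ℝ, dyad g p q (r • h) * 1 * Real.sin (φ + (b * h.1 + a * h.2)) := by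
  rw [oscMoment, oscMoment, ← integral_sub (integrable_oscMoment hg (half_pos hr) a b φ p q)
    (integrable_oscMoment hg hr a b φ p q), ← integral_const_mul]
  congr 1
  funext h
  linear_combination (Real.sin (φ + (b * h.1 + a * h.2))) * kern_mul_cutoff_sub (g := g) hr p q h

lemma exists_oscMoment_half_bound (hg : IsCutoff g) (p q K : ℕ) (hK : p + q ≤ K) :
    ∃ C, 0 ≤ C ∧ ∀ r > 0, ∀ a b φ : ℝ, a ^ 2 + b ^ 2 = 1 →
      |oscMoment g a b φ p q (r / 2) - oscMoment g a b φ p q r| ≤ C * r ^ (K + 1 - (p + q)) := by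
  obtain ⟨C, hC, h⟩ := oscillatory_bound (K + 2) (dyad g p q) (contDiff_dyad hg p q)
    (dyad_eq_zero hg p q)
  refine ⟨16 * C, by positivity, fun r hr a b φ hab => ?_⟩
  have h1 := h r hr a b φ hab Set.univ isClosed_univ (fun _ => 1) contDiff_const (by simp)
    (fun l => if l = 0 then 1 else 0) (fun l => by split_ifs <;> norm_num)
    (derivBound_const_one _ _)
  rw [Set.univ_inter, volume_Box hr] at h1
  have h2 : ∑ l ∈ Finset.range (K + 2 + 1), r ^ (K + 2 - l) * (if l = 0 then (1 : ℝ) else 0) =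
      r ^ (K + 2) := by
    simp
  rw [h2] at h1
  rw [oscMoment_half_sub hg hr, abs_mul, abs_of_pos (by positivity)]
  refine (mul_le_mul_of_nonneg_left h1 (by positivity)).trans (le_of_eq ?_)
  obtain ⟨e, rfl⟩ := Nat.exists_eq_add_of_le hK
  rw [show p + q + e + 1 - (p + q) = e + 1 by omega, inv_pow, pow_add r (p + q + e),
    pow_add r (p + q) e]
  field_simp
  ring

lemma exists_oscMoment_tail_bound (hg : IsCutoff g) (p q K : ℕ) (hK : p + q ≤ K) :
    ∃ C, 0 ≤ C ∧ ∀ r > 0, ∀ a b φ c : ℝ, a ^ 2 + b ^ 2 = 1 →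
      Tendsto (oscMoment g a b φ p q) (nhdsWithin 0 (Set.Ioi 0)) (nhds c) →
      |oscMoment g a b φ p q r - c| ≤ C * r ^ (K + 1 - (p + q)) := by
  obtain ⟨C, hC, h⟩ := exists_oscMoment_half_bound hg p q K hK
  refine ⟨2 * C, by positivity, fun r hr a b φ c hab ht => ?_⟩
  have hlim : Tendsto (fun n : ℕ => r / 2 ^ n) atTop (nhdsWithin 0 (Set.Ioi 0)) := by
    rw [tendsto_nhdsWithin_iff]
    refine ⟨?_, Eventually.of_forall fun n => ?_⟩
    · have := (tendsto_pow_atTop_nhds_zero_of_lt_one (r := (1 / 2 : ℝ)) (by norm_num)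
        (by norm_num)).const_mul r
      simpa [div_eq_mul_inv] using this
    · exact Set.mem_Ioi.mpr (by positivity)
  have key := dist_le_of_le_geometric_two_of_tendsto₀ (C := 2 * C * r ^ (K + 1 - (p + q)))
    (f := fun n : ℕ => oscMoment g a b φ p q (r / 2 ^ n)) (a := c) ?_ (ht.comp hlim)
  · simpa [Real.dist_eq] using key
  · intro n
    rw [dist_comm, Real.dist_eq, pow_succ, ← div_div]
    refine (h (r / 2 ^ n) (by positivity) a b φ hab).trans ?_
    rw [div_pow, show 2 * C * r ^ (K + 1 - (p + q)) / 2 / 2 ^ n =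
      C * (r ^ (K + 1 - (p + q)) / 2 ^ n) by ring]
    gcongr
    exact le_self_pow₀ (one_le_pow₀ one_le_two) (by omega)

lemma tendsto_of_tendsto_rpow {ε : ℝ} (hε : ε < 1) {G : ℝ → ℝ} {c : ℝ}
    (h : Tendsto (fun M : ℝ => G (M ^ (ε - 1))) atTop (nhds c)) :
    Tendsto G (nhdsWithin 0 (Set.Ioi 0)) (nhds c) := by
  have h1 : Tendsto (fun s : ℝ => s ^ (ε - 1)⁻¹) (nhdsWithin 0 (Set.Ioi 0)) atTop :=
    tendsto_rpow_neg_nhdsGT_zero (inv_lt_zero.mpr (by linarith))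
  refine (h.comp h1).congr' ?_
  filter_upwards [self_mem_nhdsWithin] with s hs
  have hs : (0 : ℝ) < s := hs
  simp only [Function.comp]
  rw [← Real.rpow_mul hs.le, inv_mul_cancel₀ (by linarith), Real.rpow_one]

/-- Distance between the truncated moments and their limits. -/
lemma exists_T_tail_bound (hg : IsCutoff g) {ε : ℝ} (hε : ε < 1) (K : ℕ) :
    ∃ C, 0 ≤ C ∧ ∀ N > 0, ∀ a b : ℝ, a ^ 2 + b ^ 2 = 1 → ∀ i ≤ K, ∀ j ≤ i, ∀ cs cc : ℝ,
      (Tendsto (fun M : ℝ => Tijs g ε a b i j M) atTop (nhds cs) →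
        |Tijs g ε a b i j N - cs| ≤ C * (N ^ (ε - 1)) ^ (K + 1 - i)) ∧
      (Tendsto (fun M : ℝ => Tijc g ε a b i j M) atTop (nhds cc) →
        |Tijc g ε a b i j N - cc| ≤ C * (N ^ (ε - 1)) ^ (K + 1 - i)) := by
  have hex : ∀ p q : ℕ, ∃ C, 0 ≤ C ∧ (p + q ≤ K → ∀ r > 0, ∀ a b φ c : ℝ, a ^ 2 + b ^ 2 = 1 →
      Tendsto (oscMoment g a b φ p q) (nhdsWithin 0 (Set.Ioi 0)) (nhds c) →
      |oscMoment g a b φ p q r - c| ≤ C * r ^ (K + 1 - (p + q))) := by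
    intro p q
    by_cases hpq : p + q ≤ K
    · obtain ⟨C, hC, h⟩ := exists_oscMoment_tail_bound hg p q K hpq
      exact ⟨C, hC, fun _ => h⟩
    · exact ⟨0, le_rfl, fun h => absurd h hpq⟩
  choose C hC h using hex
  refine ⟨∑ p ∈ Finset.range (K + 1), ∑ q ∈ Finset.range (K + 1), C p q,
    Finset.sum_nonneg fun p _ => Finset.sum_nonneg fun q _ => hC p q, ?_⟩
  intro N hN a b hab i hi j hj cs cc
  have hle : C (i - j) j ≤ ∑ p ∈ Finset.range (K + 1), ∑ q ∈ Finset.range (K + 1), C p q :=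
    (Finset.single_le_sum (f := fun q => C (i - j) q) (fun q _ => hC _ q)
      (Finset.mem_range.mpr (by omega))).trans
    (Finset.single_le_sum (f := fun p => ∑ q ∈ Finset.range (K + 1), C p q)
      (fun p _ => Finset.sum_nonneg fun q _ => hC p q) (Finset.mem_range.mpr (by omega)))
  have hD : (1 : ℝ) ≤ (i - j).factorial * j.factorial := by
    exact_mod_cast Nat.one_le_iff_ne_zero.mpr
      (mul_ne_zero (Nat.factorial_ne_zero _) (Nat.factorial_ne_zero _))
  have hr : 0 < N ^ (ε - 1) := Real.rpow_pos_of_pos hN _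
  have main : ∀ φ c : ℝ, Tendsto (fun M : ℝ => oscMoment g a b φ (i - j) j (M ^ (ε - 1)) /
      ((i - j).factorial * j.factorial)) atTop (nhds c) →
      |oscMoment g a b φ (i - j) j (N ^ (ε - 1)) / ((i - j).factorial * j.factorial) - c| ≤
        (∑ p ∈ Finset.range (K + 1), ∑ q ∈ Finset.range (K + 1), C p q) *
          (N ^ (ε - 1)) ^ (K + 1 - i) := by
    intro φ c ht
    set D : ℝ := (i - j).factorial * j.factorial
    have hD0 : D ≠ 0 := by positivity
    have ht' : Tendsto (fun M : ℝ => oscMoment g a b φ (i - j) j (M ^ (ε - 1))) atTop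
        (nhds (c * D)) := by
      simpa [div_mul_cancel₀ _ hD0] using ht.mul_const D
    have h1 := h (i - j) j (by omega) _ hr a b φ (c * D) hab (tendsto_of_tendsto_rpow hε ht')
    rw [show i - j + j = i by omega] at h1
    rw [div_sub' hD0, abs_div, abs_of_pos (by positivity : 0 < D), mul_comm D c]
    refine (div_le_self (abs_nonneg _) hD).trans (h1.trans ?_)
    gcongr
  simp only [Tijs_eq, Tijc_eq]
  exact ⟨main _ _, main _ _⟩

end Cutoff

/-- The antiderivative normalised monomial `t ^ p / p!`. -/
noncomputable def mono (p : ℕ) (t : ℝ) : ℝ := t ^ p / p.factorial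

/-- The derivative of `mono p`. -/
noncomputable def mono' : ℕ → ℝ → ℝ
  | 0 => fun _ => 0
  | p + 1 => mono p

lemma hasDerivAt_mono (p : ℕ) (t : ℝ) : HasDerivAt (mono p) (mono' p t) t := by
  cases p with
  | zero =>
    have : mono 0 = fun _ => 1 := by funext; simp [mono]
    rw [this]
    exact hasDerivAt_const t 1
  | succ p =>
    refine ((hasDerivAt_pow (p + 1) t).div_const _).congr_deriv ?_
    have : (p.factorial : ℝ) ≠ 0 := by positivity
    simp only [mono', mono, Nat.factorial_succ, Nat.cast_mul]
    rw [Nat.add_sub_cancel, mul_div_mul_left]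
    positivity

/-- The polynomial of degree less than `n` with Taylor coefficients `A`. -/
noncomputable def tay (n : ℕ) (A : ℕ → ℕ → ℝ) (h : ℝ × ℝ) : ℝ :=
  ∑ i ∈ Finset.range n, ∑ p ∈ Finset.HasAntidiagonal.antidiagonal i, A p.1 p.2 * (mono p.1 h.1 * mono p.2 h.2)

lemma tay_congr {n : ℕ} {A B : ℕ → ℕ → ℝ} (h : ∀ p q, p + q < n → A p q = B p q) :
    tay n A = tay n B := by
  funext y
  refine Finset.sum_congr rfl fun i hi => Finset.sum_congr rfl fun p hp => ?_
  rw [h p.1 p.2 (by rw [Finset.HasAntidiagonal.mem_antidiagonal.mp hp]; exact Finset.mem_range.mp hi)]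

lemma tay_succ_zero (n : ℕ) (A : ℕ → ℕ → ℝ) : tay (n + 1) A 0 = A 0 0 := by
  rw [tay, Finset.sum_range_succ', Finset.sum_eq_zero]
  · simp [mono]
  · intro i _
    refine Finset.sum_eq_zero fun p hp => ?_
    have := Finset.HasAntidiagonal.mem_antidiagonal.mp hp
    rcases Nat.eq_zero_or_pos p.1 with h1 | h1
    · have : p.2 ≠ 0 := by omega
      simp [mono, this]
    · simp [mono, h1.ne']

lemma hasFDerivAt_tay (n : ℕ) (A : ℕ → ℕ → ℝ) (h : ℝ × ℝ) :
    HasFDerivAt (tay (n + 1) A)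
      (tay n (fun p q => A (p + 1) q) h • ContinuousLinearMap.fst ℝ ℝ ℝ +
        tay n (fun p q => A p (q + 1)) h • ContinuousLinearMap.snd ℝ ℝ ℝ) h := by
  have hm : ∀ p q : ℕ, HasFDerivAt (fun y : ℝ × ℝ => A p q * (mono p y.1 * mono q y.2))
      ((A p q * (mono' p h.1 * mono q h.2)) • ContinuousLinearMap.fst ℝ ℝ ℝ +
        (A p q * (mono p h.1 * mono' q h.2)) • ContinuousLinearMap.snd ℝ ℝ ℝ) h := by
    intro p q
    have h1 : HasFDerivAt (fun y : ℝ × ℝ => mono p y.1)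
        (mono' p h.1 • ContinuousLinearMap.fst ℝ ℝ ℝ) h :=
      (hasDerivAt_mono p h.1).comp_hasFDerivAt h hasFDerivAt_fst
    have h2 : HasFDerivAt (fun y : ℝ × ℝ => mono q y.2)
        (mono' q h.2 • ContinuousLinearMap.snd ℝ ℝ ℝ) h :=
      (hasDerivAt_mono q h.2).comp_hasFDerivAt h hasFDerivAt_snd
    refine ((h1.mul h2).const_mul (A p q)).congr_fderiv ?_
    ext <;> simp [mul_comm]
  have hs : HasFDerivAt (tay (n + 1) A) (∑ i ∈ Finset.range (n + 1),
      ∑ p ∈ Finset.HasAntidiagonal.antidiagonal i,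
        ((A p.1 p.2 * (mono' p.1 h.1 * mono p.2 h.2)) • ContinuousLinearMap.fst ℝ ℝ ℝ +
        (A p.1 p.2 * (mono p.1 h.1 * mono' p.2 h.2)) • ContinuousLinearMap.snd ℝ ℝ ℝ)) h :=
    HasFDerivAt.fun_sum fun i _ => HasFDerivAt.fun_sum fun p _ => hm p.1 p.2
  refine hs.congr_fderiv ?_
  simp only [Finset.sum_add_distrib, ← Finset.sum_smul]
  congr 2
  · rw [Finset.sum_range_succ']
    simp [tay, Finset.Nat.sum_antidiagonal_succ, mono']
  · rw [Finset.sum_range_succ']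
    simp [tay, Finset.Nat.sum_antidiagonal_succ', mono']

lemma norm_fderiv_le_of_partials {G : ℝ × ℝ → ℝ} {y : ℝ × ℝ} {L1 L2 B : ℝ} (hB : 0 ≤ B)
    (hG : HasFDerivAt G (L1 • ContinuousLinearMap.fst ℝ ℝ ℝ +
      L2 • ContinuousLinearMap.snd ℝ ℝ ℝ) y) (h1 : |L1| ≤ B) (h2 : |L2| ≤ B) :
    ‖fderiv ℝ G y‖ ≤ 2 * B := by
  rw [hG.fderiv]
  refine ContinuousLinearMap.opNorm_le_bound _ (by positivity) fun w => ?_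
  have e1 : |w.1| ≤ ‖w‖ := norm_fst_le w
  have e2 : |w.2| ≤ ‖w‖ := norm_snd_le w
  calc ‖(L1 • ContinuousLinearMap.fst ℝ ℝ ℝ + L2 • ContinuousLinearMap.snd ℝ ℝ ℝ) w‖
      = |L1 * w.1 + L2 * w.2| := rfl
    _ ≤ |L1| * |w.1| + |L2| * |w.2| := by
        rw [← abs_mul, ← abs_mul]; exact abs_add_le _ _
    _ ≤ B * ‖w‖ + B * ‖w‖ := by gcongr
    _ = 2 * B * ‖w‖ := by ring

lemma abs_taylor_remainder_le (n : ℕ) (f : ℝ × ℝ → ℝ) (hf : ContDiff ℝ n f) (x : ℝ × ℝ) {M : ℝ}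
    (hM : ∀ p q, p + q = n → ∀ y, |pdMix p q f y| ≤ M) (h : ℝ × ℝ) :
    |f (x + h) - tay n (fun p q => pdMix p q f x) h| ≤ 2 ^ n * ‖h‖ ^ n * M := by
  have hM0 : 0 ≤ M := (abs_nonneg _).trans (hM n 0 (by omega) 0)
  induction n generalizing f h with
  | zero => simpa [tay, pdMix] using hM 0 0 rfl (x + h)
  | succ n ih =>
    have h1 := ih (pd1 f) (contDiff_dd _ hf) fun p q hpq y => by
      rw [pdMix_pd1 (hf.of_le (by norm_cast; omega))]
      exact hM (p + 1) q (by omega) y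
    have h2 := ih (pd2 f) (contDiff_dd _ hf) fun p q hpq y => by
      rw [pdMix_pd2]
      exact hM p (q + 1) (by omega) y
    have t1 : tay n (fun p q => pdMix (p + 1) q f x) = tay n (fun p q => pdMix p q (pd1 f) x) :=
      tay_congr fun p q hpq => by rw [pdMix_pd1 (hf.of_le (by norm_cast; omega))]
    have hdf : ∀ y, HasFDerivAt (fun y => f (x + y)) (pd1 f (x + y) •
        ContinuousLinearMap.fst ℝ ℝ ℝ + pd2 f (x + y) • ContinuousLinearMap.snd ℝ ℝ ℝ) y := by
      intro y
      have := ((differentiable_of_contDiff_succ hf) (x + y)).hasFDerivAt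
      refine ((hasFDerivAt_comp_add_left x).mpr this).congr_fderiv ?_
      ext <;> simp [pd1, pd2]
    have hd : ∀ y, HasFDerivAt (fun y => f (x + y) - tay (n + 1) (fun p q => pdMix p q f x) y)
        ((pd1 f (x + y) - tay n (fun p q => pdMix p q (pd1 f) x) y) •
          ContinuousLinearMap.fst ℝ ℝ ℝ +
          (pd2 f (x + y) - tay n (fun p q => pdMix p q (pd2 f) x) y) •
            ContinuousLinearMap.snd ℝ ℝ ℝ) y := by
      intro y
      refine ((hdf y).fun_sub (hasFDerivAt_tay n _ y)).congr_fderiv ?_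
      rw [t1]
      simp only [pdMix_pd2]
      module
    have hmv := (convex_closedBall (0 : ℝ × ℝ) ‖h‖).norm_image_sub_le_of_norm_fderiv_le (𝕜 := ℝ)
      (f := fun y => f (x + y) - tay (n + 1) (fun p q => pdMix p q f x) y)
      (C := 2 * (2 ^ n * ‖h‖ ^ n * M)) (x := 0) (y := h)
      (fun y _ => (hd y).differentiableAt) (fun y hy => ?_) (by simp) (by simp)
    · simp only [add_zero, tay_succ_zero, sub_zero] at hmv
      rw [show f x - pdMix 0 0 f x = 0 from sub_self _, sub_zero] at hmv
      refine hmv.trans (le_of_eq ?_)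
      rw [pow_succ, pow_succ]
      ring
    · have hy' : ‖y‖ ≤ ‖h‖ := by simpa using hy
      have hle : 2 ^ n * ‖y‖ ^ n * M ≤ 2 ^ n * ‖h‖ ^ n * M := by gcongr
      exact norm_fderiv_le_of_partials (by positivity) (hd y) ((h1 y).trans hle)
        ((h2 y).trans hle)

lemma tay_eq_sum_range (n : ℕ) (A : ℕ → ℕ → ℝ) (h : ℝ × ℝ) :
    tay n A h = ∑ i ∈ Finset.range n, ∑ j ∈ Finset.range (i + 1),
      A (i - j) j * (mono (i - j) h.1 * mono j h.2) := by
  refine Finset.sum_congr rfl fun i _ => ?_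
  rw [← Finset.Nat.sum_antidiagonal_swap,
    Finset.Nat.sum_antidiagonal_eq_sum_range_succ_mk]
  rfl

lemma sum_min_inv_le (L : ℕ) {y : ℝ} (hy : 0 < y) :
    ∑ n ∈ Finset.range L, min (y / 2 ^ n)⁻¹ (y / 2 ^ n) ≤ if y ≤ 1 then 2 * y else 4 - y⁻¹ := by
  induction L generalizing y with
  | zero =>
    simp only [Finset.range_zero, Finset.sum_empty]
    split_ifs with h
    · positivity
    · have := inv_le_one_of_one_le₀ (not_le.mp h).le
      linarith
  | succ L ih =>
    rw [Finset.sum_range_succ']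
    have h1 := ih (half_pos hy)
    simp only [pow_succ', ← div_div]
    rw [pow_zero, div_one]
    split_ifs at h1 ⊢ with h2 h3 h3
    · linarith [min_le_right y⁻¹ y]
    · linarith
    · have h4 := min_le_left y⁻¹ y
      have h5 : y + 2 * y⁻¹ ≤ 3 := by
        rw [← div_eq_mul_inv, ← le_sub_iff_add_le', div_le_iff₀ hy]
        nlinarith
      linarith
    · have h4 := min_le_left y⁻¹ y
      have h5 : (y / 2)⁻¹ = 2 * y⁻¹ := by field_simp
      rw [h5] at h1
      linarith

/-- The set of `h` for which `x + h / N` lies in the square of half-side one. -/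
def scaledSquare (N : ℝ) (x : ℝ × ℝ) : Set (ℝ × ℝ) :=
  Set.Icc (N * (-1 - x.1)) (N * (1 - x.1)) ×ˢ Set.Icc (N * (-1 - x.2)) (N * (1 - x.2))

lemma isCompact_scaledSquare (N : ℝ) (x : ℝ × ℝ) : IsCompact (scaledSquare N x) :=
  isCompact_Icc.prod isCompact_Icc

lemma volume_scaledSquare {N : ℝ} (hN : 0 < N) (x : ℝ × ℝ) :
    volume.real (scaledSquare N x) = 4 * N ^ 2 := by
  rw [scaledSquare, Measure.volume_eq_prod, measureReal_prod_prod, Real.volume_real_Icc,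
    Real.volume_real_Icc, max_eq_left (by linarith), max_eq_left (by linarith)]
  ring

lemma Adm.comp_affine_eq_zero {n : ℕ} {f : ℝ × ℝ → ℝ} (hf : Adm n f) {N : ℝ} (hN : 0 < N)
    (x : ℝ × ℝ) : ∀ h ∉ scaledSquare N x, f (x + N⁻¹ • h) = 0 := by
  intro h hh
  apply hf.supp
  by_contra! hc
  apply hh
  have h1 : |(x + N⁻¹ • h).1| ≤ 1 := abs_le_one_iff_mul_self_le_one.mpr
    (by nlinarith [sq_nonneg (x + N⁻¹ • h).2])
  have h2 : |(x + N⁻¹ • h).2| ≤ 1 := abs_le_one_iff_mul_self_le_one.mpr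
    (by nlinarith [sq_nonneg (x + N⁻¹ • h).1])
  rw [abs_le] at h1 h2
  simp only [Prod.fst_add, Prod.snd_add, Prod.smul_fst, Prod.smul_snd, smul_eq_mul] at h1 h2
  have e1 : N * (N⁻¹ * h.1) = h.1 := by field_simp
  have e2 : N * (N⁻¹ * h.2) = h.2 := by field_simp
  refine ⟨⟨?_, ?_⟩, ⟨?_, ?_⟩⟩ <;> nlinarith

lemma dyadic_difference {g : ℝ → ℝ} (hg : IsCutoff g) {r : ℝ} (hr : 0 < r) {W : ℝ × ℝ → ℝ}
    (hW : Continuous W) :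
    (∫ h : ℝ × ℝ, kern h * W h * g (r / 2 * rad h)) - ∫ h : ℝ × ℝ, kern h * W h * g (r * rad h) =
      r * ∫ h : ℝ × ℝ, dyad g 0 0 (r • h) * W h := by
  rw [← integral_sub (integrable_kern_cutoff hg (half_pos hr) hW)
    (integrable_kern_cutoff hg hr hW), ← integral_const_mul]
  congr 1
  funext h
  have := kern_mul_cutoff_sub (g := g) hr 0 0 h
  simp only [pow_zero, mul_one, add_zero] at this
  linear_combination W h * this

/-- Dyadic summation of the contribution of the region far from the singularity. -/
lemma exists_outer_bound {g : ℝ → ℝ} (hg : IsCutoff g) (m : ℕ) :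
    ∃ C, 0 ≤ C ∧ ∀ r > 0, ∀ N > 0, ∀ a b φ : ℝ, a ^ 2 + b ^ 2 = 1 → ∀ f : ℝ × ℝ → ℝ, Adm m f →
      ∀ x : ℝ × ℝ,
      |(∫ h : ℝ × ℝ, kern h * (f (x + N⁻¹ • h) * Real.sin (φ + (b * h.1 + a * h.2)))) -
        ∫ h : ℝ × ℝ, kern h * (f (x + N⁻¹ • h) * Real.sin (φ + (b * h.1 + a * h.2))) *
          g (r * rad h)| ≤
      C * N * ∑ l ∈ Finset.range (m + 1), r ^ (m - l) * (N⁻¹ ^ l * CkNorm l f) := by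
  obtain ⟨C, hC, hosc⟩ := oscillatory_bound m (dyad g 0 0) (contDiff_dyad hg 0 0)
    (dyad_eq_zero hg 0 0)
  refine ⟨64 * C, by positivity, fun r hr N hN a b φ hab f hf x => ?_⟩
  set S := scaledSquare N x with hS
  set F : ℝ × ℝ → ℝ := fun h => f (x + N⁻¹ • h) with hF
  have hFS : ∀ h ∉ S, F h = 0 := hf.comp_affine_eq_zero hN x
  have hFc : ContDiff ℝ m F := hf.smooth.comp (by fun_prop)
  set W : ℝ × ℝ → ℝ := fun h => F h * Real.sin (φ + (b * h.1 + a * h.2)) with hW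
  have hWc : Continuous W := hFc.continuous.mul (by fun_prop)
  set M : ℕ → ℝ := fun l => N⁻¹ ^ l * CkNorm l f with hM
  have hM0 : ∀ l, 0 ≤ M l := fun l => mul_nonneg (by positivity) (CkNorm_nonneg l f)
  have hD : DerivBound Set.univ m M F := by
    simpa only [abs_one, one_mul] using hf.derivBound_comp_affine x (t := N⁻¹) (by positivity) 1
  set T := ∑ l ∈ Finset.range (m + 1), r ^ (m - l) * M l with hT
  have hT0 : 0 ≤ T := Finset.sum_nonneg fun l _ => mul_nonneg (by positivity) (hM0 l)
  obtain ⟨B, hB⟩ := ((isCompact_scaledSquare N x).image continuous_rad).bddAbove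
  obtain ⟨L, hL⟩ := exists_pow_lt_of_lt_one (show 0 < (2 * (r * (|B| + 1)))⁻¹ by positivity)
    (show (1 / 2 : ℝ) < 1 by norm_num)
  have hfull : ∫ h, kern h * W h = ∫ h, kern h * W h * g (r / 2 ^ L * rad h) := by
    congr 1
    funext h
    by_cases hh : h ∈ S
    · have h1 : rad h ≤ B := hB ⟨h, hh, rfl⟩
      have h2 : r / 2 ^ L * rad h ≤ 1 / 2 := by
        rw [one_div, inv_pow, lt_inv_comm₀ (by positivity) (by positivity), inv_inv] at hL
        rw [div_mul_eq_mul_div, div_le_iff₀ (by positivity)]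
        have : r * rad h ≤ r * (|B| + 1) := by
          gcongr
          linarith [le_abs_self B]
        linarith
      rw [hg.2.2.1 _ h2, mul_one]
    · simp [hW, hFS h hh]
  have htel : (∫ h, kern h * W h * g (r / 2 ^ L * rad h)) - ∫ h, kern h * W h * g (r * rad h) =
      ∑ n ∈ Finset.range L, r / 2 ^ n * ∫ h : ℝ × ℝ, dyad g 0 0 ((r / 2 ^ n) • h) * W h := by
    have h1 := Finset.sum_range_sub
      (fun n => ∫ h, kern h * W h * g (r / 2 ^ n * rad h)) L
    rw [pow_zero, div_one] at h1
    rw [← h1]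
    refine Finset.sum_congr rfl fun n _ => ?_
    rw [← dyadic_difference hg (by positivity) hWc, pow_succ, div_div]
  rw [hfull, htel]
  have hterm : ∀ n : ℕ, |r / 2 ^ n * ∫ h : ℝ × ℝ, dyad g 0 0 ((r / 2 ^ n) • h) * W h| ≤
      16 * C * N * T * min (N * r / 2 ^ n)⁻¹ (N * r / 2 ^ n) := by
    intro n
    set s := r / 2 ^ n with hs
    have hs0 : 0 < s := by positivity
    have hsr : s ≤ r := div_le_self hr.le (one_le_pow₀ one_le_two)
    have h1 := hosc s hs0 a b φ hab S (isCompact_scaledSquare N x).isClosed F hFc hFS M hM0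
      (hD.subset (Set.subset_univ _))
    have hsum : ∑ l ∈ Finset.range (m + 1), s ^ (m - l) * M l ≤ T :=
      Finset.sum_le_sum fun l _ => mul_le_mul_of_nonneg_right (by gcongr) (hM0 l)
    have hsum0 : 0 ≤ ∑ l ∈ Finset.range (m + 1), s ^ (m - l) * M l :=
      Finset.sum_nonneg fun l _ => mul_nonneg (by positivity) (hM0 l)
    have hvol : s * volume.real (S ∩ Box s) ≤ 16 * N * min (N * s)⁻¹ (N * s) := by
      have v1 : volume.real (S ∩ Box s) ≤ 16 * (s ^ 2)⁻¹ :=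
        (measureReal_mono Set.inter_subset_right
          (isCompact_Box hs0).measure_lt_top.ne).trans_eq (volume_Box hs0)
      have v2 : volume.real (S ∩ Box s) ≤ 4 * N ^ 2 :=
        (measureReal_mono Set.inter_subset_left
          (isCompact_scaledSquare N x).measure_lt_top.ne).trans_eq (volume_scaledSquare hN x)
      rw [mul_min_of_nonneg _ _ (by positivity)]
      refine le_min ?_ ?_
      · refine (mul_le_mul_of_nonneg_left v1 hs0.le).trans (le_of_eq ?_)
        field_simp
      · refine (mul_le_mul_of_nonneg_left v2 hs0.le).trans ?_
        have : 0 ≤ s * N ^ 2 := by positivity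
        linarith
    have hint : ∫ h : ℝ × ℝ, dyad g 0 0 (s • h) * W h =
        ∫ h : ℝ × ℝ, dyad g 0 0 (s • h) * F h * Real.sin (φ + (b * h.1 + a * h.2)) := by
      congr 1
      funext h
      rw [hW]
      ring
    rw [hint, abs_mul, abs_of_pos hs0, mul_div_assoc N r]
    calc _ ≤ s * (C * volume.real (S ∩ Box s) * T) := by
          refine mul_le_mul_of_nonneg_left (h1.trans ?_) hs0.le
          exact mul_le_mul_of_nonneg_left hsum (mul_nonneg hC measureReal_nonneg)
      _ = C * T * (s * volume.real (S ∩ Box s)) := by ring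
      _ ≤ C * T * (16 * N * min (N * s)⁻¹ (N * s)) :=
          mul_le_mul_of_nonneg_left hvol (by positivity)
      _ = _ := by ring
  refine (Finset.abs_sum_le_sum_abs _ _).trans ((Finset.sum_le_sum fun n _ => hterm n).trans ?_)
  rw [← Finset.mul_sum]
  have hmin := sum_min_inv_le L (mul_pos hN hr)
  have h4 : (if N * r ≤ 1 then 2 * (N * r) else 4 - (N * r)⁻¹) ≤ 4 := by
    split_ifs with h
    · linarith
    · have : 0 < (N * r)⁻¹ := by positivity
      linarith
  calc _ ≤ 16 * C * N * T * 4 :=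
        mul_le_mul_of_nonneg_left (hmin.trans h4) (by positivity)
    _ = _ := by ring

lemma continuous_mono (p : ℕ) : Continuous (mono p) := by
  unfold mono
  fun_prop

lemma continuous_tay (n : ℕ) (A : ℕ → ℕ → ℝ) : Continuous (tay n A) := by
  unfold tay mono
  fun_prop

/-- The error `V(w) - V^K(w)` for the plane wave `w` with amplitude `f` and phase offset `Θ`. -/
noncomputable def waveError (cs cc : ℕ → ℕ → ℝ) (K : ℕ) (N a b Θ : ℝ) (f : ℝ × ℝ → ℝ) :
    ℝ × ℝ → ℝ := fun x =>
  Vop (fun y => f y * Real.sin (N * (b * y.1 + a * y.2) + Θ)) x - VKapprox cs cc K N a b Θ f x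

lemma Vop_wave_eq {N : ℝ} (hN : 0 < N) (a b Θ : ℝ) (f : ℝ × ℝ → ℝ) (x : ℝ × ℝ) :
    Vop (fun y => f y * Real.sin (N * (b * y.1 + a * y.2) + Θ)) x = N⁻¹ *
      ∫ h : ℝ × ℝ, kern h * (f (x + N⁻¹ • h) *
        Real.sin (N * (b * x.1 + a * x.2) + Θ + (b * h.1 + a * h.2))) := by
  have h1 := Measure.integral_comp_smul (volume : Measure (ℝ × ℝ)) (fun h : ℝ × ℝ => kern h *
    (f (x + h) * Real.sin (N * (b * (x + h).1 + a * (x + h).2) + Θ))) N⁻¹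
  have h2 : (∫ h : ℝ × ℝ, kern (N⁻¹ • h) * (f (x + N⁻¹ • h) *
      Real.sin (N * (b * (x + N⁻¹ • h).1 + a * (x + N⁻¹ • h).2) + Θ))) =
      N * ∫ h : ℝ × ℝ, kern h * (f (x + N⁻¹ • h) *
        Real.sin (N * (b * x.1 + a * x.2) + Θ + (b * h.1 + a * h.2))) := by
    rw [← integral_const_mul]
    congr 1
    funext h
    rw [kern_smul, inv_inv]
    have : N * (b * (x + N⁻¹ • h).1 + a * (x + N⁻¹ • h).2) + Θ =
        N * (b * x.1 + a * x.2) + Θ + (b * h.1 + a * h.2) := by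
      simp only [Prod.fst_add, Prod.snd_add, Prod.smul_fst, Prod.smul_snd, smul_eq_mul]
      field_simp
      ring
    rw [this]
    ring
  rw [h2] at h1
  have h3 : Module.finrank ℝ (ℝ × ℝ) = 2 := by simp
  rw [h3, inv_pow, inv_inv, abs_of_pos (by positivity), smul_eq_mul] at h1
  have h4 : Vop (fun y => f y * Real.sin (N * (b * y.1 + a * y.2) + Θ)) x =
    ∫ h : ℝ × ℝ, kern h * (f (x + h) *
      Real.sin (N * (b * (x + h).1 + a * (x + h).2) + Θ)) := rfl
  rw [h4, inv_mul_eq_div, eq_div_iff hN.ne']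
  apply mul_left_cancel₀ hN.ne'
  rw [h1]
  ring

lemma integral_moment_eq {g : ℝ → ℝ} (hg : IsCutoff g) {N : ℝ} (hN : 0 < N) (ε a b φ : ℝ)
    (i j : ℕ) :
    ∫ h : ℝ × ℝ, kern h * ((mono (i - j) h.1 * mono j h.2) *
      Real.sin (φ + (b * h.1 + a * h.2))) * g (N ^ (ε - 1) * rad h) =
      Real.sin φ * Tijs g ε a b i j N + Real.cos φ * Tijc g ε a b i j N := by
  have hr : 0 < N ^ (ε - 1) := Real.rpow_pos_of_pos hN _
  rw [Tijs, Tijc, ← integral_const_mul, ← integral_const_mul, ← integral_add]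
  · congr 1
    funext h
    rw [Real.sin_add, kern, mono, mono, add_comm (b * h.1) (a * h.2)]
    ring
  · refine ((integrable_kern_cutoff hg hr (G := fun h => (h.1 ^ (i - j) * h.2 ^ j /
      ((Nat.factorial (i - j) : ℝ) * (Nat.factorial j : ℝ))) *
      Real.cos (a * h.2 + b * h.1)) (by fun_prop)).const_mul (Real.sin φ)).congr
      (ae_of_all _ fun h => ?_)
    simp only [kern]
    ring
  · refine ((integrable_kern_cutoff hg hr (G := fun h => (h.1 ^ (i - j) * h.2 ^ j /
      ((Nat.factorial (i - j) : ℝ) * (Nat.factorial j : ℝ))) *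
      Real.sin (a * h.2 + b * h.1)) (by fun_prop)).const_mul (Real.cos φ)).congr
      (ae_of_all _ fun h => ?_)
    simp only [kern]
    ring

lemma integral_taylor_eq {g : ℝ → ℝ} (hg : IsCutoff g) {N : ℝ} (hN : 0 < N) (ε a b φ : ℝ)
    (n : ℕ) (A : ℕ → ℕ → ℝ) :
    ∫ h : ℝ × ℝ, kern h * (tay n A (N⁻¹ • h) * Real.sin (φ + (b * h.1 + a * h.2))) *
      g (N ^ (ε - 1) * rad h) =
      ∑ i ∈ Finset.range n, ∑ j ∈ Finset.range (i + 1), A (i - j) j / N ^ i *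
        (Real.sin φ * Tijs g ε a b i j N + Real.cos φ * Tijc g ε a b i j N) := by
  have hr : 0 < N ^ (ε - 1) := Real.rpow_pos_of_pos hN _
  have hi : ∀ i j : ℕ, Integrable (fun h : ℝ × ℝ => A (i - j) j / N ^ i *
      (kern h * ((mono (i - j) h.1 * mono j h.2) *
      Real.sin (φ + (b * h.1 + a * h.2))) * g (N ^ (ε - 1) * rad h))) := by
    intro i j
    refine Integrable.const_mul (integrable_kern_cutoff hg hr ?_) _
    have h1 := continuous_mono (i - j)
    have h2 := continuous_mono j
    fun_prop
  simp only [← integral_moment_eq hg hN, ← integral_const_mul]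
  have hs : ∀ i, (∑ j ∈ Finset.range (i + 1), ∫ h : ℝ × ℝ, A (i - j) j / N ^ i *
      (kern h * ((mono (i - j) h.1 * mono j h.2) *
      Real.sin (φ + (b * h.1 + a * h.2))) * g (N ^ (ε - 1) * rad h))) =
      ∫ h : ℝ × ℝ, ∑ j ∈ Finset.range (i + 1), A (i - j) j / N ^ i *
      (kern h * ((mono (i - j) h.1 * mono j h.2) *
      Real.sin (φ + (b * h.1 + a * h.2))) * g (N ^ (ε - 1) * rad h)) :=
    fun i => (integral_finsetSum _ fun j _ => hi i j).symm
  simp only [hs]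
  rw [← integral_finsetSum _ fun i _ => integrable_finsetSum _ fun j _ => hi i j]
  congr 1
  funext h
  rw [tay_eq_sum_range, Finset.sum_mul, Finset.mul_sum, Finset.sum_mul]
  refine Finset.sum_congr rfl fun i _ => ?_
  rw [Finset.sum_mul, Finset.mul_sum, Finset.sum_mul]
  refine Finset.sum_congr rfl fun j hj => ?_
  have hji : j ≤ i := Nat.lt_succ_iff.mp (Finset.mem_range.mp hj)
  have hsc : mono (i - j) (N⁻¹ • h).1 * mono j (N⁻¹ • h).2 =
      (N ^ i)⁻¹ * (mono (i - j) h.1 * mono j h.2) := by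
    simp only [mono, Prod.smul_fst, Prod.smul_snd, smul_eq_mul, mul_pow]
    rw [← Nat.sub_add_cancel hji, pow_add N, Nat.add_sub_cancel, inv_pow, inv_pow]
    field_simp
  rw [hsc]
  ring

/-- The contribution of the Taylor remainder near the singularity. -/
lemma abs_inner_le {g : ℝ → ℝ} (hg : IsCutoff g) {K : ℕ} {r N : ℝ} (hr : 0 < r) (hN : 0 < N)
    (a b φ : ℝ) {f : ℝ × ℝ → ℝ} (hf : Adm (K + 1) f) (x : ℝ × ℝ) :
    |(∫ h : ℝ × ℝ, kern h * (f (x + N⁻¹ • h) * Real.sin (φ + (b * h.1 + a * h.2))) *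
        g (r * rad h)) -
      ∫ h : ℝ × ℝ, kern h * (tay (K + 1) (fun p q => pdMix p q f x) (N⁻¹ • h) *
        Real.sin (φ + (b * h.1 + a * h.2))) * g (r * rad h)| ≤
      4 ^ (K + 3) * (r⁻¹ ^ (K + 2) * N⁻¹ ^ (K + 1) * CkNorm (K + 1) f) := by
  have hfc : Continuous f := hf.smooth.continuous
  have htc := continuous_tay (K + 1) (fun p q => pdMix p q f x)
  rw [← integral_sub (integrable_kern_cutoff hg hr (by fun_prop))
    (integrable_kern_cutoff hg hr (by fun_prop))]
  set M := CkNorm (K + 1) f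
  have hM : 0 ≤ M := CkNorm_nonneg _ _
  rw [← setIntegral_eq_integral_of_forall_compl_eq_zero (s := Box r) fun h hh => by
    rw [hg.2.2.2 (r * rad h) (by linarith [two_lt_mul_rad_of_notMem_Box hr.le hh])]; ring]
  rw [← Real.norm_eq_abs]
  refine (norm_setIntegral_le_of_norm_le_const
    (C := (2 / r) ^ K * (2 ^ (K + 1) * N⁻¹ ^ (K + 1) * M)) (isCompact_Box hr).measure_lt_top
    fun h hh => ?_).trans ?_
  · have hrem := abs_taylor_remainder_le (K + 1) f hf.smooth x (M := M)
      (fun p q hpq y => abs_pdMix_le_CkNorm hf hpq.le y) (N⁻¹ • h)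
    rw [norm_smul, Real.norm_eq_abs, abs_of_pos (inv_pos.mpr hN), mul_pow] at hrem
    have hbox : ‖h‖ ≤ 2 / r := by
      rw [le_div_iff₀' hr]
      rcases max_cases |h.1| |h.2| with ⟨h1, -⟩ | ⟨h1, -⟩ <;>
        rw [Prod.norm_def, Real.norm_eq_abs, Real.norm_eq_abs, h1, ← abs_of_pos hr, ← abs_mul]
      exacts [hh.1, hh.2]
    have hk : |kern h| * ‖h‖ ^ (K + 1) ≤ (2 / r) ^ K := by
      calc |kern h| * ‖h‖ ^ (K + 1) ≤ ‖h‖⁻¹ * ‖h‖ ^ (K + 1) := by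
            gcongr
            exact abs_kern_le h
        _ = ‖h‖⁻¹ * ‖h‖ * ‖h‖ ^ K := by ring
        _ ≤ 1 * ‖h‖ ^ K := by
            gcongr
            exact inv_mul_le_one
        _ ≤ (2 / r) ^ K := by
            rw [one_mul]
            gcongr
    rw [show ∀ k F T S G : ℝ, k * (F * S) * G - k * (T * S) * G = k * (F - T) * (S * G) by
      intros; ring, Real.norm_eq_abs, abs_mul, abs_mul, abs_mul]
    have h1 : |Real.sin (φ + (b * h.1 + a * h.2))| * |g (r * rad h)| ≤ 1 :=
      mul_le_one₀ (Real.abs_sin_le_one _) (abs_nonneg _)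
        (hg.abs_le_one (mul_nonneg hr.le (rad_nonneg h)))
    calc _ ≤ |kern h| * (2 ^ (K + 1) * (N⁻¹ ^ (K + 1) * ‖h‖ ^ (K + 1)) * M) * 1 := by gcongr
      _ = (|kern h| * ‖h‖ ^ (K + 1)) * (2 ^ (K + 1) * N⁻¹ ^ (K + 1) * M) := by ring
      _ ≤ _ := by gcongr
  · rw [volume_Box hr]
    have h4 : (4 : ℝ) ^ (K + 3) = 2 ^ K * 2 ^ K * 64 := by
      rw [← mul_pow, pow_add]
      norm_num
    have e : (2 / r) ^ K * (2 ^ (K + 1) * N⁻¹ ^ (K + 1) * M) * (16 * (r ^ 2)⁻¹) =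
        2 ^ K * 2 ^ K * 32 * (r⁻¹ ^ (K + 2) * N⁻¹ ^ (K + 1) * M) := by
      rw [div_eq_mul_inv, mul_pow]
      ring
    rw [e, h4]
    gcongr
    norm_num

/-- The moment limits used by the order `K` approximation. -/
def HasMomentLimits (g : ℝ → ℝ) (ε a b : ℝ) (K : ℕ) (cs cc : ℕ → ℕ → ℝ) : Prop :=
  ∀ i j : ℕ, j ≤ i → i ≤ K →
    Tendsto (fun M : ℝ => Tijs g ε a b i j M) atTop (nhds (cs i j)) ∧
    Tendsto (fun M : ℝ => Tijc g ε a b i j M) atTop (nhds (cc i j))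

/-- The right-hand side of the error bound for a plane wave. -/
noncomputable def errorBound (ε : ℝ) (K J : ℕ) (N : ℝ) (f : ℝ × ℝ → ℝ) : ℝ :=
  (∑ i ∈ Finset.range (K + 1), N ^ ((i : ℝ) * ε - K) * CkNorm (K - i + J + 1) f) +
    N ^ (-(((K : ℝ) + 2) * ε)) * CkNorm (K + J + 1) f

lemma errorBound_nonneg (ε : ℝ) (K J : ℕ) {N : ℝ} (hN : 0 < N) (f : ℝ × ℝ → ℝ) :
    0 ≤ errorBound ε K J N f := by
  refine add_nonneg (Finset.sum_nonneg fun i _ => ?_) ?_ <;>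
    exact mul_nonneg (Real.rpow_nonneg hN.le _) (CkNorm_nonneg _ _)

lemma exists_waveError_raw_bound {g : ℝ → ℝ} (hg : IsCutoff g) {ε : ℝ} (hε : ε < 1) (K : ℕ) :
    ∃ C, 0 ≤ C ∧ ∀ N : ℝ, 1 ≤ N → ∀ a b Θ : ℝ, a ^ 2 + b ^ 2 = 1 → ∀ cs cc : ℕ → ℕ → ℝ,
      HasMomentLimits g ε a b K cs cc → ∀ f : ℝ × ℝ → ℝ, Adm (K + 1) f → ∀ x : ℝ × ℝ,
      |waveError cs cc K N a b Θ f x| ≤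
        C * ((N ^ (ε - 1))⁻¹ ^ (K + 2) * N⁻¹ ^ (K + 2) * CkNorm (K + 1) f +
          ∑ l ∈ Finset.range (K + 1 + 1), (N ^ (ε - 1)) ^ (K + 1 - l) *
            (N⁻¹ ^ l * CkNorm l f)) := by
  obtain ⟨C1, hC1, h1⟩ := exists_outer_bound hg (K + 1)
  obtain ⟨C2, hC2, h2⟩ := exists_T_tail_bound hg hε K
  refine ⟨4 ^ (K + 3) + C1 + (K + 1) * (2 * C2), by positivity, ?_⟩
  intro N hN a b Θ hab cs cc hlim f hf x
  have hN0 : 0 < N := one_pos.trans_le hN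
  set r := N ^ (ε - 1) with hr
  have hr0 : 0 < r := Real.rpow_pos_of_pos hN0 _
  set φ := N * (b * x.1 + a * x.2) + Θ with hφ
  set U := r⁻¹ ^ (K + 2) * N⁻¹ ^ (K + 2) * CkNorm (K + 1) f with hU
  set T := ∑ l ∈ Finset.range (K + 1 + 1), r ^ (K + 1 - l) * (N⁻¹ ^ l * CkNorm l f) with hT
  have hU0 : 0 ≤ U := mul_nonneg (by positivity) (CkNorm_nonneg _ _)
  have ht0 : ∀ l, 0 ≤ r ^ (K + 1 - l) * (N⁻¹ ^ l * CkNorm l f) := fun l =>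
    mul_nonneg (by positivity) (mul_nonneg (by positivity) (CkNorm_nonneg _ _))
  have hT0 : 0 ≤ T := Finset.sum_nonneg fun l _ => ht0 l
  set A : ℕ → ℕ → ℝ := fun p q => pdMix p q f x with hA
  set I := ∫ h : ℝ × ℝ, kern h * (f (x + N⁻¹ • h) * Real.sin (φ + (b * h.1 + a * h.2))) with hI
  set Ic := ∫ h : ℝ × ℝ, kern h * (f (x + N⁻¹ • h) * Real.sin (φ + (b * h.1 + a * h.2))) *
    g (r * rad h) with hIc
  have houter : |I - Ic| ≤ C1 * N * T := h1 r hr0 N hN0 a b φ hab f hf x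
  have hinner := abs_inner_le hg hr0 hN0 a b φ hf x
  rw [hr, integral_taylor_eq hg hN0, ← hr, ← hIc] at hinner
  have htail : |(∑ i ∈ Finset.range (K + 1), ∑ j ∈ Finset.range (i + 1), A (i - j) j / N ^ i *
        (Real.sin φ * Tijs g ε a b i j N + Real.cos φ * Tijc g ε a b i j N)) -
      N * VKapprox cs cc K N a b Θ f x| ≤ (K + 1) * (2 * C2) * T := by
    rw [VKapprox, ← hφ, Finset.mul_sum, ← Finset.sum_sub_distrib, hT,
      Finset.sum_range_succ _ (K + 1), mul_add (_ * (2 * C2)), Finset.mul_sum]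
    refine (Finset.abs_sum_le_sum_abs _ _).trans (le_add_of_le_of_nonneg
      (Finset.sum_le_sum fun i hi => ?_) (mul_nonneg (by positivity) (ht0 _)))
    have hiK : i ≤ K := Nat.lt_succ_iff.mp (Finset.mem_range.mp hi)
    rw [Finset.mul_sum, ← Finset.sum_sub_distrib]
    refine (Finset.abs_sum_le_sum_abs _ _).trans ((Finset.sum_le_card_nsmul _ _
      (2 * C2 * (r ^ (K + 1 - i) * (N⁻¹ ^ i * CkNorm i f))) fun j hj => ?_).trans ?_)
    · have hji : j ≤ i := Nat.lt_succ_iff.mp (Finset.mem_range.mp hj)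
      obtain ⟨l1, l2⟩ := hlim i j hji hiK
      have e1 := (h2 N hN0 a b hab i hiK j hji (cs i j) (cc i j)).1 l1
      have e2 := (h2 N hN0 a b hab i hiK j hji (cs i j) (cc i j)).2 l2
      have eA : |A (i - j) j| ≤ CkNorm i f :=
        abs_pdMix_le_CkNorm (hf.mono (by omega)) (by omega) x
      have es := Real.abs_sin_le_one φ
      have ec := Real.abs_cos_le_one φ
      have hnorm : 0 ≤ CkNorm i f := CkNorm_nonneg _ _
      rw [show A (i - j) j / N ^ i * (Real.sin φ * Tijs g ε a b i j N +
          Real.cos φ * Tijc g ε a b i j N) - N * (pdMix (i - j) j f x / N ^ (i + 1) *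
          (cs i j * Real.sin φ + cc i j * Real.cos φ)) =
          A (i - j) j * N⁻¹ ^ i * (Real.sin φ * (Tijs g ε a b i j N - cs i j) +
          Real.cos φ * (Tijc g ε a b i j N - cc i j)) by
        simp only [hA, pow_succ, inv_pow]
        field_simp
        ring]
      rw [abs_mul, abs_mul, abs_of_pos (by positivity : 0 < N⁻¹ ^ i)]
      calc _ ≤ CkNorm i f * N⁻¹ ^ i * (1 * (C2 * r ^ (K + 1 - i)) + 1 * (C2 * r ^ (K + 1 - i))) := by
            gcongr
            refine (abs_add_le _ _).trans ?_
            rw [abs_mul, abs_mul]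
            gcongr
        _ = _ := by ring
    · rw [Finset.card_range, nsmul_eq_mul, Nat.cast_add, Nat.cast_one, mul_assoc ((K : ℝ) + 1)]
      have : (i : ℝ) ≤ K := by exact_mod_cast hiK
      have := ht0 i
      gcongr
  have hNE : N * waveError cs cc K N a b Θ f x = I - N * VKapprox cs cc K N a b Θ f x := by
    rw [waveError, Vop_wave_eq hN0, mul_sub, mul_inv_cancel_left₀ hN0.ne']
  have habs : N * |waveError cs cc K N a b Θ f x| ≤
      N * ((4 ^ (K + 3) + C1 + (K + 1) * (2 * C2)) * (U + T)) := by
    rw [← abs_of_pos hN0, ← abs_mul, abs_of_pos hN0, hNE]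
    have htri := (abs_add_le ((I - Ic) + (Ic - ∑ i ∈ Finset.range (K + 1),
      ∑ j ∈ Finset.range (i + 1), A (i - j) j / N ^ i *
      (Real.sin φ * Tijs g ε a b i j N + Real.cos φ * Tijc g ε a b i j N))) _).trans
      (add_le_add ((abs_add_le _ _).trans (add_le_add houter hinner)) htail)
    rw [show ∀ p q s t : ℝ, p - q + (q - s) + (s - t) = p - t by intros; ring] at htri
    refine htri.trans ?_
    have hU' : r⁻¹ ^ (K + 2) * N⁻¹ ^ (K + 1) * CkNorm (K + 1) f = N * U := by
      rw [hU, pow_succ N⁻¹ (K + 1)]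
      field_simp
    rw [hU']
    have hcT : (K + 1) * (2 * C2) * T ≤ N * ((K + 1) * (2 * C2) * T) :=
      le_mul_of_one_le_left (by positivity) hN
    have p1 : 0 ≤ N * ((C1 + (K + 1) * (2 * C2)) * U) := by positivity
    have p2 : 0 ≤ N * ((4 : ℝ) ^ (K + 3) * T) := by positivity
    linarith
  exact le_of_mul_le_mul_left habs hN0

lemma exists_waveError_bound {g : ℝ → ℝ} (hg : IsCutoff g) {ε : ℝ} (hε : ε ∈ Set.Ioo (0 : ℝ) 1)
    (K : ℕ) :
    ∃ C, 0 ≤ C ∧ ∀ N : ℝ, 1 ≤ N → ∀ a b Θ : ℝ, a ^ 2 + b ^ 2 = 1 → ∀ cs cc : ℕ → ℕ → ℝ,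
      HasMomentLimits g ε a b K cs cc → ∀ f : ℝ × ℝ → ℝ, Adm (K + 1) f → ∀ x : ℝ × ℝ,
      |waveError cs cc K N a b Θ f x| ≤ C * errorBound ε K 0 N f := by
  obtain ⟨C, hC, h⟩ := exists_waveError_raw_bound hg hε.2 K
  refine ⟨C * (K + 3), by positivity, fun N hN a b Θ hab cs cc hlim f hf x => ?_⟩
  refine (h N hN a b Θ hab cs cc hlim f hf x).trans ?_
  rw [mul_assoc C]
  refine mul_le_mul_of_nonneg_left ?_ hC
  have hN0 : 0 < N := one_pos.trans_le hN
  have hterm0 : ∀ i ∈ Finset.range (K + 1), 0 ≤ N ^ ((i : ℝ) * ε - K) * CkNorm (K - i + 0 + 1) f :=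
    fun i _ => mul_nonneg (Real.rpow_nonneg hN0.le _) (CkNorm_nonneg _ _)
  have hlast0 : 0 ≤ N ^ (-(((K : ℝ) + 2) * ε)) * CkNorm (K + 0 + 1) f :=
    mul_nonneg (Real.rpow_nonneg hN0.le _) (CkNorm_nonneg _ _)
  have hfirst : (N ^ (ε - 1))⁻¹ ^ (K + 2) * N⁻¹ ^ (K + 2) * CkNorm (K + 1) f ≤
      errorBound ε K 0 N f := by
    have e : (N ^ (ε - 1))⁻¹ ^ (K + 2) * N⁻¹ ^ (K + 2) = N ^ (-(((K : ℝ) + 2) * ε)) := by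
      rw [← mul_pow, ← Real.rpow_neg hN0.le, ← Real.rpow_neg_one N, ← Real.rpow_add hN0,
        ← Real.rpow_natCast, ← Real.rpow_mul hN0.le]
      congr 1
      push_cast
      ring
    rw [e]
    exact le_add_of_nonneg_left (Finset.sum_nonneg hterm0)
  have hl : ∀ l ∈ Finset.range (K + 1 + 1), (N ^ (ε - 1)) ^ (K + 1 - l) *
      (N⁻¹ ^ l * CkNorm l f) ≤ errorBound ε K 0 N f := by
    intro l hl
    have hlK : l ≤ K + 1 := Nat.lt_succ_iff.mp (Finset.mem_range.mp hl)
    have e : (N ^ (ε - 1)) ^ (K + 1 - l) * N⁻¹ ^ l = N ^ (((K : ℝ) + 1 - l) * ε - (K + 1)) := by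
      rw [← Real.rpow_neg_one N, ← Real.rpow_natCast, ← Real.rpow_natCast,
        ← Real.rpow_mul hN0.le, ← Real.rpow_mul hN0.le, ← Real.rpow_add hN0, Nat.cast_sub hlK]
      congr 1
      push_cast
      ring
    rw [← mul_assoc, e]
    obtain ⟨i, hi, h1, h2⟩ : ∃ i ∈ Finset.range (K + 1),
        ((K : ℝ) + 1 - l) * ε - (K + 1) ≤ (i : ℝ) * ε - K ∧ l ≤ K - i + 0 + 1 := by
      rcases Nat.eq_zero_or_pos l with rfl | hl0
      · refine ⟨K, by simp, ?_, by omega⟩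
        push_cast
        linarith [hε.2]
      · refine ⟨K + 1 - l, Finset.mem_range.mpr (by omega), ?_, by omega⟩
        rw [Nat.cast_sub hlK]
        push_cast
        linarith
    calc _ ≤ N ^ ((i : ℝ) * ε - K) * CkNorm (K - i + 0 + 1) f :=
          mul_le_mul (Real.rpow_le_rpow_of_exponent_le hN h1)
            (CkNorm_mono (hf.mono (by omega)) h2) (CkNorm_nonneg _ _) (Real.rpow_nonneg hN0.le _)
      _ ≤ errorBound ε K 0 N f :=
          (Finset.single_le_sum hterm0 hi).trans (le_add_of_nonneg_right hlast0)
  have hsum := Finset.sum_le_card_nsmul _ _ _ hl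
  rw [Finset.card_range, nsmul_eq_mul] at hsum
  push_cast at hsum
  linarith

/-- The plane wave with amplitude `F` and phase offset `Θ`. -/
noncomputable def wave (N a b Θ : ℝ) (F : ℝ × ℝ → ℝ) : ℝ × ℝ → ℝ :=
  fun y => F y * Real.sin (N * (b * y.1 + a * y.2) + Θ)

lemma contDiff_wave {n : ℕ} (N a b Θ : ℝ) {F : ℝ × ℝ → ℝ} (hF : ContDiff ℝ n F) :
    ContDiff ℝ n (wave N a b Θ F) := by
  unfold wave
  fun_prop

lemma dd_wave (N a b Θ : ℝ) {F : ℝ × ℝ → ℝ} (v : ℝ × ℝ) (hF : Differentiable ℝ F) :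
    dd v (wave N a b Θ F) = fun x => wave N a b Θ (dd v F) x +
      N * (b * v.1 + a * v.2) * wave N a b (Θ + Real.pi / 2) F x := by
  funext x
  have hφ : HasFDerivAt (fun y : ℝ × ℝ => N * (b * y.1 + a * y.2) + Θ)
      (N • (b • ContinuousLinearMap.fst ℝ ℝ ℝ + a • ContinuousLinearMap.snd ℝ ℝ ℝ)) x :=
    (((hasFDerivAt_fst.const_mul b).add (hasFDerivAt_snd.const_mul a)).const_mul N).add_const Θ
  have h := ((hF x).hasFDerivAt.mul hφ.sin).fderiv
  have e : fderiv ℝ (wave N a b Θ F) x = _ := h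
  rw [dd, e]
  simp only [wave, dd, ← add_assoc, Real.sin_add_pi_div_two, _root_.add_apply,
    _root_.smul_apply, ContinuousLinearMap.coe_fst', ContinuousLinearMap.coe_snd',
    smul_eq_mul]
  ring

lemma Adm.wave {n : ℕ} {F : ℝ × ℝ → ℝ} (hF : Adm n F) (N a b Θ : ℝ) :
    Adm n (wave N a b Θ F) :=
  ⟨contDiff_wave N a b Θ hF.smooth, fun x hx => by rw [IPMVelocity.wave, hF.supp x hx, zero_mul]⟩

lemma Vop_add_const_mul {w z : ℝ × ℝ → ℝ} (hw : Adm 0 w) (hz : Adm 0 z) (c : ℝ) :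
    Vop (fun x => w x + c * z x) = fun x => Vop w x + c * Vop z x := by
  funext x
  have hi : ∀ {w : ℝ × ℝ → ℝ}, Adm 0 w → Integrable fun h => kern h * w (x + h) := fun hw =>
    integrable_kern_mul (hw.smooth.continuous.comp (continuous_const.add continuous_id))
      (hw.hasCompactSupport.comp_homeomorph (Homeomorph.addLeft x))
  change ∫ h, kern h * (w (x + h) + c * z (x + h)) =
    (∫ h, kern h * w (x + h)) + c * ∫ h, kern h * z (x + h)
  rw [← integral_const_mul, ← integral_add (hi hw) ((hi hz).const_mul c)]
  congr 1
  funext h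
  ring

lemma Vop_dd_wave {N a b Θ : ℝ} {f : ℝ × ℝ → ℝ} (v : ℝ × ℝ) (hf : Adm 1 f) :
    Vop (dd v (wave N a b Θ f)) = fun x => Vop (wave N a b Θ (dd v f)) x +
      N * (b * v.1 + a * v.2) * Vop (wave N a b (Θ + Real.pi / 2) f) x := by
  rw [dd_wave N a b Θ v (differentiable_of_contDiff_succ (n := 0) hf.smooth),
    Vop_add_const_mul ((Adm.dd v (n := 0) hf).wave N a b Θ)
      ((hf.mono zero_le_one).wave N a b (Θ + Real.pi / 2))]

lemma dd_Vop_wave {N a b Θ : ℝ} {f : ℝ × ℝ → ℝ} (v : ℝ × ℝ) (hf : Adm 1 f) :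
    dd v (Vop (wave N a b Θ f)) = fun x => Vop (wave N a b Θ (dd v f)) x +
      N * (b * v.1 + a * v.2) * Vop (wave N a b (Θ + Real.pi / 2) f) x := by
  rw [dd_Vop v (hf.wave N a b Θ).smooth (hf.wave N a b Θ).hasCompactSupport,
    Vop_dd_wave v hf]

/-- The first `n` terms of the local expansion of `V`. -/
noncomputable def waveSum (cs cc : ℕ → ℕ → ℝ) (n : ℕ) (N a b Θ : ℝ) (f : ℝ × ℝ → ℝ) :
    ℝ × ℝ → ℝ := fun x => ∑ i ∈ Finset.range n, ∑ j ∈ Finset.range (i + 1),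
  (pdMix (i - j) j f x / N ^ (i + 1)) *
    (cs i j * Real.sin (N * (b * x.1 + a * x.2) + Θ)
      + cc i j * Real.cos (N * (b * x.1 + a * x.2) + Θ))

/-- The error of the `n` term local expansion of `V` on a plane wave. -/
noncomputable def truncError (cs cc : ℕ → ℕ → ℝ) (n : ℕ) (N a b Θ : ℝ) (f : ℝ × ℝ → ℝ) :
    ℝ × ℝ → ℝ := fun x => Vop (wave N a b Θ f) x - waveSum cs cc n N a b Θ f x

section TruncError

variable {cs cc : ℕ → ℕ → ℝ} {n : ℕ} {N a b Θ : ℝ} {f : ℝ × ℝ → ℝ}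

lemma waveSum_eq : waveSum cs cc n N a b Θ f = fun x =>
    ∑ i ∈ Finset.range n, ∑ j ∈ Finset.range (i + 1),
      (cs i j / N ^ (i + 1) * wave N a b Θ (pdMix (i - j) j f) x +
        cc i j / N ^ (i + 1) * wave N a b (Θ + Real.pi / 2) (pdMix (i - j) j f) x) := by
  funext x
  refine Finset.sum_congr rfl fun i _ => Finset.sum_congr rfl fun j _ => ?_
  simp only [wave, ← add_assoc, Real.sin_add_pi_div_two]
  ring

lemma contDiff_waveSum {m : ℕ} (hf : ContDiff ℝ (n + m : ℕ) f) :
    ContDiff ℝ m (waveSum cs cc n N a b Θ f) := by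
  rw [waveSum_eq]
  refine ContDiff.sum fun i hi => ContDiff.sum fun j hj => ?_
  have hi' := Finset.mem_range.mp hi
  have hj' := Finset.mem_range.mp hj
  have hp : ContDiff ℝ m (pdMix (i - j) j f) :=
    contDiff_pdMix (hf.of_le (by norm_cast; omega))
  exact (contDiff_const.mul (contDiff_wave N a b _ hp)).add
    (contDiff_const.mul (contDiff_wave N a b _ hp))

lemma contDiff_truncError {m : ℕ} (hf : Adm (n + m) f) :
    ContDiff ℝ m (truncError cs cc n N a b Θ f) :=
  (contDiff_Vop ((hf.wave N a b Θ).mono (by omega : m ≤ n + m)).smooth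
    (hf.wave N a b Θ).hasCompactSupport).sub (contDiff_waveSum hf.smooth)

lemma dd_sum {ι : Type*} (s : Finset ι) {F : ι → ℝ × ℝ → ℝ} (v : ℝ × ℝ)
    (hF : ∀ i ∈ s, Differentiable ℝ (F i)) :
    dd v (fun x => ∑ i ∈ s, F i x) = fun x => ∑ i ∈ s, dd v (F i) x := by
  funext x
  rw [dd, fderiv_fun_sum fun i hi => hF i hi x, _root_.sum_apply]
  rfl

lemma dd_waveSum (v : ℝ × ℝ) (hf : ContDiff ℝ n f)
    (hv : ∀ p q, p + q < n → dd v (pdMix p q f) = pdMix p q (dd v f)) :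
    dd v (waveSum cs cc n N a b Θ f) = fun x => waveSum cs cc n N a b Θ (dd v f) x +
      N * (b * v.1 + a * v.2) * waveSum cs cc n N a b (Θ + Real.pi / 2) f x := by
  have hd : ∀ i ∈ Finset.range n, ∀ j ∈ Finset.range (i + 1),
      Differentiable ℝ (pdMix (i - j) j f) := fun i hi j hj => by
    have hi' := Finset.mem_range.mp hi
    have hj' := Finset.mem_range.mp hj
    exact differentiable_of_contDiff_succ (n := 0)
      (contDiff_pdMix (hf.of_le (by norm_cast; omega)))
  have hw : ∀ Θ, ∀ i ∈ Finset.range n, ∀ j ∈ Finset.range (i + 1),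
      Differentiable ℝ (wave N a b Θ (pdMix (i - j) j f)) := fun Θ i hi j hj => by
    have := hd i hi j hj
    unfold wave
    fun_prop
  have hwc : ∀ Θ, ∀ c : ℝ, ∀ i ∈ Finset.range n, ∀ j ∈ Finset.range (i + 1),
      Differentiable ℝ (fun x => c * wave N a b Θ (pdMix (i - j) j f) x) :=
    fun Θ c i hi j hj => (hw Θ i hi j hj).const_mul c
  have hterm : ∀ i ∈ Finset.range n, ∀ j ∈ Finset.range (i + 1), Differentiable ℝ (fun x =>
      cs i j / N ^ (i + 1) * wave N a b Θ (pdMix (i - j) j f) x +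
        cc i j / N ^ (i + 1) * wave N a b (Θ + Real.pi / 2) (pdMix (i - j) j f) x) :=
    fun i hi j hj => (hwc _ _ i hi j hj).add (hwc _ _ i hi j hj)
  simp only [waveSum_eq]
  rw [dd_sum _ v fun i hi => Differentiable.fun_sum fun j hj => hterm i hi j hj]
  funext x
  rw [Finset.mul_sum, ← Finset.sum_add_distrib]
  refine Finset.sum_congr rfl fun i hi => ?_
  rw [dd_sum _ v (hterm i hi), Finset.mul_sum, ← Finset.sum_add_distrib]
  refine Finset.sum_congr rfl fun j hj => ?_
  have hi' := Finset.mem_range.mp hi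
  have hj' := Finset.mem_range.mp hj
  rw [dd_add v (hwc _ _ i hi j hj) (hwc _ _ i hi j hj), dd_const_mul, dd_const_mul,
    dd_wave _ _ _ _ v (hd i hi j hj), dd_wave _ _ _ _ v (hd i hi j hj), hv _ _ (by omega)]
  ring

lemma dd_truncError (v : ℝ × ℝ) (hf : Adm (n + 1) f)
    (hv : ∀ p q, p + q < n → dd v (pdMix p q f) = pdMix p q (dd v f)) :
    dd v (truncError cs cc n N a b Θ f) = fun x => truncError cs cc n N a b Θ (dd v f) x +
      N * (b * v.1 + a * v.2) * truncError cs cc n N a b (Θ + Real.pi / 2) f x := by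
  have e : truncError cs cc n N a b Θ f =
      fun x => Vop (wave N a b Θ f) x + (-1) * waveSum cs cc n N a b Θ f x := by
    funext x
    rw [truncError]
    ring
  have h1 : Differentiable ℝ (Vop (wave N a b Θ f)) := differentiable_of_contDiff_succ (n := 0)
    (contDiff_Vop ((hf.wave N a b Θ).mono (by omega)).smooth (hf.wave N a b Θ).hasCompactSupport)
  have h2 : Differentiable ℝ (waveSum cs cc n N a b Θ f) :=
    differentiable_of_contDiff_succ (n := 0) (contDiff_waveSum hf.smooth)
  rw [e, dd_add v h1 (h2.const_mul _), dd_const_mul, dd_Vop_wave v (hf.mono (by omega)),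
    dd_waveSum v (hf.mono (by omega)).smooth hv]
  funext x
  simp only [truncError]
  ring

lemma pd1_truncError (hf : Adm (n + 1) f) :
    pd1 (truncError cs cc n N a b Θ f) = fun x => truncError cs cc n N a b Θ (pd1 f) x +
      N * b * truncError cs cc n N a b (Θ + Real.pi / 2) f x := by
  have h := dd_truncError (cs := cs) (cc := cc) (N := N) (a := a) (b := b) (Θ := Θ) (1, 0) hf
    fun p q hpq => (pd1_pdMix p q f).trans
      (pdMix_pd1 (hf.smooth.of_le (by norm_cast; omega))).symm
  rw [pd1_eq_dd, h]
  simp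

lemma pd2_truncError (hf : Adm (n + 1) f) :
    pd2 (truncError cs cc n N a b Θ f) = fun x => truncError cs cc n N a b Θ (pd2 f) x +
      N * a * truncError cs cc n N a b (Θ + Real.pi / 2) f x := by
  have h := dd_truncError (cs := cs) (cc := cc) (N := N) (a := a) (b := b) (Θ := Θ) (0, 1) hf
    fun p q hpq => (pd2_pdMix (hf.smooth.of_le (by norm_cast; omega))).trans
      (pdMix_pd2 p q f).symm
  rw [pd2_eq_dd, h]
  simp

/-- A uniform bound on the error of plane waves yields bounds on its derivatives, each derivative
costing a factor `N`. -/
lemma derivBound_truncError {C : ℝ} (hC : 0 ≤ C) (hN : 1 ≤ N) (hab : a ^ 2 + b ^ 2 = 1)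
    {Φ : ℕ → (ℝ × ℝ → ℝ) → ℝ}
    (hΦ0 : ∀ J f, 0 ≤ Φ J f)
    (hΦ : ∀ J f, Adm (n + J + 1) f → Φ J f ≤ Φ (J + 1) f)
    (hΦ1 : ∀ J f, Adm (n + J + 1) f → Φ J (pd1 f) ≤ Φ (J + 1) f)
    (hΦ2 : ∀ J f, Adm (n + J + 1) f → Φ J (pd2 f) ≤ Φ (J + 1) f)
    (hbound : ∀ Θ f, Adm n f → ∀ x, |truncError cs cc n N a b Θ f x| ≤ C * Φ 0 f)
    (J : ℕ) (Θ : ℝ) (f : ℝ × ℝ → ℝ) (hf : Adm (n + J) f) :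
    DerivBound Set.univ J (fun _ => C * (2 * N) ^ J * Φ J f) (truncError cs cc n N a b Θ f) := by
  induction J generalizing Θ f with
  | zero => exact fun x _ => by simpa using hbound Θ f hf x
  | succ J ih =>
    have hN0 : 0 < N := one_pos.trans_le hN
    have ha : |a| ≤ 1 := abs_le_one_iff_mul_self_le_one.mpr (by nlinarith)
    have hb : |b| ≤ 1 := abs_le_one_iff_mul_self_le_one.mpr (by nlinarith)
    have hmono : C * (2 * N) ^ J * Φ J f ≤ C * (2 * N) ^ J * Φ (J + 1) f :=
      mul_le_mul_of_nonneg_left (hΦ J f hf) (by positivity)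
    have hX := hΦ0 (J + 1) f
    have step : ∀ (c : ℝ) (q : ℝ × ℝ → ℝ), |c| ≤ 1 → Adm (n + J) q → Φ J q ≤ Φ (J + 1) f →
        DerivBound Set.univ J (fun _ => C * (2 * N) ^ (J + 1) * Φ (J + 1) f)
          (fun x => truncError cs cc n N a b Θ q x +
            N * c * truncError cs cc n N a b (Θ + Real.pi / 2) f x) := by
      intro c q hc hq hqΦ
      refine ((ih Θ q hq).add ((ih (Θ + Real.pi / 2) f (hf.mono (by omega))).const_mul (N * c))
        (contDiff_truncError hq) (contDiff_const.mul
          (contDiff_truncError (hf.mono (by omega))))).mono fun l _ => ?_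
      have h1 : C * (2 * N) ^ J * Φ J q ≤ N * (C * (2 * N) ^ J * Φ (J + 1) f) :=
        (mul_le_mul_of_nonneg_left hqΦ (by positivity)).trans
          (le_mul_of_one_le_left (by positivity) hN)
      have h2 : |N * c| * (C * (2 * N) ^ J * Φ J f) ≤ N * (C * (2 * N) ^ J * Φ (J + 1) f) := by
        rw [abs_mul, abs_of_pos hN0]
        exact mul_le_mul (mul_le_of_le_one_right hN0.le hc) hmono
          (mul_nonneg (by positivity) (hΦ0 _ _)) hN0.le
      calc _ ≤ _ := add_le_add h1 h2
        _ = _ := by ring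
    refine ⟨fun x _ => ?_, ?_, ?_⟩
    · refine ((ih Θ f (hf.mono (by omega))).le x (Set.mem_univ x)).trans (hmono.trans ?_)
      rw [pow_succ]
      have : 0 ≤ C * (2 * N) ^ J * Φ (J + 1) f := by positivity
      nlinarith
    · rw [pd1_truncError (hf.mono (by omega))]
      exact step b _ hb (Adm.dd (1, 0) hf) (hΦ1 J f hf)
    · rw [pd2_truncError (hf.mono (by omega))]
      exact step a _ ha (Adm.dd (0, 1) hf) (hΦ2 J f hf)

end TruncError

lemma exists_abs_Vop_le : ∃ C, 0 ≤ C ∧ ∀ w : ℝ × ℝ → ℝ, Adm 0 w → ∀ M : ℝ, (∀ x, |w x| ≤ M) →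
    ∀ x, |Vop w x| ≤ C * M := by
  set Q : Set (ℝ × ℝ) := Set.Icc (-1, -1) (1, 1) with hQ
  set I : ℝ × ℝ → ℝ := (Metric.ball 0 1).indicator fun h => |kern h| with hI
  have hQc : IsCompact Q := isCompact_Icc
  have hI' : Integrable I :=
    (integrable_indicator_iff Metric.isOpen_ball.measurableSet).mpr (integrableOn_kern_ball 1).abs
  have hQ' : Integrable (Q.indicator fun _ : ℝ × ℝ => (1 : ℝ)) :=
    (integrable_indicator_iff hQc.measurableSet).mpr
      (integrableOn_const hQc.measure_lt_top.ne)
  have hI0 : ∀ h, 0 ≤ I h := fun h => Set.indicator_nonneg (fun _ _ => abs_nonneg _) h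
  have hQ0 : ∀ h, 0 ≤ Q.indicator (fun _ : ℝ × ℝ => (1 : ℝ)) h :=
    fun h => Set.indicator_nonneg (fun _ _ => zero_le_one) h
  refine ⟨(∫ h, I h) + ∫ h, Q.indicator (fun _ => (1 : ℝ)) h,
    add_nonneg (integral_nonneg hI0) (integral_nonneg hQ0), fun w hw M hM x => ?_⟩
  have hM0 : 0 ≤ M := (abs_nonneg _).trans (hM x)
  have hQx : Integrable fun h => Q.indicator (fun _ => (1 : ℝ)) (x + h) := hQ'.comp_add_left x
  rw [← integral_add_left_eq_self (fun h => Q.indicator (fun _ => (1 : ℝ)) h) x,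
    ← integral_add hI' hQx, ← integral_mul_const, ← Real.norm_eq_abs]
  refine norm_integral_le_of_norm_le ((hI'.add hQx).mul_const M) (Eventually.of_forall fun h => ?_)
  change ‖kern h * w (x + h)‖ ≤ _
  rw [norm_mul, Real.norm_eq_abs, Real.norm_eq_abs]
  by_cases hh : h ∈ Metric.ball (0 : ℝ × ℝ) 1
  · have e : I h = |kern h| := Set.indicator_of_mem hh _
    rw [← e]
    exact mul_le_mul (le_add_of_nonneg_right (hQ0 _)) (hM _) (abs_nonneg _)
      (add_nonneg (hI0 _) (hQ0 _))
  · by_cases hx : x + h ∈ Q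
    · have hk : |kern h| ≤ 1 := by
        refine (abs_kern_le h).trans (inv_le_one_of_one_le₀ ?_)
        simpa using hh
      rw [Set.indicator_of_mem hx]
      exact mul_le_mul (hk.trans (le_add_of_nonneg_left (hI0 h))) (hM _) (abs_nonneg _)
        (add_nonneg (hI0 h) zero_le_one)
    · have : w (x + h) = 0 := by
        refine hw.supp _ (not_le.mp fun hle => hx ?_)
        have h1 := abs_le_of_sq_add_sq_le (x := x + h) (L := 1) zero_le_one (by simpa using hle)
        exact ⟨⟨(abs_le.mp h1.1).1, (abs_le.mp h1.2).1⟩, (abs_le.mp h1.1).2, (abs_le.mp h1.2).2⟩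
      rw [this, abs_zero, mul_zero]
      exact mul_nonneg (add_nonneg (hI0 h) (hQ0 _)) hM0

lemma errorBound_le_of {ε : ℝ} {K J J' : ℕ} {N : ℝ} (hN : 0 < N) {q f : ℝ × ℝ → ℝ}
    (h : ∀ k ≤ K, CkNorm (k + J + 1) q ≤ CkNorm (k + J' + 1) f) :
    errorBound ε K J N q ≤ errorBound ε K J' N f :=
  add_le_add (Finset.sum_le_sum fun i _ => mul_le_mul_of_nonneg_left (h _ (by omega))
    (Real.rpow_nonneg hN.le _)) (mul_le_mul_of_nonneg_left (h _ le_rfl) (Real.rpow_nonneg hN.le _))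

/-- The bound for the derivatives up to order `J` of the error of the `n` term expansion. -/
noncomputable def truncBound (ε : ℝ) (n J : ℕ) (N : ℝ) (f : ℝ × ℝ → ℝ) : ℝ :=
  match n with
  | 0 => CkNorm J f
  | K + 1 => errorBound ε K J N f

lemma truncBound_nonneg (ε : ℝ) (n J : ℕ) {N : ℝ} (hN : 0 < N) (f : ℝ × ℝ → ℝ) :
    0 ≤ truncBound ε n J N f := by
  cases n with
  | zero => exact CkNorm_nonneg _ _
  | succ K => exact errorBound_nonneg ε K J hN f

lemma truncBound_le_succ {ε : ℝ} {n J : ℕ} {N : ℝ} (hN : 0 < N) {q f : ℝ × ℝ → ℝ}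
    (h : ∀ k ≤ n + J, CkNorm k q ≤ CkNorm (k + 1) f) :
    truncBound ε n J N q ≤ truncBound ε n (J + 1) N f := by
  cases n with
  | zero => exact h J (by omega)
  | succ K => exact errorBound_le_of hN fun k hk => h (k + J + 1) (by omega)

lemma exists_truncError_bound {g : ℝ → ℝ} (hg : IsCutoff g) {ε : ℝ} (hε : ε ∈ Set.Ioo (0 : ℝ) 1)
    (n : ℕ) :
    ∃ C, 0 ≤ C ∧ ∀ N : ℝ, 1 ≤ N → ∀ a b : ℝ, a ^ 2 + b ^ 2 = 1 → ∀ cs cc : ℕ → ℕ → ℝ,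
      (∀ i j : ℕ, j ≤ i → i < n →
        Tendsto (fun M : ℝ => Tijs g ε a b i j M) atTop (nhds (cs i j)) ∧
        Tendsto (fun M : ℝ => Tijc g ε a b i j M) atTop (nhds (cc i j))) →
      ∀ (J : ℕ) (Θ : ℝ) (f : ℝ × ℝ → ℝ), Adm (n + J) f → DerivBound Set.univ J
        (fun _ => C * (2 * N) ^ J * truncBound ε n J N f) (truncError cs cc n N a b Θ f) := by
  obtain ⟨C, hC, h⟩ : ∃ C, 0 ≤ C ∧ ∀ N : ℝ, 1 ≤ N → ∀ a b : ℝ, a ^ 2 + b ^ 2 = 1 →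
      ∀ cs cc : ℕ → ℕ → ℝ, (∀ i j : ℕ, j ≤ i → i < n →
        Tendsto (fun M : ℝ => Tijs g ε a b i j M) atTop (nhds (cs i j)) ∧
        Tendsto (fun M : ℝ => Tijc g ε a b i j M) atTop (nhds (cc i j))) →
      ∀ (Θ : ℝ) (f : ℝ × ℝ → ℝ), Adm n f → ∀ x,
        |truncError cs cc n N a b Θ f x| ≤ C * truncBound ε n 0 N f := by
    cases n with
    | zero =>
      obtain ⟨C, hC, h⟩ := exists_abs_Vop_le
      refine ⟨C, hC, fun N _ a b _ cs cc _ Θ f hf x => ?_⟩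
      have := h _ (hf.wave N a b Θ) (CkNorm 0 f) (fun y => ?_) x
      · simpa [truncError, waveSum, truncBound] using this
      · rw [wave, abs_mul]
        exact (mul_le_of_le_one_right (abs_nonneg _) (Real.abs_sin_le_one _)).trans
          (abs_le_CkNorm hf y)
    | succ K =>
      obtain ⟨C, hC, h⟩ := exists_waveError_bound hg hε K
      exact ⟨C, hC, fun N hN a b hab cs cc hlim Θ f hf x => h N hN a b Θ hab cs cc
        (fun i j hji hi => hlim i j hji (Nat.lt_succ_of_le hi)) f hf x⟩
  refine ⟨C, hC, fun N hN a b hab cs cc hlim J Θ f hf => ?_⟩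
  have hN0 : 0 < N := one_pos.trans_le hN
  exact derivBound_truncError (Φ := fun J f => truncBound ε n J N f) hC hN hab
    (fun J f => truncBound_nonneg ε n J hN0 f)
    (fun J f hf => truncBound_le_succ hN0 fun k hk => CkNorm_mono (hf.mono (by omega)) (by omega))
    (fun J f hf => truncBound_le_succ hN0 fun k hk => CkNorm_pd1_le (hf.mono (by omega)))
    (fun J f hf => truncBound_le_succ hN0 fun k hk => CkNorm_pd2_le (hf.mono (by omega)))
    (h N hN a b hab cs cc hlim) J Θ f hf

/-- The right-hand side of the velocity approximation estimate. -/
noncomputable def velocityBound (ε : ℝ) (K J : ℕ) (N : ℝ) (f : ℝ × ℝ → ℝ) : ℝ :=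
  (∑ i ∈ Finset.range (K + 1),
    N ^ ((i : ℝ) * ε + (J : ℝ) + 1 - (K : ℝ)) * CkNorm (K - i + J + 1) f) +
    N ^ ((J : ℝ) + 1 - ((K : ℝ) + 2) * ε) * CkNorm (K + J + 2) f

lemma pow_mul_errorBound_le {ε : ℝ} {K J : ℕ} {N : ℝ} (hN : 0 < N) {f : ℝ × ℝ → ℝ}
    (hf : Adm (K + J + 2) f) :
    N ^ (J + 1) * errorBound ε K J N f ≤ velocityBound ε K J N f := by
  have e : ∀ s t : ℝ, t = (J + 1 : ℕ) + s → N ^ (J + 1) * N ^ s = N ^ t := fun s t h => by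
    rw [h, Real.rpow_add hN, Real.rpow_natCast]
  rw [errorBound, velocityBound, mul_add, Finset.mul_sum]
  refine add_le_add (Finset.sum_le_sum fun i _ => ?_) ?_
  · rw [← mul_assoc, e _ ((i : ℝ) * ε + (J : ℝ) + 1 - (K : ℝ)) (by push_cast; ring)]
  · rw [← mul_assoc, e _ ((J : ℝ) + 1 - ((K : ℝ) + 2) * ε) (by push_cast; ring)]
    exact mul_le_mul_of_nonneg_left (CkNorm_mono hf (by omega)) (Real.rpow_nonneg hN.le _)

lemma pow_mul_truncBound_le {ε : ℝ} (hε : ε ≤ 1) {K J : ℕ} {N : ℝ} (hN : 1 ≤ N)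
    {q f : ℝ × ℝ → ℝ} (hf : Adm (K + J + 2) f)
    (hq : ∀ k ≤ K + J + 1, CkNorm k q ≤ CkNorm (k + 1) f) :
    N ^ J * truncBound ε K J N q ≤ velocityBound ε K J N f := by
  have hN0 : 0 < N := one_pos.trans_le hN
  have e : ∀ s : ℝ, N ^ J * N ^ s = N ^ (J + s) := fun s => by
    rw [Real.rpow_add hN0, Real.rpow_natCast]
  cases K with
  | zero =>
    rw [velocityBound, Finset.sum_range_one]
    refine le_add_of_le_of_nonneg ?_ (mul_nonneg (Real.rpow_nonneg hN0.le _) (CkNorm_nonneg _ _))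
    rw [← Real.rpow_natCast]
    refine mul_le_mul (Real.rpow_le_rpow_of_exponent_le hN ?_) ?_ (CkNorm_nonneg _ _)
      (Real.rpow_nonneg hN0.le _)
    · push_cast
      linarith
    · exact (hq J (by omega)).trans_eq (by rw [Nat.sub_self, zero_add])
  | succ k =>
    rw [truncBound, errorBound, velocityBound, Finset.sum_range_succ _ (k + 1), mul_add,
      Finset.mul_sum]
    refine add_le_add (le_add_of_le_of_nonneg (Finset.sum_le_sum fun i hi => ?_)
      (mul_nonneg (Real.rpow_nonneg hN0.le _) (CkNorm_nonneg _ _))) ?_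
    · have hi' := Finset.mem_range.mp hi
      rw [← mul_assoc, e]
      refine mul_le_mul (Real.rpow_le_rpow_of_exponent_le hN ?_) ?_ (CkNorm_nonneg _ _)
        (Real.rpow_nonneg hN0.le _)
      · push_cast
        linarith
      · exact (hq _ (by omega)).trans_eq (by congr 1; omega)
    · rw [← mul_assoc, e]
      refine mul_le_mul (Real.rpow_le_rpow_of_exponent_le hN ?_) ?_ (CkNorm_nonneg _ _)
        (Real.rpow_nonneg hN0.le _)
      · push_cast
        linarith
      · exact (hq _ (by omega)).trans (CkNorm_mono hf (by omega))

lemma velocityBound_nonneg (ε : ℝ) (K J : ℕ) {N : ℝ} (hN : 0 < N) (f : ℝ × ℝ → ℝ) :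
    0 ≤ velocityBound ε K J N f := by
  refine add_nonneg (Finset.sum_nonneg fun i _ => ?_) ?_ <;>
    exact mul_nonneg (Real.rpow_nonneg hN.le _) (CkNorm_nonneg _ _)

/-- Combined bound for a component of the velocity error, written in terms of the errors of the
expansions of `V` with `K + 1` and `K` terms. -/
lemma exists_CkNorm_combination_le {g : ℝ → ℝ} (hg : IsCutoff g) {ε : ℝ}
    (hε : ε ∈ Set.Ioo (0 : ℝ) 1) (K J : ℕ) :
    ∃ C > 0, ∀ N : ℝ, 1 ≤ N → ∀ a b Θ : ℝ, a ^ 2 + b ^ 2 = 1 → ∀ cs cc : ℕ → ℕ → ℝ,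
      HasMomentLimits g ε a b K cs cc → ∀ f : ℝ × ℝ → ℝ, Adm (K + J + 2) f →
      ∀ q : ℝ × ℝ → ℝ, Adm (K + J + 1) q →
      (∀ k ≤ K + J + 1, CkNorm k q ≤ CkNorm (k + 1) f) → ∀ σ c : ℝ, |σ| ≤ 1 → |c| ≤ 1 →
      CkNorm J (fun x => σ * (truncError cs cc K N a b Θ q x +
        N * c * truncError cs cc (K + 1) N a b (Θ + Real.pi / 2) f x)) ≤
      C * velocityBound ε K J N f := by
  obtain ⟨C1, hC1, h1⟩ := exists_truncError_bound hg hε K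
  obtain ⟨C2, hC2, h2⟩ := exists_truncError_bound hg hε (K + 1)
  refine ⟨(C1 + C2) * 2 ^ J + 1, by positivity, ?_⟩
  intro N hN a b Θ hab cs cc hlim f hf q hq hqf σ c hσ hc
  have hN0 : 0 < N := one_pos.trans_le hN
  have hq' : Adm (K + J) q := hq.mono (by omega)
  have hf' : Adm (K + 1 + J) f := hf.mono (by omega)
  have b1 := h1 N hN a b hab cs cc (fun i j hji hi => hlim i j hji hi.le) J Θ q hq'
  have b2 := h2 N hN a b hab cs cc (fun i j hji hi => hlim i j hji (Nat.le_of_lt_succ hi)) J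
    (Θ + Real.pi / 2) f hf'
  have p1 := pow_mul_truncBound_le hε.2.le hN hf hqf
  have p2 := pow_mul_errorBound_le (ε := ε) hN0 hf
  have hR := velocityBound_nonneg ε K J hN0 f
  have hE := errorBound_nonneg ε K J hN0 f
  have hb := (b1.add (b2.const_mul (N * c)) (contDiff_truncError hq') (contDiff_const.mul
    (contDiff_truncError hf'))).const_mul σ
  refine CkNorm_le fun i j x hij => (hb.mono fun l _ => ?_).abs_pdMix_le hij x (Set.mem_univ x)
  have q1 : C1 * (2 * N) ^ J * truncBound ε K J N q ≤ C1 * 2 ^ J * velocityBound ε K J N f := by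
    calc _ = C1 * 2 ^ J * (N ^ J * truncBound ε K J N q) := by ring
      _ ≤ _ := by gcongr
  have q2 : |N * c| * (C2 * (2 * N) ^ J * truncBound ε (K + 1) J N f) ≤
      C2 * 2 ^ J * velocityBound ε K J N f := by
    calc _ ≤ N * (C2 * (2 * N) ^ J * errorBound ε K J N f) := by
          refine mul_le_mul_of_nonneg_right ?_ (by positivity)
          rw [abs_mul, abs_of_pos hN0]
          exact mul_le_of_le_one_right hN0.le hc
      _ = C2 * 2 ^ J * (N ^ (J + 1) * errorBound ε K J N f) := by ring
      _ ≤ _ := by gcongr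
  have hsum := add_le_add q1 q2
  calc _ ≤ 1 * (C1 * 2 ^ J * velocityBound ε K J N f + C2 * 2 ^ J * velocityBound ε K J N f) :=
        mul_le_mul hσ hsum (add_nonneg (mul_nonneg (by positivity)
          (truncBound_nonneg _ _ _ hN0 _)) (mul_nonneg (abs_nonneg _) (mul_nonneg (by positivity)
          (truncBound_nonneg _ _ _ hN0 _)))) zero_le_one
    _ ≤ _ := by linarith

lemma VKapprox_const_mul (cs cc : ℕ → ℕ → ℝ) (K : ℕ) (N a b Θ c : ℝ) (f : ℝ × ℝ → ℝ)
    (x : ℝ × ℝ) : VKapprox cs cc K N a b Θ (fun y => c * f y) x =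
      c * waveSum cs cc (K + 1) N a b Θ f x := by
  simp only [VKapprox, waveSum, Finset.mul_sum, pdMix_const_mul]
  refine Finset.sum_congr rfl fun i _ => Finset.sum_congr rfl fun j _ => ?_
  ring

lemma ite_VKapprox_eq (cs cc : ℕ → ℕ → ℝ) (K : ℕ) (N a b Θ : ℝ) (f : ℝ × ℝ → ℝ) (x : ℝ × ℝ) :
    (if K = 0 then 0 else VKapprox cs cc (K - 1) N a b Θ f x) = waveSum cs cc K N a b Θ f x := by
  cases K with
  | zero => simp [waveSum]
  | succ K => rfl

end IPMVelocity

open IPMVelocity in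
/-- Local approximation of the IPM velocity for plane-wave densities
`ρ(x) = f(x) sin(N(b x₁ + a x₂) + Θ₀)`, where `u₁(ρ) = -V(∂₂ρ)`, `u₂(ρ) = V(∂₁ρ)`,
and `u^K` is built from `V^K` and `V^{K-1}` (with the convention `V^{-1} = 0`);
note that `f·∂ᵢ sin(N(b x₁ + a x₂)+Θ₀)` is the plane wave with amplitude `N·a·f`
(resp. `N·b·f`) and phase offset `Θ₀ + π/2`. -/
theorem velocity_local_approximation (g : ℝ → ℝ) (hg : IsCutoff g)
    (K : ℕ) (ε : ℝ) (hε : ε ∈ Set.Ioo (0 : ℝ) 1) (J : ℕ) :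
    ∃ C > 0, ∀ N : ℝ, 1 ≤ N → ∀ a b Θ₀ : ℝ, a ^ 2 + b ^ 2 = 1 →
      ∀ cs cc : ℕ → ℕ → ℝ,
        (∀ i j : ℕ, j ≤ i → i ≤ K →
          Tendsto (fun M : ℝ => Tijs g ε a b i j M) atTop (nhds (cs i j)) ∧
          Tendsto (fun M : ℝ => Tijc g ε a b i j M) atTop (nhds (cc i j))) →
      ∀ f : ℝ × ℝ → ℝ, ContDiff ℝ (K + J + 2 : ℕ) f →
        (∀ x : ℝ × ℝ, f x ≠ 0 → x.1 ^ 2 + x.2 ^ 2 < 1) →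
        -- first component: `‖u₁(ρ) − u^K₁(ρ)‖_{C^J} ≤ ...`
        (CkNorm J (fun x : ℝ × ℝ =>
            (-(Vop (pd2 (fun y => f y * Real.sin (N * (b * y.1 + a * y.2) + Θ₀))) x))
              - (-(VKapprox cs cc K N a b (Θ₀ + Real.pi / 2) (fun y => N * a * f y) x)
                  - (if K = 0 then 0 else VKapprox cs cc (K - 1) N a b Θ₀ (pd2 f) x)))
          ≤ C * ((∑ i ∈ Finset.range (K + 1),
                N ^ ((i : ℝ) * ε + (J : ℝ) + 1 - (K : ℝ)) * CkNorm (K - i + J + 1) f)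
              + N ^ ((J : ℝ) + 1 - ((K : ℝ) + 2) * ε) * CkNorm (K + J + 2) f)) ∧
        -- second component: `‖u₂(ρ) − u^K₂(ρ)‖_{C^J} ≤ ...`
        (CkNorm J (fun x : ℝ × ℝ =>
            Vop (pd1 (fun y => f y * Real.sin (N * (b * y.1 + a * y.2) + Θ₀))) x
              - (VKapprox cs cc K N a b (Θ₀ + Real.pi / 2) (fun y => N * b * f y) x
                  + (if K = 0 then 0 else VKapprox cs cc (K - 1) N a b Θ₀ (pd1 f) x)))
          ≤ C * ((∑ i ∈ Finset.range (K + 1),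
                N ^ ((i : ℝ) * ε + (J : ℝ) + 1 - (K : ℝ)) * CkNorm (K - i + J + 1) f)
              + N ^ ((J : ℝ) + 1 - ((K : ℝ) + 2) * ε) * CkNorm (K + J + 2) f)) := by
  obtain ⟨C, hC, h⟩ := exists_CkNorm_combination_le hg hε K J
  refine ⟨C, hC, fun N hN a b Θ hab cs cc hlim f hf hsupp => ?_⟩
  have hF : Adm (K + J + 2) f := ⟨hf, fun x hx => by
    by_contra h0
    exact lt_asymm hx (hsupp x h0)⟩
  have ha : |a| ≤ 1 := abs_le_one_iff_mul_self_le_one.mpr (by nlinarith)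
  have hb : |b| ≤ 1 := abs_le_one_iff_mul_self_le_one.mpr (by nlinarith)
  have hF1 : Adm 1 f := hF.mono (by omega)
  have e1 := Vop_dd_wave (N := N) (a := a) (b := b) (Θ := Θ) (1, 0) hF1
  have e2 := Vop_dd_wave (N := N) (a := a) (b := b) (Θ := Θ) (0, 1) hF1
  constructor
  · refine (congrArg (CkNorm J) (funext fun x => ?_)).trans_le
      (h N hN a b Θ hab cs cc hlim f hF (pd2 f) (Adm.dd (0, 1) hF)
        (fun k hk => CkNorm_pd2_le (hF.mono (by omega))) (-1) a (by simp) ha)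
    have e := congrFun e2 x
    simp only [mul_zero, mul_one, zero_add] at e
    rw [VKapprox_const_mul, ite_VKapprox_eq]
    change -(Vop (dd (0, 1) (wave N a b Θ f)) x) - _ = _
    rw [e]
    simp only [truncError, pd2_eq_dd]
    ring
  · refine (congrArg (CkNorm J) (funext fun x => ?_)).trans_le
      (h N hN a b Θ hab cs cc hlim f hF (pd1 f) (Adm.dd (1, 0) hF)
        (fun k hk => CkNorm_pd1_le (hF.mono (by omega))) 1 b (by simp) hb)
    have e := congrFun e1 x
    simp only [mul_zero, mul_one, add_zero] at e
    rw [VKapprox_const_mul, ite_VKapprox_eq]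
    change Vop (dd (1, 0) (wave N a b Θ f)) x - _ = _
    rw [e]
    simp only [truncError, pd1_eq_dd]
    ring
end

section
/- Structure of derivatives of a concentrated modulated wave: let β ∈ (0, 1/2), c, d > 0, K ∈ ℕ, and let (a_m)_{m∈ℕ}, (b_m)_{m∈ℕ} be sequences of positive reals. For every k ∈ ℕ and every j ∈ ℕ there exist constants ā > 0 and b̄ > 0, depending only on β, (a_m), (b_m), c, d, k, K and j, with the following property: for every N > 2 with N^{−β}(ln N)⁴ ≤ 1, every θ₀ ∈ ℝ, every smooth f_N : ℝ² → ℝ with supp f_N ⊂ B_{N^{−β}(ln N)⁴}(0) and ‖f_N‖_{C^m} ≤ a_m N^{mβ} (ln N)^{b_m} for every m ∈ ℕ, every polynomial g_N(x) = Σ_{q=2}^{K} Σ_{i=0}^{q} c_{i,q} x₁^{i} x₂^{q−i} with |c_{i,q}| ≤ c (ln N)^{d} for all coefficients, and every integer 0 ≤ i ≤ k, there exist smooth functions g¹, g² : ℝ² → ℝ with supp g¹, supp g² ⊂ B_{N^{−β}(ln N)⁴}(0) such that ∂^{k}/(∂x₁^{k−i} ∂x₂^{i}) [ f_N(x) sin(N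 g_N(x) + θ₀) ] = g¹(x) sin(N g_N(x) + θ₀) + g²(x) cos(N g_N(x) + θ₀), and ‖g¹‖_{C^j} ≤ ā N^{k(1−β) + jβ} (ln N)^{b̄} and ‖g²‖_{C^j} ≤ ā N^{k(1−β) + jβ} (ln N)^{b̄}. -/
open MeasureTheory Real Filter

/-- The polynomial phase `g_N(x) = Σ_{q=2}^{K} Σ_{i=0}^{q} c_{i,q} x₁^i x₂^{q-i}`. -/
noncomputable def polyPhase (K : ℕ) (cf : ℕ → ℕ → ℝ) (x : ℝ × ℝ) : ℝ :=
  ∑ q ∈ Finset.Icc 2 K, ∑ i ∈ Finset.range (q + 1), cf i q * x.1 ^ i * x.2 ^ (q - i)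

/-- The derivative of `f` in the direction `v`. -/
noncomputable def pdv (v : ℝ × ℝ) (f : ℝ × ℝ → ℝ) : ℝ × ℝ → ℝ := fun x => fderiv ℝ f x v

/-- The two coordinate directions. -/
def coordDirs : Set (ℝ × ℝ) := {(1, 0), (0, 1)}

lemma pd1_eq_pdv : pd1 = pdv (1, 0) := rfl

lemma pd2_eq_pdv : pd2 = pdv (0, 1) := rfl

section Pdv

variable {f g : ℝ × ℝ → ℝ}

lemma ContDiff.pdv (hf : ContDiff ℝ (⊤ : ℕ∞) f) (v : ℝ × ℝ) :
    ContDiff ℝ (⊤ : ℕ∞) (pdv v f) :=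
  (hf.fderiv_right (m := (⊤ : ℕ∞)) (by simp)).clm_apply contDiff_const

lemma ContDiff.pdv_iterate (hf : ContDiff ℝ (⊤ : ℕ∞) f) (v : ℝ × ℝ) (n : ℕ) :
    ContDiff ℝ (⊤ : ℕ∞) ((_root_.pdv v)^[n] f) := by
  induction n with
  | zero => exact hf
  | succ n ih => rw [Function.iterate_succ_apply']; exact ih.pdv v

lemma ContDiff.pdMix (hf : ContDiff ℝ (⊤ : ℕ∞) f) (i j : ℕ) :
    ContDiff ℝ (⊤ : ℕ∞) (pdMix i j f) :=
  (hf.pdv_iterate (0, 1) j).pdv_iterate (1, 0) i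

lemma pdv_add (hf : ContDiff ℝ (⊤ : ℕ∞) f) (hg : ContDiff ℝ (⊤ : ℕ∞) g) (v : ℝ × ℝ) :
    pdv v (fun x => f x + g x) = fun x => pdv v f x + pdv v g x := by
  ext x
  simp only [pdv]
  rw [fderiv_fun_add (hf.differentiable (by simp) x) (hg.differentiable (by simp) x)]
  rfl

lemma pdv_mul (hf : ContDiff ℝ (⊤ : ℕ∞) f) (hg : ContDiff ℝ (⊤ : ℕ∞) g) (v : ℝ × ℝ) :
    pdv v (fun x => f x * g x) = fun x => f x * pdv v g x + pdv v f x * g x := by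
  ext x
  simp only [pdv]
  rw [fderiv_fun_mul (hf.differentiable (by simp) x) (hg.differentiable (by simp) x)]
  simp [mul_comm]

lemma pdv_const (c : ℝ) (v : ℝ × ℝ) : pdv v (fun _ => c) = fun _ => 0 := by
  ext x
  simp [pdv]

lemma pdv_sin (hf : ContDiff ℝ (⊤ : ℕ∞) f) (v : ℝ × ℝ) :
    pdv v (fun x => Real.sin (f x)) = fun x => Real.cos (f x) * pdv v f x := by
  ext x
  simp only [pdv]
  rw [fderiv_sin (hf.differentiable (by simp) x)]
  simp

lemma pdv_cos (hf : ContDiff ℝ (⊤ : ℕ∞) f) (v : ℝ × ℝ) :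
    pdv v (fun x => Real.cos (f x)) = fun x => -(Real.sin (f x) * pdv v f x) := by
  ext x
  simp only [pdv]
  rw [fderiv_cos (hf.differentiable (by simp) x)]
  simp

lemma pdv_comm (hf : ContDiff ℝ (⊤ : ℕ∞) f) (v w : ℝ × ℝ) :
    pdv v (pdv w f) = pdv w (pdv v f) := by
  have hd : Differentiable ℝ (fderiv ℝ f) :=
    (hf.fderiv_right (m := (⊤ : ℕ∞)) (by simp)).differentiable (by simp)
  have key (u u' x : ℝ × ℝ) : pdv u (pdv u' f) x = fderiv ℝ (fderiv ℝ f) x u u' := by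
    change fderiv ℝ (fun y => fderiv ℝ f y u') x u = _
    rw [fderiv_clm_apply (hd x) (differentiableAt_const u')]
    simp
  ext x
  rw [key, key]
  have hs : IsSymmSndFDerivAt ℝ f x :=
    (show ContDiff ℝ 2 f from contDiff_infty.1 hf 2).contDiffAt.isSymmSndFDerivAt (by simp)
  exact hs v w

lemma pdv_pdv_iterate (hf : ContDiff ℝ (⊤ : ℕ∞) f) (v w : ℝ × ℝ) (n : ℕ) :
    pdv v ((pdv w)^[n] f) = (pdv w)^[n] (pdv v f) := by
  induction n with
  | zero => rfl
  | succ n ih =>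
    rw [Function.iterate_succ_apply', Function.iterate_succ_apply', ← ih,
      pdv_comm (hf.pdv_iterate w n)]

lemma pdv_fst_pdMix (i j : ℕ) (f : ℝ × ℝ → ℝ) : pdv (1, 0) (pdMix i j f) = pdMix (i + 1) j f :=
  (Function.iterate_succ_apply' pd1 i _).symm

lemma pdv_snd_pdMix (hf : ContDiff ℝ (⊤ : ℕ∞) f) (i j : ℕ) :
    pdv (0, 1) (pdMix i j f) = pdMix i (j + 1) f := by
  simp only [pdMix, pd1_eq_pdv, pd2_eq_pdv]
  rw [pdv_pdv_iterate (hf.pdv_iterate _ j), Function.iterate_succ_apply']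

lemma pdMix_pdv_fst (hf : ContDiff ℝ (⊤ : ℕ∞) f) (i j : ℕ) :
    pdMix i j (pdv (1, 0) f) = pdMix (i + 1) j f := by
  simp only [pdMix, pd1_eq_pdv, pd2_eq_pdv]
  rw [← pdv_pdv_iterate hf, Function.iterate_succ_apply]

lemma pdMix_pdv_snd (i j : ℕ) (f : ℝ × ℝ → ℝ) :
    pdMix i j (pdv (0, 1) f) = pdMix i (j + 1) f := rfl

lemma pdv_eq_zero_of_notMem {U : Set (ℝ × ℝ)} (hU : Uᶜ ⊆ closure (interior Uᶜ))
    (hf : ContDiff ℝ (⊤ : ℕ∞) f) (h : ∀ x ∉ U, f x = 0) (v : ℝ × ℝ) :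
    ∀ x ∉ U, pdv v f x = 0 := by
  have hc : IsClosed {x | pdv v f x = 0} := isClosed_eq (hf.pdv v).continuous continuous_const
  refine fun x hx => closure_minimal (fun y hy => ?_) hc (hU hx)
  have : f =ᶠ[nhds y] fun _ => 0 :=
    mem_of_superset (mem_interior_iff_mem_nhds.1 hy) h
  simp [pdv, this.fderiv_eq]

lemma pdMix_eq_zero_of_notMem {U : Set (ℝ × ℝ)} (hU : Uᶜ ⊆ closure (interior Uᶜ)) (i j : ℕ) :
    ∀ {f : ℝ × ℝ → ℝ}, ContDiff ℝ (⊤ : ℕ∞) f → (∀ x ∉ U, f x = 0) →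
      ∀ x ∉ U, pdMix i j f x = 0 := by
  induction i with
  | zero =>
    induction j with
    | zero => exact fun _ h => h
    | succ j ih => exact fun hf h => ih (hf.pdv (0, 1)) (pdv_eq_zero_of_notMem hU hf h _)
  | succ i ih =>
    intro f hf h
    rw [← pdMix_pdv_fst hf]
    exact ih (hf.pdv (1, 0)) (pdv_eq_zero_of_notMem hU hf h _)

lemma CkNorm_le {k : ℕ} {C : ℝ} (h : ∀ i j x, i + j ≤ k → |pdMix i j f x| ≤ C) :
    CkNorm k f ≤ C := by
  refine csSup_le ⟨_, 0, 0, 0, by simp, rfl⟩ ?_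
  rintro y ⟨i, j, x, hij, rfl⟩
  exact h i j x hij

lemma HasCompactSupport.pdMix (hc : HasCompactSupport f) (i j : ℕ) :
    HasCompactSupport (pdMix i j f) := by
  have hv (v : ℝ × ℝ) {g : ℝ × ℝ → ℝ} (hg : HasCompactSupport g) (n : ℕ) :
      HasCompactSupport ((pdv v)^[n] g) := by
    induction n with
    | zero => exact hg
    | succ n ih => rw [Function.iterate_succ_apply']; exact ih.fderiv_apply ℝ v
  exact hv _ (hv _ hc j) i

lemma abs_pdMix_le_CkNorm (hf : ContDiff ℝ (⊤ : ℕ∞) f) (hc : HasCompactSupport f)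
    {i j k : ℕ} (hij : i + j ≤ k) (x : ℝ × ℝ) : |pdMix i j f x| ≤ CkNorm k f := by
  refine le_csSup ?_ ⟨i, j, x, hij, rfl⟩
  have hb (i j : ℕ) : ∃ C, ∀ x, ‖pdMix i j f x‖ ≤ C :=
    (hf.pdMix i j).continuous.bounded_above_of_compact_support (hc.pdMix i j)
  choose C hC using hb
  have hC0 (i j : ℕ) : 0 ≤ C i j := (norm_nonneg _).trans (hC i j 0)
  refine ⟨∑ i ∈ Finset.range (k + 1), ∑ j ∈ Finset.range (k + 1), C i j, ?_⟩
  rintro y ⟨i, j, x, hij, rfl⟩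
  calc |pdMix i j f x| ≤ C i j := hC i j x
    _ ≤ ∑ j ∈ Finset.range (k + 1), C i j :=
      Finset.single_le_sum (fun j _ => hC0 i j) (Finset.mem_range.2 (by omega))
    _ ≤ _ := Finset.single_le_sum (f := fun i => ∑ j ∈ Finset.range (k + 1), C i j)
      (fun i _ => Finset.sum_nonneg fun j _ => hC0 i j) (Finset.mem_range.2 (by omega))

end Pdv

/-- The open Euclidean disc of radius `r` about the origin. -/
def euclDisc (r : ℝ) : Set (ℝ × ℝ) := {x | x.1 ^ 2 + x.2 ^ 2 < r ^ 2}

lemma compl_euclDisc_subset {r : ℝ} (hr : 0 < r) :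
    (euclDisc r)ᶜ ⊆ closure (interior (euclDisc r)ᶜ) := by
  intro x hx
  have hx : r ^ 2 ≤ x.1 ^ 2 + x.2 ^ 2 := not_lt.1 hx
  have hopen : IsOpen {y : ℝ × ℝ | r ^ 2 < y.1 ^ 2 + y.2 ^ 2} :=
    isOpen_lt (by fun_prop) (by fun_prop)
  have hsub : {y : ℝ × ℝ | r ^ 2 < y.1 ^ 2 + y.2 ^ 2} ⊆ interior (euclDisc r)ᶜ :=
    interior_maximal (fun y (hy : r ^ 2 < _) (h : _ < r ^ 2) => lt_asymm h hy) hopen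
  have htend : Tendsto (fun s : ℝ => s • x) (nhdsWithin 1 (Set.Ioi 1)) (nhds x) := by
    have : Tendsto (fun s : ℝ => s • x) (nhds 1) (nhds ((1 : ℝ) • x)) :=
      (continuous_id.smul continuous_const).tendsto 1
    rw [one_smul] at this
    exact this.mono_left nhdsWithin_le_nhds
  refine closure_mono hsub (mem_closure_of_tendsto htend ?_)
  filter_upwards [self_mem_nhdsWithin] with s hs
  have hs : 1 < s := hs
  have : 0 < r ^ 2 := by positivity
  change r ^ 2 < (s * x.1) ^ 2 + (s * x.2) ^ 2
  nlinarith [mul_pos (show 0 < s ^ 2 - 1 by nlinarith) (this.trans_le hx)]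

lemma hasCompactSupport_of_euclDisc {r : ℝ} (hr : 0 < r) {f : ℝ × ℝ → ℝ}
    (h : ∀ x ∉ euclDisc r, f x = 0) : HasCompactSupport f := by
  refine HasCompactSupport.intro (isCompact_closedBall (0 : ℝ × ℝ) r) fun x hx => h x ?_
  contrapose! hx
  have hx : x.1 ^ 2 + x.2 ^ 2 < r ^ 2 := hx
  rw [mem_closedBall_zero_iff, Prod.norm_def, sup_le_iff]
  exact ⟨abs_le_of_sq_le_sq (by nlinarith [sq_nonneg x.2]) hr.le,
    abs_le_of_sq_le_sq (by nlinarith [sq_nonneg x.1]) hr.le⟩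

section Symbols

variable {ι : Type*} {N : ι → ℝ} {U : ι → Set (ℝ × ℝ)} {β p q : ℝ} {n : ℕ}
  {F G : ι → ℝ × ℝ → ℝ}

/-- The family `G` is bounded on `U` by `N ^ p`, up to a constant and powers of `log N`. -/
def PowLogBound (N : ι → ℝ) (U : ι → Set (ℝ × ℝ)) (p : ℝ) (G : ι → ℝ × ℝ → ℝ) : Prop :=
  ∃ A : ℝ, 0 ≤ A ∧ ∃ B : ℕ, ∀ t, ∀ x ∈ U t, |G t x| ≤ A * N t ^ p * (2 * Real.log (N t)) ^ B

/-- The family `G` satisfies the bounds of a symbol of degree `p` up to order `n`: every derivative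
costs at most a factor `N ^ β`, up to powers of `log N`. -/
def SymbolUpTo (N : ι → ℝ) (U : ι → Set (ℝ × ℝ)) (β : ℝ) :
    ℕ → ℝ → (ι → ℝ × ℝ → ℝ) → Prop
  | 0, p, G => PowLogBound N U p G
  | n + 1, p, G => PowLogBound N U p G ∧
      ∀ v ∈ coordDirs, SymbolUpTo N U β n (p + β) fun t => pdv v (G t)

/-- Smooth families satisfying the symbol bounds of degree `p` to every order. -/
structure IsSymbol (N : ι → ℝ) (U : ι → Set (ℝ × ℝ)) (β p : ℝ) (G : ι → ℝ × ℝ → ℝ) : Prop where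
  smooth : ∀ t, ContDiff ℝ (⊤ : ℕ∞) (G t)
  bound : ∀ n, SymbolUpTo N U β n p G

lemma one_le_two_mul_log {s : ℝ} (hs : 2 < s) : 1 ≤ 2 * Real.log s := by
  have := Real.log_le_log two_pos hs.le
  have := Real.log_two_gt_d9
  linarith

lemma PowLogBound.mono (hN : ∀ t, 2 < N t) (hG : PowLogBound N U p G) (hpq : p ≤ q) :
    PowLogBound N U q G := by
  obtain ⟨A, hA, B, h⟩ := hG
  refine ⟨A, hA, B, fun t x hx => (h t x hx).trans ?_⟩
  have := one_le_two_mul_log (hN t)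
  have := hN t
  gcongr
  linarith

lemma PowLogBound.add (hN : ∀ t, 2 < N t) (hF : PowLogBound N U p F) (hG : PowLogBound N U p G) :
    PowLogBound N U p fun t x => F t x + G t x := by
  obtain ⟨A, hA, B, h⟩ := hF
  obtain ⟨A', hA', B', h'⟩ := hG
  refine ⟨A + A', by positivity, B + B', fun t x hx => (abs_add_le _ _).trans ?_⟩
  have hL := one_le_two_mul_log (hN t)
  have hN0 : 0 < N t := by linarith [hN t]
  rw [add_mul, add_mul]
  refine add_le_add ((h t x hx).trans ?_) ((h' t x hx).trans ?_) <;> gcongr <;> omega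

lemma PowLogBound.mul (hN : ∀ t, 2 < N t) (hF : PowLogBound N U p F) (hG : PowLogBound N U q G) :
    PowLogBound N U (p + q) fun t x => F t x * G t x := by
  obtain ⟨A, hA, B, h⟩ := hF
  obtain ⟨A', hA', B', h'⟩ := hG
  refine ⟨A * A', by positivity, B + B', fun t x hx => ?_⟩
  have hL := one_le_two_mul_log (hN t)
  have hN0 : 0 < N t := by linarith [hN t]
  calc |F t x * G t x| = |F t x| * |G t x| := abs_mul _ _
    _ ≤ (A * N t ^ p * (2 * Real.log (N t)) ^ B) * (A' * N t ^ q * (2 * Real.log (N t)) ^ B') :=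
      mul_le_mul (h t x hx) (h' t x hx) (abs_nonneg _) (by positivity)
    _ = _ := by rw [Real.rpow_add hN0, pow_add]; ring

lemma SymbolUpTo.powLogBound (hG : SymbolUpTo N U β n p G) : PowLogBound N U p G := by
  cases n with
  | zero => exact hG
  | succ n => exact hG.1

lemma SymbolUpTo.mono (hN : ∀ t, 2 < N t) (hG : SymbolUpTo N U β n p G) (hpq : p ≤ q) :
    SymbolUpTo N U β n q G := by
  induction n generalizing p q G with
  | zero => exact PowLogBound.mono hN hG hpq
  | succ n ih => exact ⟨hG.1.mono hN hpq, fun v hv => ih (hG.2 v hv) (by linarith)⟩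

lemma SymbolUpTo.of_succ (hG : SymbolUpTo N U β (n + 1) p G) : SymbolUpTo N U β n p G := by
  induction n generalizing p G with
  | zero => exact hG.1
  | succ n ih => exact ⟨hG.1, fun v hv => ih (hG.2 v hv)⟩

lemma SymbolUpTo.add (hN : ∀ t, 2 < N t) (sF : ∀ t, ContDiff ℝ (⊤ : ℕ∞) (F t))
    (sG : ∀ t, ContDiff ℝ (⊤ : ℕ∞) (G t)) (hF : SymbolUpTo N U β n p F)
    (hG : SymbolUpTo N U β n p G) : SymbolUpTo N U β n p fun t x => F t x + G t x := by
  induction n generalizing p F G with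
  | zero => exact PowLogBound.add hN hF hG
  | succ n ih =>
    refine ⟨hF.1.add hN hG.1, fun v hv => ?_⟩
    simp only [pdv_add (sF _) (sG _)]
    exact ih (fun t => (sF t).pdv v) (fun t => (sG t).pdv v) (hF.2 v hv) (hG.2 v hv)

lemma SymbolUpTo.mul (hN : ∀ t, 2 < N t) (sF : ∀ t, ContDiff ℝ (⊤ : ℕ∞) (F t))
    (sG : ∀ t, ContDiff ℝ (⊤ : ℕ∞) (G t)) (hF : SymbolUpTo N U β n p F)
    (hG : SymbolUpTo N U β n q G) : SymbolUpTo N U β n (p + q) fun t x => F t x * G t x := by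
  induction n generalizing p q F G with
  | zero => exact PowLogBound.mul hN hF hG
  | succ n ih =>
    refine ⟨hF.1.mul hN hG.1, fun v hv => ?_⟩
    simp only [pdv_mul (sF _) (sG _)]
    refine SymbolUpTo.add hN (fun t => (sF t).mul ((sG t).pdv v))
      (fun t => ((sF t).pdv v).mul (sG t)) ?_ ?_
    · rw [add_assoc]
      exact ih sF (fun t => (sG t).pdv v) hF.of_succ (hG.2 v hv)
    · rw [add_right_comm]
      exact ih (fun t => (sF t).pdv v) sG (hF.2 v hv) hG.of_succ

lemma isSymbol_zero : IsSymbol N U β p fun _ _ => 0 := by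
  refine ⟨fun t => contDiff_const, fun n => ?_⟩
  have h (p : ℝ) : PowLogBound N U p fun _ _ => 0 := by
    refine ⟨0, le_rfl, 0, fun t x _ => by simp⟩
  induction n generalizing p with
  | zero => exact h p
  | succ n ih => exact ⟨h p, fun v _ => by simpa only [pdv_const] using ih⟩

lemma isSymbol_const {c : ι → ℝ} (h : PowLogBound N U p fun t _ => c t) :
    IsSymbol N U β p fun t _ => c t := by
  refine ⟨fun t => contDiff_const, fun n => ?_⟩
  cases n with
  | zero => exact h
  | succ n => exact ⟨h, fun v _ => by simpa only [pdv_const] using (isSymbol_zero).bound n⟩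

namespace IsSymbol

lemma mono (hN : ∀ t, 2 < N t) (hG : IsSymbol N U β p G) (hpq : p ≤ q) : IsSymbol N U β q G :=
  ⟨hG.smooth, fun n => (hG.bound n).mono hN hpq⟩

lemma pdv (hG : IsSymbol N U β p G) {v : ℝ × ℝ} (hv : v ∈ coordDirs) :
    IsSymbol N U β (p + β) fun t => pdv v (G t) :=
  ⟨fun t => (hG.smooth t).pdv v, fun n => (hG.bound (n + 1)).2 v hv⟩

lemma add (hN : ∀ t, 2 < N t) (hF : IsSymbol N U β p F) (hG : IsSymbol N U β p G) :
    IsSymbol N U β p fun t x => F t x + G t x :=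
  ⟨fun t => (hF.smooth t).add (hG.smooth t),
    fun n => (hF.bound n).add hN hF.smooth hG.smooth (hG.bound n)⟩

lemma mul (hN : ∀ t, 2 < N t) (hF : IsSymbol N U β p F) (hG : IsSymbol N U β q G) :
    IsSymbol N U β (p + q) fun t x => F t x * G t x :=
  ⟨fun t => (hF.smooth t).mul (hG.smooth t),
    fun n => (hF.bound n).mul hN hF.smooth hG.smooth (hG.bound n)⟩

lemma neg (hN : ∀ t, 2 < N t) (hG : IsSymbol N U β p G) :
    IsSymbol N U β p fun t x => -G t x := by
  have h : IsSymbol N U β 0 fun _ _ => -1 :=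
    isSymbol_const ⟨1, zero_le_one, 0, fun t x _ => by simp⟩
  simpa using h.mul hN hG

lemma pow (hN : ∀ t, 2 < N t) (hG : IsSymbol N U β p G) (m : ℕ) :
    IsSymbol N U β (m * p) fun t x => G t x ^ m := by
  induction m with
  | zero =>
    simpa using isSymbol_const (p := 0) ⟨1, zero_le_one, 0, fun t x _ => by simp⟩
  | succ m ih =>
    simp only [pow_succ]
    convert ih.mul hN hG using 1
    push_cast
    ring

lemma sum (hN : ∀ t, 2 < N t) {κ : Type*} (s : Finset κ) {G : κ → ι → ℝ × ℝ → ℝ}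
    (hG : ∀ k ∈ s, IsSymbol N U β p (G k)) : IsSymbol N U β p fun t x => ∑ k ∈ s, G k t x := by
  classical
  induction s using Finset.induction_on with
  | empty => simpa using isSymbol_zero
  | insert k s hk ih =>
    simp only [Finset.sum_insert hk]
    exact (hG k (by simp)).add hN (ih fun k' hk' => hG k' (by simp [hk']))

lemma of_linear (ℓ : ℝ × ℝ →L[ℝ] ℝ)
    (h : PowLogBound N U (-β) fun _ x => ℓ x) : IsSymbol N U β (-β) fun _ x => ℓ x := by
  refine ⟨fun t => ℓ.contDiff, fun n => ?_⟩
  cases n with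
  | zero => exact h
  | succ n =>
    refine ⟨h, fun v _ => ?_⟩
    have : _root_.pdv v (fun x => ℓ x) = fun _ => ℓ v := by
      ext x
      simp [_root_.pdv]
    simp only [this, neg_add_cancel]
    exact (isSymbol_const ⟨|ℓ v|, abs_nonneg _, 0, fun t x _ => by simp⟩).bound n

lemma pdMix_powLogBound (hG : IsSymbol N U β p G) (i j : ℕ) :
    PowLogBound N U (p + (i + j : ℕ) * β) fun t => pdMix i j (G t) := by
  induction i generalizing p G with
  | zero =>
    induction j generalizing p G with
    | zero => simpa [pdMix] using (hG.bound 0).powLogBound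
    | succ j ih =>
      have := ih (hG.pdv (v := (0, 1)) (by simp [coordDirs]))
      simp only [pdMix_pdv_snd] at this
      convert this using 1
      push_cast
      ring
  | succ i ih =>
    have := ih (hG.pdv (v := (1, 0)) (by simp [coordDirs]))
    simp only [pdMix_pdv_fst (hG.smooth _)] at this
    convert this using 1
    push_cast
    ring

lemma of_pdMix (hs : ∀ t, ContDiff ℝ (⊤ : ℕ∞) (G t))
    (h : ∀ i j : ℕ, PowLogBound N U (p + (i + j : ℕ) * β) fun t => pdMix i j (G t)) :
    IsSymbol N U β p G := by
  refine ⟨hs, fun n => ?_⟩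
  suffices H : ∀ i j : ℕ, SymbolUpTo N U β n (p + (i + j : ℕ) * β) fun t => pdMix i j (G t) by
    simpa [pdMix] using H 0 0
  induction n with
  | zero => exact h
  | succ n ih =>
    refine fun i j => ⟨h i j, ?_⟩
    rintro v (rfl | rfl)
    · simp only [pdv_fst_pdMix]
      convert ih (i + 1) j using 1
      push_cast
      ring
    · simp only [pdv_snd_pdMix (hs _)]
      convert ih i (j + 1) using 1
      push_cast
      ring

/-- A symbol supported in `U` has uniformly bounded `C^j` norms. -/
lemma exists_CkNorm_le (hN : ∀ t, 2 < N t) (hβ : 0 ≤ β)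
    (hU : ∀ t, (U t)ᶜ ⊆ closure (interior (U t)ᶜ)) (hG : IsSymbol N U β p G)
    (h0 : ∀ t, ∀ x ∉ U t, G t x = 0) (k : ℕ) :
    ∃ A : ℝ, 0 ≤ A ∧ ∃ B : ℕ, ∀ t,
      CkNorm k (G t) ≤ A * N t ^ (p + k * β) * (2 * Real.log (N t)) ^ B := by
  have hb : PowLogBound N U (p + k * β) fun t x => ∑ i ∈ Finset.range (k + 1),
      ∑ j ∈ Finset.range (k + 1), if i + j ≤ k then |pdMix i j (G t) x| else 0 := by
    have hsum (s : Finset ℕ) (H : ℕ → ι → ℝ × ℝ → ℝ)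
        (h : ∀ i, PowLogBound N U (p + k * β) (H i)) :
        PowLogBound N U (p + k * β) fun t x => ∑ i ∈ s, H i t x := by
      classical
      induction s using Finset.induction_on with
      | empty => exact ⟨0, le_rfl, 0, fun t x _ => by simp⟩
      | insert i s hi ih =>
        simp only [Finset.sum_insert hi]
        exact (h i).add hN ih
    refine hsum _ _ fun i => hsum _ _ fun j => ?_
    split_ifs with hij
    · obtain ⟨A, hA, B, h⟩ := (hG.pdMix_powLogBound i j).mono hN
        (q := p + k * β) (by gcongr)
      exact ⟨A, hA, B, fun t x hx => by simpa only [abs_abs] using h t x hx⟩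
    · exact ⟨0, le_rfl, 0, fun t x _ => by simp⟩
  obtain ⟨A, hA, B, h⟩ := hb
  refine ⟨A, hA, B, fun t => CkNorm_le fun i j x hij => ?_⟩
  have hL := one_le_two_mul_log (hN t)
  have hN0 : 0 < N t := by linarith [hN t]
  by_cases hx : x ∈ U t
  · refine le_trans ?_ ((le_abs_self _).trans (h t x hx))
    have hnn (i j : ℕ) : 0 ≤ if i + j ≤ k then |pdMix i j (G t) x| else 0 := by
      split_ifs <;> positivity
    calc |pdMix i j (G t) x| = if i + j ≤ k then |pdMix i j (G t) x| else 0 := by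
          rw [if_pos hij]
      _ ≤ ∑ j ∈ Finset.range (k + 1), if i + j ≤ k then |pdMix i j (G t) x| else 0 :=
        Finset.single_le_sum (f := fun j => if i + j ≤ k then |pdMix i j (G t) x| else 0)
          (fun j _ => hnn i j) (Finset.mem_range.2 (by omega))
      _ ≤ _ := Finset.single_le_sum (f := fun i => ∑ j ∈ Finset.range (k + 1),
          if i + j ≤ k then |pdMix i j (G t) x| else 0)
        (fun i _ => Finset.sum_nonneg fun j _ => hnn i j) (Finset.mem_range.2 (by omega))
  · rw [pdMix_eq_zero_of_notMem (hU t) i j (hG.smooth t) (h0 t) x hx, abs_zero]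
    positivity

end IsSymbol

/-- `F` is a combination of the sine and cosine of the phase `φ` whose amplitudes are symbols of
degree `p` supported in `U`. -/
def IsModulated (N : ι → ℝ) (U : ι → Set (ℝ × ℝ)) (β : ℝ) (φ : ι → ℝ × ℝ → ℝ) (p : ℝ)
    (F : ι → ℝ × ℝ → ℝ) : Prop :=
  ∃ G₁ G₂ : ι → ℝ × ℝ → ℝ, IsSymbol N U β p G₁ ∧ IsSymbol N U β p G₂ ∧
    (∀ t, ∀ x ∉ U t, G₁ t x = 0) ∧ (∀ t, ∀ x ∉ U t, G₂ t x = 0) ∧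
    ∀ t, F t = fun x => G₁ t x * Real.sin (φ t x) + G₂ t x * Real.cos (φ t x)

lemma IsModulated.pdv (hN : ∀ t, 2 < N t) (hU : ∀ t, (U t)ᶜ ⊆ closure (interior (U t)ᶜ))
    {φ : ι → ℝ × ℝ → ℝ} (hφ : ∀ t, ContDiff ℝ (⊤ : ℕ∞) (φ t)) {v : ℝ × ℝ} (hv : v ∈ coordDirs)
    (hφv : IsSymbol N U β q fun t => pdv v (φ t)) (hβq : β ≤ q) (hF : IsModulated N U β φ p F) :
    IsModulated N U β φ (p + q) fun t => pdv v (F t) := by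
  obtain ⟨G₁, G₂, h₁, h₂, z₁, z₂, hF⟩ := hF
  refine ⟨fun t x => _root_.pdv v (G₁ t) x + -(G₂ t x * _root_.pdv v (φ t) x),
    fun t x => _root_.pdv v (G₂ t) x + G₁ t x * _root_.pdv v (φ t) x,
    ((h₁.pdv hv).mono hN (by linarith)).add hN ((h₂.mul hN hφv).neg hN),
    ((h₂.pdv hv).mono hN (by linarith)).add hN (h₁.mul hN hφv), ?_, ?_, ?_⟩
  · intro t x hx
    simp [z₂ t x hx, pdv_eq_zero_of_notMem (hU t) (h₁.smooth t) (z₁ t) v x hx]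
  · intro t x hx
    simp [z₁ t x hx, pdv_eq_zero_of_notMem (hU t) (h₂.smooth t) (z₂ t) v x hx]
  · intro t
    change _root_.pdv v (F t) = _
    rw [hF t, pdv_add ((h₁.smooth t).mul (hφ t).sin) ((h₂.smooth t).mul (hφ t).cos),
      pdv_mul (h₁.smooth t) (hφ t).sin, pdv_mul (h₂.smooth t) (hφ t).cos, pdv_sin (hφ t),
      pdv_cos (hφ t)]
    ext x
    ring

lemma IsModulated.pdv_iterate (hN : ∀ t, 2 < N t)
    (hU : ∀ t, (U t)ᶜ ⊆ closure (interior (U t)ᶜ)) {φ : ι → ℝ × ℝ → ℝ}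
    (hφ : ∀ t, ContDiff ℝ (⊤ : ℕ∞) (φ t)) {v : ℝ × ℝ} (hv : v ∈ coordDirs)
    (hφv : IsSymbol N U β q fun t => _root_.pdv v (φ t)) (hβq : β ≤ q)
    (hF : IsModulated N U β φ p F) (m : ℕ) :
    IsModulated N U β φ (p + m * q) fun t => (_root_.pdv v)^[m] (F t) := by
  induction m with
  | zero => simpa using hF
  | succ m ih =>
    simp only [Function.iterate_succ_apply']
    convert ih.pdv hN hU hφ hv hφv hβq using 1
    push_cast
    ring

end Symbols

lemma log_rpow_le {s d : ℝ} (hs : 2 < s) (hd : 0 ≤ d) :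
    Real.log s ^ d ≤ (2 * Real.log s) ^ ⌈d⌉₊ := by
  have hL := one_le_two_mul_log hs
  calc Real.log s ^ d ≤ (2 * Real.log s) ^ d :=
        Real.rpow_le_rpow (by linarith) (by linarith) hd
    _ ≤ (2 * Real.log s) ^ (⌈d⌉₊ : ℝ) := Real.rpow_le_rpow_of_exponent_le hL (Nat.le_ceil d)
    _ = _ := Real.rpow_natCast _ _

/-- Concentrated amplitudes and polynomial phases obeying the given quantitative bounds. -/
structure WaveData (β c d : ℝ) (K : ℕ) (a b : ℕ → ℝ) where
  /-- the frequency -/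
  N : ℝ
  /-- the constant phase shift -/
  θ : ℝ
  /-- the amplitude -/
  f : ℝ × ℝ → ℝ
  /-- the coefficients of the polynomial phase -/
  cf : ℕ → ℕ → ℝ
  two_lt : 2 < N
  smooth : ContDiff ℝ (⊤ : ℕ∞) f
  support : ∀ x : ℝ × ℝ, f x ≠ 0 → x.1 ^ 2 + x.2 ^ 2 < (N ^ (-β) * Real.log N ^ (4 : ℕ)) ^ 2
  CkNorm_le : ∀ m : ℕ, CkNorm m f ≤ a m * N ^ ((m : ℝ) * β) * Real.log N ^ (b m)
  abs_cf_le : ∀ i q : ℕ, i ≤ q → 2 ≤ q → q ≤ K → |cf i q| ≤ c * Real.log N ^ d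

namespace WaveData

variable {β c d : ℝ} {K : ℕ} {a b : ℕ → ℝ}

/-- The radius of the disc in which the amplitude is supported. -/
noncomputable def radius (t : WaveData β c d K a b) : ℝ := t.N ^ (-β) * Real.log t.N ^ (4 : ℕ)

lemma radius_pos (t : WaveData β c d K a b) : 0 < t.radius := by
  have := one_le_two_mul_log t.two_lt
  have hL : 0 < Real.log t.N := by linarith
  have hN : 0 < t.N := by linarith [t.two_lt]
  unfold radius
  positivity

lemma f_eq_zero (t : WaveData β c d K a b) {x : ℝ × ℝ} (hx : x ∉ euclDisc t.radius) :
    t.f x = 0 := by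
  contrapose! hx
  exact t.support x hx

lemma isSymbol_amplitude (ha : ∀ m, 0 ≤ a m) (hb : ∀ m, 0 ≤ b m) :
    IsSymbol (fun t : WaveData β c d K a b => t.N) (fun t => euclDisc t.radius) β 0
      fun t => t.f := by
  refine IsSymbol.of_pdMix (fun t => t.smooth) fun i j =>
    ⟨a (i + j), ha _, ⌈b (i + j)⌉₊, fun t x _ => ?_⟩
  have hN : 0 < t.N := by linarith [t.two_lt]
  have hc := hasCompactSupport_of_euclDisc t.radius_pos fun x hx => t.f_eq_zero hx
  refine (abs_pdMix_le_CkNorm t.smooth hc le_rfl x).trans ((t.CkNorm_le (i + j)).trans ?_)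
  rw [zero_add]
  exact mul_le_mul_of_nonneg_left (log_rpow_le t.two_lt (hb _))
    (mul_nonneg (ha _) (by positivity))

lemma isSymbol_coord (ℓ : ℝ × ℝ →L[ℝ] ℝ) (h : ∀ x, ℓ x ^ 2 ≤ x.1 ^ 2 + x.2 ^ 2) :
    IsSymbol (fun t : WaveData β c d K a b => t.N) (fun t => euclDisc t.radius) β (-β)
      fun _ x => ℓ x := by
  refine IsSymbol.of_linear ℓ ⟨1, zero_le_one, 4, fun t x hx => ?_⟩
  have hL := one_le_two_mul_log t.two_lt
  have hN : 0 < t.N := by linarith [t.two_lt]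
  calc |ℓ x| ≤ t.radius := abs_le_of_sq_le_sq ((h x).trans (le_of_lt hx)) t.radius_pos.le
    _ = 1 * t.N ^ (-β) * Real.log t.N ^ 4 := by rw [radius, one_mul]
    _ ≤ _ := by
      gcongr
      all_goals linarith

lemma isSymbol_phase (hβ : 0 ≤ β) (hc : 0 ≤ c) (hd : 0 ≤ d) :
    IsSymbol (fun t : WaveData β c d K a b => t.N) (fun t => euclDisc t.radius) β (1 - 2 * β)
      fun t x => t.N * polyPhase K t.cf x := by
  have hN (t : WaveData β c d K a b) : 2 < t.N := t.two_lt
  have hfst := isSymbol_coord (β := β) (c := c) (d := d) (K := K) (a := a) (b := b)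
    (ContinuousLinearMap.fst ℝ ℝ ℝ) fun x => by simp; positivity
  have hsnd := isSymbol_coord (β := β) (c := c) (d := d) (K := K) (a := a) (b := b)
    (ContinuousLinearMap.snd ℝ ℝ ℝ) fun x => by simp; positivity
  have hfreq : IsSymbol (fun t : WaveData β c d K a b => t.N) (fun t => euclDisc t.radius) β 1
      fun t _ => t.N :=
    isSymbol_const ⟨1, zero_le_one, 0, fun t x _ => by
      simp [abs_of_pos (show 0 < t.N by linarith [t.two_lt])]⟩
  have hpoly : IsSymbol (fun t : WaveData β c d K a b => t.N) (fun t => euclDisc t.radius) β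
      (-2 * β) fun t x => polyPhase K t.cf x := by
    unfold polyPhase
    refine IsSymbol.sum hN _ fun q hq => IsSymbol.sum hN _ fun i hi => ?_
    obtain ⟨hq2, hqK⟩ := Finset.mem_Icc.1 hq
    have hiq : i ≤ q := Nat.lt_succ_iff.1 (Finset.mem_range.1 hi)
    have hcoef : IsSymbol (fun t : WaveData β c d K a b => t.N) (fun t => euclDisc t.radius) β 0
        fun t _ => t.cf i q := by
      refine isSymbol_const ⟨c, hc, ⌈d⌉₊, fun t x _ => ?_⟩
      rw [Real.rpow_zero, mul_one]
      exact (t.abs_cf_le i q hiq hq2 hqK).trans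
        (mul_le_mul_of_nonneg_left (log_rpow_le t.two_lt hd) hc)
    refine ((hcoef.mul hN (hfst.pow hN i)).mul hN (hsnd.pow hN (q - i))).mono hN ?_
    have : (2 : ℝ) ≤ q := by exact_mod_cast hq2
    rw [Nat.cast_sub hiq]
    nlinarith
  convert hfreq.mul hN hpoly using 1
  ring

end WaveData

/-- Structure of derivatives of a concentrated modulated wave. -/
theorem concentrated_wave_derivative_structure
    (β : ℝ) (hβ : β ∈ Set.Ioo (0 : ℝ) (1 / 2)) (c d : ℝ) (hc : 0 < c) (hd : 0 < d)
    (K : ℕ) (a b : ℕ → ℝ) (ha : ∀ m, 0 < a m) (hb : ∀ m, 0 < b m) :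
    ∀ k j : ℕ, ∃ abar > 0, ∃ bbar > 0,
      ∀ N : ℝ, 2 < N → N ^ (-β) * Real.log N ^ (4 : ℕ) ≤ 1 →
      ∀ θ₀ : ℝ,
      ∀ fN : ℝ × ℝ → ℝ, ContDiff ℝ (⊤ : ℕ∞) fN →
        -- `supp fN ⊂ B_{N^{-β}(ln N)⁴}(0)`
        (∀ x : ℝ × ℝ, fN x ≠ 0 →
          x.1 ^ 2 + x.2 ^ 2 < (N ^ (-β) * Real.log N ^ (4 : ℕ)) ^ 2) →
        (∀ m : ℕ, CkNorm m fN ≤ a m * N ^ ((m : ℝ) * β) * Real.log N ^ (b m)) →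
      ∀ cf : ℕ → ℕ → ℝ,
        (∀ i q : ℕ, i ≤ q → 2 ≤ q → q ≤ K → |cf i q| ≤ c * Real.log N ^ d) →
      ∀ i : ℕ, i ≤ k →
        ∃ g1 g2 : ℝ × ℝ → ℝ, ContDiff ℝ (⊤ : ℕ∞) g1 ∧ ContDiff ℝ (⊤ : ℕ∞) g2 ∧
          (∀ x : ℝ × ℝ, g1 x ≠ 0 →
            x.1 ^ 2 + x.2 ^ 2 < (N ^ (-β) * Real.log N ^ (4 : ℕ)) ^ 2) ∧
          (∀ x : ℝ × ℝ, g2 x ≠ 0 →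
            x.1 ^ 2 + x.2 ^ 2 < (N ^ (-β) * Real.log N ^ (4 : ℕ)) ^ 2) ∧
          (∀ x : ℝ × ℝ,
            pdMix (k - i) i (fun y => fN y * Real.sin (N * polyPhase K cf y + θ₀)) x
              = g1 x * Real.sin (N * polyPhase K cf x + θ₀)
                + g2 x * Real.cos (N * polyPhase K cf x + θ₀)) ∧
          CkNorm j g1 ≤ abar * N ^ ((k : ℝ) * (1 - β) + (j : ℝ) * β) * Real.log N ^ bbar ∧
          CkNorm j g2 ≤ abar * N ^ ((k : ℝ) * (1 - β) + (j : ℝ) * β) * Real.log N ^ bbar := by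
  have hβ0 : 0 < β := hβ.1
  have hβ2 : β < 1 / 2 := hβ.2
  intro k j
  let N : WaveData β c d K a b → ℝ := fun t => t.N
  let U : WaveData β c d K a b → Set (ℝ × ℝ) := fun t => euclDisc t.radius
  let φ : WaveData β c d K a b → ℝ × ℝ → ℝ := fun t x => t.N * polyPhase K t.cf x + t.θ
  have hN (t) : 2 < N t := t.two_lt
  have hU (t) : (U t)ᶜ ⊆ closure (interior (U t)ᶜ) := compl_euclDisc_subset t.radius_pos
  have hphase : IsSymbol N U β (1 - 2 * β) fun t x => t.N * polyPhase K t.cf x :=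
    WaveData.isSymbol_phase hβ0.le hc.le hd.le
  have hφ (t) : ContDiff ℝ (⊤ : ℕ∞) (φ t) := (hphase.smooth t).add contDiff_const
  have hdir {v : ℝ × ℝ} (hv : v ∈ coordDirs) : IsSymbol N U β (1 - β) fun t => pdv v (φ t) := by
    convert hphase.pdv hv using 1
    · ring
    · ext t x
      simp only [φ, pdv_add (hphase.smooth t) contDiff_const, pdv_const, add_zero]
  have hbase : IsModulated N U β φ 0 fun t x => t.f x * Real.sin (φ t x) :=
    ⟨fun t => t.f, fun _ _ => 0, WaveData.isSymbol_amplitude (fun m => (ha m).le)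
      (fun m => (hb m).le), isSymbol_zero, fun t x => t.f_eq_zero, fun _ _ _ => rfl,
      fun t => by simp⟩
  have hmod (i : ℕ) (hi : i ≤ k) : IsModulated N U β φ (k * (1 - β)) fun t =>
      pdMix (k - i) i fun x => t.f x * Real.sin (φ t x) := by
    have h₂ : ((0, 1) : ℝ × ℝ) ∈ coordDirs := by simp [coordDirs]
    have h₁ : ((1, 0) : ℝ × ℝ) ∈ coordDirs := by simp [coordDirs]
    convert (hbase.pdv_iterate hN hU hφ h₂ (hdir h₂) (by linarith) i).pdv_iterate hN hU hφ h₁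
      (hdir h₁) (by linarith) (k - i) using 1
    · rw [Nat.cast_sub hi]
      ring
    · rfl
  have hbound (i : ℕ) (hi : i ≤ k) : ∃ A : ℝ, 0 ≤ A ∧ ∃ B : ℕ, ∀ t, ∃ g₁ g₂ : ℝ × ℝ → ℝ,
      ContDiff ℝ (⊤ : ℕ∞) g₁ ∧ ContDiff ℝ (⊤ : ℕ∞) g₂ ∧
      (∀ x ∉ U t, g₁ x = 0) ∧ (∀ x ∉ U t, g₂ x = 0) ∧
      ((pdMix (k - i) i fun x => t.f x * Real.sin (φ t x)) =
        fun x => g₁ x * Real.sin (φ t x) + g₂ x * Real.cos (φ t x)) ∧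
      CkNorm j g₁ ≤ A * N t ^ (k * (1 - β) + j * β) * (2 * Real.log (N t)) ^ B ∧
      CkNorm j g₂ ≤ A * N t ^ (k * (1 - β) + j * β) * (2 * Real.log (N t)) ^ B := by
    obtain ⟨G₁, G₂, h₁, h₂, z₁, z₂, hG⟩ := hmod i hi
    obtain ⟨A₁, hA₁, B₁, hB₁⟩ := h₁.exists_CkNorm_le hN hβ0.le hU z₁ j
    obtain ⟨A₂, hA₂, B₂, hB₂⟩ := h₂.exists_CkNorm_le hN hβ0.le hU z₂ j
    refine ⟨A₁ + A₂, by positivity, B₁ + B₂, fun t => ⟨G₁ t, G₂ t, h₁.smooth t, h₂.smooth t,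
      z₁ t, z₂ t, hG t, (hB₁ t).trans ?_, (hB₂ t).trans ?_⟩⟩ <;>
    · have hL := one_le_two_mul_log (hN t)
      have hN0 : 0 < N t := by linarith [hN t]
      gcongr
      · linarith
      · omega
  choose! A hA B hAB using hbound
  have hA0 (i) (hi : i ∈ Finset.range (k + 1)) : 0 ≤ A i :=
    hA i (Nat.lt_succ_iff.1 (Finset.mem_range.1 hi))
  have hS : 0 ≤ ∑ i ∈ Finset.range (k + 1), A i := Finset.sum_nonneg hA0
  set B' := ∑ i ∈ Finset.range (k + 1), B i
  refine ⟨(∑ i ∈ Finset.range (k + 1), A i + 1) * 2 ^ (B' + 1), by positivity,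
    B' + 1, by positivity, ?_⟩
  intro M hM _ θ₀ f hf hsupp hnorm cf hcf i hi
  obtain ⟨g₁, g₂, s₁, s₂, z₁, z₂, hg, n₁, n₂⟩ :=
    hAB i hi ⟨M, θ₀, f, cf, hM, hf, hsupp, hnorm, hcf⟩
  have hL := one_le_two_mul_log hM
  have hM0 : 0 < M := by linarith
  have hi' : i ∈ Finset.range (k + 1) := Finset.mem_range.2 (Nat.lt_succ_iff.2 hi)
  have hAi : A i ≤ ∑ i ∈ Finset.range (k + 1), A i + 1 := by
    linarith [Finset.single_le_sum hA0 hi']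
  have hBi : B i ≤ B' + 1 :=
    (Finset.single_le_sum (f := B) (fun _ _ => Nat.zero_le _) hi').trans (Nat.le_succ _)
  have hle : A i * M ^ (k * (1 - β) + j * β) * (2 * Real.log M) ^ B i ≤
      (∑ i ∈ Finset.range (k + 1), A i + 1) * 2 ^ (B' + 1) * M ^ (k * (1 - β) + j * β) *
        Real.log M ^ (B' + 1) := by
    calc _ ≤ (∑ i ∈ Finset.range (k + 1), A i + 1) * M ^ (k * (1 - β) + j * β) *
          (2 * Real.log M) ^ (B' + 1) := by gcongr
      _ = _ := by rw [mul_pow]; ring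
  exact ⟨g₁, g₂, s₁, s₂, fun x => not_imp_comm.1 (z₁ x), fun x => not_imp_comm.1 (z₂ x),
    fun x => congrFun hg x, n₁.trans hle, n₂.trans hle⟩
end
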